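/- Let M be a σ-compact, non-compact, connected 2-manifold with boundary. If M contains an embedded Möbius band and ∂M has a connected component homeomorphic to the circle S¹, then the mapping class group 𝓜_c(M) = 𝓗_c(M)/𝓗₀(M) contains an element of infinite order. -/

import Mathlib

noncomputable section

open scoped Pointwise

/-- The Whitney topology on the homeomorphism group of a space `M`:
it is generated by the sets `{f | graph f ⊆ U}` where `U` runs over the open subsets
of `M × M`. -/
def whitneyTopology (M : Type*) [TopologicalSpace M] : TopologicalSpace (M ≃ₜ M) :=
  TopologicalSpace.generateFrom
    {S : Set (M ≃ₜ M) | ∃ U : Set (M × M), IsOpen U ∧ S = {f : M ≃ₜ M | ∀ x : M, (x, f x) ∈ U}}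

/-- We endow the homeomorphism group `𝓗(M)` with the Whitney topology. -/
instance (M : Type*) [TopologicalSpace M] : TopologicalSpace (M ≃ₜ M) := whitneyTopology M

/-- `𝓗_c(M)`: the set of compactly supported homeomorphisms of `M`. -/
def Hc (M : Type*) [TopologicalSpace M] : Set (M ≃ₜ M) :=
  {f : M ≃ₜ M | IsCompact (closure {x : M | f x ≠ x})}

/-- `𝓗₀(M)`: the identity component of the homeomorphism group of `M` with
the Whitney topology. -/
def H0 (M : Type*) [TopologicalSpace M] : Set (M ≃ₜ M) :=
  connectedComponent (Homeomorph.refl M)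

/-- The `n`-th power (iterate) of a self-homeomorphism. -/
def hpow {M : Type*} [TopologicalSpace M] (h : M ≃ₜ M) : ℕ → (M ≃ₜ M)
  | 0 => Homeomorph.refl M
  | n + 1 => (hpow h n).trans h

/-- The circle `S¹`. -/
abbrev Circle2 : Type := ↥(Metric.sphere (0 : EuclideanSpace ℝ (Fin 2)) 1)

/-- The boundary `∂M` of a 2-manifold `M` modelled on the half-plane. -/
abbrev surfaceBoundary (M : Type*) [TopologicalSpace M]
    [ChartedSpace (EuclideanHalfSpace 2) M] : Set M :=
  ModelWithCorners.boundary (I := modelWithCornersEuclideanHalfSpace 2) M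

/-- The gluing relation for the Möbius band: `(0, t) ∼ (1, 1 - t)`. -/
def mobiusRel (p q : unitInterval × unitInterval) : Prop :=
  p.1 = 0 ∧ q.1 = 1 ∧ (q.2 : ℝ) = 1 - (p.2 : ℝ)

/-- The Möbius band: the quotient of `[0,1] × [0,1]` identifying `(0,t)` with `(1, 1-t)`. -/
def MobiusBand : Type := Quot mobiusRel

instance : TopologicalSpace MobiusBand :=
  inferInstanceAs (TopologicalSpace (Quot mobiusRel))

/-- The boundary circle of the Möbius band: the image of `[0,1] × {0,1}`. -/
def mobiusBoundary : Set MobiusBand :=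
  Quot.mk _ '' {p : unitInterval × unitInterval | p.2 = 0 ∨ p.2 = 1}

namespace SurfaceMCG

open Set Filter Topology Metric

/-- The direction `z / ‖z‖` of a nonzero complex number, as a point of the unit circle. -/
def dir (z : ℂ) : Circle := Circle.exp z.arg

lemma coe_dir {z : ℂ} (hz : z ≠ 0) : (dir z : ℂ) = z / ‖z‖ := by
  have h : (‖z‖ : ℂ) ≠ 0 := by exact_mod_cast norm_ne_zero_iff.2 hz
  rw [dir, Circle.coe_exp, eq_div_iff h, mul_comm]
  exact Complex.norm_mul_exp_arg_mul_I z

lemma isEmbedding_circle_coe : IsEmbedding (fun z : Circle => (z : ℂ)) :=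
  ⟨⟨rfl⟩, Circle.coe_injective⟩

lemma continuousAt_dir {z : ℂ} (hz : z ≠ 0) : ContinuousAt dir z := by
  have h1 : ContinuousAt (fun w : ℂ => w / (‖w‖ : ℂ)) z := by
    refine ContinuousAt.div continuousAt_id ?_ (by exact_mod_cast norm_ne_zero_iff.2 hz)
    exact (Complex.continuous_ofReal.comp continuous_norm).continuousAt
  rw [ContinuousAt, isEmbedding_circle_coe.tendsto_nhds_iff]
  have h2 : Tendsto (fun w : ℂ => w / (‖w‖ : ℂ)) (𝓝 z) (𝓝 (dir z : ℂ)) := by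
    rw [coe_dir hz]; exact h1
  refine h2.congr' ?_
  filter_upwards [isOpen_ne.mem_nhds hz] with w hw
  exact (coe_dir hw).symm

lemma dir_mul {z w : ℂ} (hz : z ≠ 0) (hw : w ≠ 0) : dir (z * w) = dir z * dir w := by
  apply Subtype.ext
  change (dir (z * w) : ℂ) = (dir z : ℂ) * (dir w : ℂ)
  rw [coe_dir hz, coe_dir hw, coe_dir (mul_ne_zero hz hw), norm_mul]
  push_cast
  rw [mul_div_mul_comm]

lemma dir_neg {z : ℂ} (hz : z ≠ 0) : dir (-z) = Circle.exp Real.pi * dir z := by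
  have h : -z = (-1) * z := by ring
  rw [h, dir_mul (by norm_num) hz]
  congr 1
  simp [dir]

/-- Maps from simply connected, locally path connected spaces to the circle lift to `ℝ`. -/
lemma exists_circle_lift {X : Type*} [TopologicalSpace X] [SimplyConnectedSpace X]
    [LocallyPathConnectedSpace X] {f : X → Circle} (hf : Continuous f) :
    ∃ F : X → ℝ, Continuous F ∧ ∀ x, Circle.exp (F x) = f x := by
  obtain ⟨a⟩ : Nonempty X := inferInstance
  obtain ⟨F, ⟨-, hF⟩, -⟩ := Circle.isCoveringMap_exp.existsUnique_continuousMap_lifts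
    (⟨f, hf⟩ : C(X, Circle)) a ((f a : ℂ).arg) (by simp)
  exact ⟨F, F.continuous, fun x => congrFun hF x⟩

lemma exists_int_of_exp_eq {X : Type*} [TopologicalSpace X] {s : Set X} (hs : IsPreconnected s)
    {F G : X → ℝ} (hF : ContinuousOn F s) (hG : ContinuousOn G s)
    (h : ∀ x ∈ s, Circle.exp (F x) = Circle.exp (G x)) :
    ∃ m : ℤ, ∀ x ∈ s, F x = G x + m * (2 * Real.pi) := by
  rcases s.eq_empty_or_nonempty with rfl | ⟨a, ha⟩
  · exact ⟨0, by simp⟩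
  have hpi : (2 * Real.pi) ≠ 0 := by positivity
  have hD : DiscreteTopology (range (Int.cast : ℤ → ℝ)) :=
    (Int.isClosedEmbedding_coe_real.isEmbedding.toHomeomorph.symm.isEmbedding).discreteTopology
  have hmap : MapsTo (fun x => (F x - G x) / (2 * Real.pi)) s (range (Int.cast : ℤ → ℝ)) := by
    intro x hx
    obtain ⟨m, hm⟩ := Circle.exp_eq_exp.1 (h x hx)
    exact ⟨m, by simp only; rw [hm]; field_simp; ring⟩
  obtain ⟨m, hm⟩ := hmap ha
  refine ⟨m, fun x hx => ?_⟩
  have := hs.constant_of_mapsTo ⟨hD⟩ ((hF.sub hG).div_const (2 * Real.pi)) hmap hx ha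
  simp only [Pi.sub_apply] at this hm
  rw [← hm] at this
  field_simp at this
  linarith

/-- A loop `ℝ → ℂ` of period `2π` has a periodic argument function. -/
def Inessential (g : ℝ → ℂ) : Prop :=
  ∃ G : ℝ → ℝ, Continuous G ∧ (∀ x, G (x + 2 * Real.pi) = G x) ∧
    ∀ x, Circle.exp (G x) = dir (g x)

lemma Inessential.homotopy {H : ℝ → ℝ → ℂ}
    (hc : ContinuousOn (fun p : ℝ × ℝ => H p.1 p.2) (univ ×ˢ Icc 0 1))
    (hper : ∀ x s, H (x + 2 * Real.pi) s = H x s) (hne : ∀ x, ∀ s ∈ Icc (0 : ℝ) 1, H x s ≠ 0)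
    (h0 : Inessential fun x => H x 0) : Inessential fun x => H x 1 := by
  let c : ℝ → ℝ := fun s => max 0 (min 1 s)
  have hcc : Continuous c := by fun_prop
  have hcm : ∀ s, c s ∈ Icc (0 : ℝ) 1 := fun s => ⟨by simp [c], by simp [c]⟩
  have hK : Continuous fun p : ℝ × ℝ => dir (H p.1 (c p.2)) := by
    rw [continuous_iff_continuousAt]
    intro p
    have h1 : Continuous fun p : ℝ × ℝ => H p.1 (c p.2) :=
      hc.comp_continuous (f := fun p : ℝ × ℝ => (p.1, c p.2)) (by fun_prop)
        (fun p => ⟨mem_univ _, hcm _⟩)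
    exact ContinuousAt.comp (g := dir) (continuousAt_dir (hne _ _ (hcm _))) h1.continuousAt
  obtain ⟨F, hF, hFe⟩ := exists_circle_lift hK
  obtain ⟨G, hG, hGp, hGe⟩ := h0
  obtain ⟨m, hm⟩ := exists_int_of_exp_eq (F := fun p : ℝ × ℝ => F (p.1 + 2 * Real.pi, p.2))
    (G := F) (isPreconnected_univ) (by fun_prop) (by fun_prop)
    (fun p _ => by rw [hFe, hFe, hper])
  obtain ⟨n, hn⟩ := exists_int_of_exp_eq (F := fun x => F (x, 0))
    (G := G) (isPreconnected_univ) (by fun_prop) (by fun_prop)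
    (fun x _ => by rw [hFe, hGe]; simp [c])
  have e1 := hn 0 trivial
  have e2 := hn (0 + 2 * Real.pi) trivial
  have e3 := hm (0, 0) trivial
  simp only [hGp] at e1 e2 e3
  refine ⟨fun x => F (x, 1), by fun_prop, fun x => ?_, fun x => ?_⟩
  · have := hm (x, 1) trivial
    simp only at this ⊢
    linarith
  · rw [hFe]; simp [c]

lemma Inessential.not_odd {g : ℝ → ℂ} (h : Inessential g) (hne : ∀ x, g x ≠ 0)
    (hodd : ∀ x, g (x + Real.pi) = -g x) : False := by
  obtain ⟨G, hG, hGp, hGe⟩ := h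
  obtain ⟨m, hm⟩ := exists_int_of_exp_eq (F := fun x => G (x + Real.pi))
    (G := fun x => Real.pi + G x) (isPreconnected_univ) (by fun_prop) (by fun_prop)
    (fun x _ => by rw [hGe, hodd, dir_neg (hne x), Circle.exp_add, hGe])
  have e1 := hm 0 trivial
  have e2 := hm (0 + Real.pi) trivial
  have e3 := hGp 0
  have e4 : (0 : ℝ) + Real.pi + Real.pi = 0 + 2 * Real.pi := by ring
  simp only [e4] at e1 e2
  have : (2 * Real.pi) * (1 + 2 * m) = 0 := by linarith
  have h3 : (1 + 2 * (m : ℝ)) = 0 := by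
    rcases mul_eq_zero.1 this with h | h
    · exact absurd h (by positivity)
    · exact h
  have : 1 + 2 * m = 0 := by exact_mod_cast h3
  omega

lemma mem_interior_image_closedBall {f : ℂ → ℂ} (hc : ContinuousOn f (closedBall 0 1))
    (hi : InjOn f (closedBall 0 1)) : f 0 ∈ interior (f '' closedBall 0 1) := by
  let e : ℝ → ℂ := fun x => Circle.exp x
  have he : Continuous e := by fun_prop
  have hen : ∀ x, ‖e x‖ = 1 := fun x => Circle.norm_coe _
  have hep : ∀ x, e (x + 2 * Real.pi) = e x := fun x => by
    simp only [e, Circle.exp_add, Circle.exp_two_pi, mul_one]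
  have heo : ∀ x, e (x + Real.pi) = -e x := fun x => by
    simp only [e, Circle.exp_add]
    push_cast
    simp
  have hK : IsCompact (sphere (0 : ℂ) 1) := isCompact_sphere _ _
  have hsub : sphere (0 : ℂ) 1 ⊆ closedBall 0 1 := sphere_subset_closedBall
  obtain ⟨z0, hz0, hmin⟩ := hK.exists_isMinOn ⟨1, by simp⟩
    (((hc.mono hsub).sub continuousOn_const).norm : ContinuousOn (fun z => ‖f z - f 0‖) _)
  have hr : 0 < ‖f z0 - f 0‖ := by
    rw [norm_pos_iff, sub_ne_zero]
    intro h
    have := hi (hsub hz0) (by simp) h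
    simp [this] at hz0
  have hmin' : ∀ x, ‖f z0 - f 0‖ ≤ ‖f (e x) - f 0‖ := fun x => hmin (by simp [hen])
  rw [mem_interior_iff_mem_nhds]
  refine mem_of_superset (ball_mem_nhds _ hr) fun q hq => ?_
  by_contra hqn
  have hqn' : ∀ z ∈ closedBall (0 : ℂ) 1, f z - q ≠ 0 := fun z hz h =>
    hqn ⟨z, hz, sub_eq_zero.1 h⟩
  have hs1 : ∀ x : ℝ, ∀ s ∈ Icc (0 : ℝ) 1, (s : ℂ) * e x ∈ closedBall (0 : ℂ) 1 := by
    intro x s hs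
    simp [hen, abs_of_nonneg hs.1, hs.2]
  have n0 : Inessential fun x => f ((0 : ℝ) * e x) - q :=
    ⟨fun _ => (f 0 - q).arg, continuous_const, fun _ => rfl, fun x => by simp [dir]⟩
  have n1 := Inessential.homotopy (H := fun x s => f ((s : ℂ) * e x) - q)
    (by
      refine ContinuousOn.sub (hc.comp (by fun_prop) ?_) continuousOn_const
      rintro ⟨x, s⟩ ⟨-, hs⟩
      exact hs1 x s hs)
    (fun x s => by simp only [hep]) (fun x s hs => hqn' _ (hs1 x s hs)) n0
  have n2 := Inessential.homotopy (H := fun x s => f (e x) - (q + (s : ℂ) * (f 0 - q)))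
    (by
      refine ContinuousOn.sub (hc.comp (by fun_prop) ?_) (by fun_prop)
      rintro ⟨x, s⟩ -
      simp [hen])
    (fun x s => by simp only [hep]) (fun x s hs h => by
      have h1 : f (e x) - f 0 = (1 - (s : ℂ)) * (q - f 0) := by
        rw [sub_eq_zero] at h
        rw [h]; ring
      have h2 := hmin' x
      rw [h1, norm_mul] at h2
      have h3 : ‖(1 - (s : ℂ))‖ ≤ 1 := by
        have : (1 - (s : ℂ)) = ((1 - s : ℝ) : ℂ) := by push_cast; rfl
        rw [this, Complex.norm_real, Real.norm_eq_abs, abs_le]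
        constructor <;> linarith [hs.1, hs.2]
      have h4 : ‖q - f 0‖ < ‖f z0 - f 0‖ := by simpa [dist_eq_norm] using hq
      have := mul_le_of_le_one_left (norm_nonneg (q - f 0)) h3
      linarith) (by simpa using n1)
  have hA : ∀ x : ℝ, ∀ s ∈ Icc (0 : ℝ) 1,
      ((1 / (1 + s) : ℝ) : ℂ) * e x ∈ closedBall (0 : ℂ) 1 := by
    intro x s hs
    apply hs1
    have : 0 < 1 + s := by linarith [hs.1]
    exact ⟨by positivity, by rw [div_le_one this]; linarith [hs.1]⟩
  have hB : ∀ x : ℝ, ∀ s ∈ Icc (0 : ℝ) 1,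
      ((-(s / (1 + s)) : ℝ) : ℂ) * e x ∈ closedBall (0 : ℂ) 1 := by
    intro x s hs
    have : 0 < 1 + s := by linarith [hs.1]
    have h2 := hs1 x (s / (1 + s)) ⟨div_nonneg hs.1 this.le, by rw [div_le_one this]; linarith⟩
    rw [mem_closedBall_zero_iff] at h2 ⊢
    simpa using h2
  have hdv : ContinuousOn (fun p : ℝ × ℝ => (1 + p.2)⁻¹) (univ ×ˢ Icc 0 1) := by
    refine ContinuousOn.inv₀ (by fun_prop) ?_
    rintro ⟨x, s⟩ ⟨-, hs⟩
    exact ne_of_gt (by have := hs.1; simp only at this ⊢; linarith)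
  have n3 := Inessential.homotopy
    (H := fun x s => f (((1 / (1 + s) : ℝ) : ℂ) * e x) - f (((-(s / (1 + s)) : ℝ) : ℂ) * e x))
    (by
      refine ContinuousOn.sub (hc.comp ?_ ?_) (hc.comp ?_ ?_)
      · refine ContinuousOn.mul (Complex.continuous_ofReal.comp_continuousOn ?_) (by fun_prop)
        simpa only [one_div] using hdv
      · rintro ⟨x, s⟩ ⟨-, hs⟩
        exact hA x s hs
      · refine ContinuousOn.mul (Complex.continuous_ofReal.comp_continuousOn ?_) (by fun_prop)
        refine ContinuousOn.neg ?_
        simp only [div_eq_mul_inv]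
        exact ContinuousOn.mul (by fun_prop) hdv
      · rintro ⟨x, s⟩ ⟨-, hs⟩
        exact hB x s hs)
    (fun x s => by simp only [hep]) (fun x s hs h => by
      have h1 := hi (hA x s hs) (hB x s hs) (sub_eq_zero.1 h)
      have he0 : e x ≠ 0 := by rw [← norm_ne_zero_iff, hen]; norm_num
      have h2 := mul_right_cancel₀ he0 h1
      have h3 : (1 / (1 + s) : ℝ) = -(s / (1 + s)) := by exact_mod_cast h2
      have : 0 < 1 + s := by linarith [hs.1]
      field_simp at h3
      linarith [hs.1]) (by simpa using n2)
  refine n3.not_odd (fun x h => ?_) (fun x => ?_)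
  · have h1 := hi (hA x 1 (by simp)) (hB x 1 (by simp)) (sub_eq_zero.1 h)
    have he0 : e x ≠ 0 := by rw [← norm_ne_zero_iff, hen]; norm_num
    have h2 := mul_right_cancel₀ he0 h1
    have h3 : (1 / (1 + 1) : ℝ) = -(1 / (1 + 1)) := by exact_mod_cast h2
    norm_num at h3
  · simp only [heo]
    push_cast
    rw [show ((1 : ℂ) / (1 + 1)) * -e x = -(1 / (1 + 1)) * e x by ring,
      show (-((1 : ℂ) / (1 + 1))) * -e x = (1 / (1 + 1)) * e x by ring]
    ring

/-- Invariance of domain in the plane. -/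
theorem isOpen_image_complex {f : ℂ → ℂ} {U : Set ℂ} (hU : IsOpen U) (hc : ContinuousOn f U)
    (hi : InjOn f U) : IsOpen (f '' U) := by
  rw [isOpen_iff_mem_nhds]
  rintro _ ⟨z, hz, rfl⟩
  obtain ⟨r, hr, hrU⟩ := nhds_basis_closedBall.mem_iff.1 (hU.mem_nhds hz)
  have hm : MapsTo (fun w : ℂ => z + r * w) (closedBall 0 1) U := by
    intro w hw
    apply hrU
    rw [mem_closedBall_zero_iff] at hw
    simpa [abs_of_pos hr] using mul_le_of_le_one_right hr.le hw
  have := mem_interior_image_closedBall (f := fun w => f (z + r * w))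
    (hc.comp (by fun_prop) hm) (fun a ha b hb h => by
      have h1 := hi (hm ha) (hm hb) h
      have hr' : (r : ℂ) ≠ 0 := by exact_mod_cast hr.ne'
      exact mul_left_cancel₀ hr' (add_left_cancel h1))
  simp only [mul_zero, add_zero] at this
  refine mem_of_superset (mem_interior_iff_mem_nhds.1 this) ?_
  rintro _ ⟨w, hw, rfl⟩
  exact ⟨_, hm hw, rfl⟩

theorem isOpen_image_prod {f : ℝ × ℝ → ℝ × ℝ} {U : Set (ℝ × ℝ)} (hU : IsOpen U)
    (hc : ContinuousOn f U) (hi : InjOn f U) : IsOpen (f '' U) := by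
  let e : ℂ ≃ₜ ℝ × ℝ := Complex.equivRealProdCLM.toHomeomorph
  have h := isOpen_image_complex (f := e.symm ∘ f ∘ e) (hU.preimage e.continuous)
    (e.symm.continuous.comp_continuousOn
      (hc.comp e.continuous.continuousOn (mapsTo_preimage _ _)))
    (fun a ha b hb h => e.injective (hi ha hb (e.symm.injective h)))
  have h2 := e.isOpenMap _ h
  have : e '' ((e.symm ∘ f ∘ e) '' (e ⁻¹' U)) = f '' U := by
    rw [image_comp, image_comp, e.image_symm, image_preimage_eq _ e.surjective,
      image_preimage_eq _ e.surjective]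
  rwa [this] at h2

section Cells

variable {S : Type*} [TopologicalSpace S]

/-- A parametrized closed square in `S` with open interior. -/
structure IsCell (η : ℝ × ℝ → S) : Prop where
  cont : ContinuousOn η (closedBall 0 1)
  inj : InjOn η (closedBall 0 1)
  isOpen : IsOpen (η '' ball 0 1)

open Classical in
/-- The map of `S` that acts as `g` in the coordinates of `η`, and as the identity elsewhere. -/
def cellExt (η : ℝ × ℝ → S) (g : ℝ × ℝ → ℝ × ℝ) (x : S) : S :=
  if x ∈ η '' closedBall 0 1 then η (g (Function.invFunOn η (closedBall 0 1) x)) else x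

variable {η κ : ℝ × ℝ → S}

lemma closedBall_subset_closure_image (h : IsCell η) :
    η '' closedBall 0 1 ⊆ closure (η '' ball 0 1) := by
  have : closure (ball (0 : ℝ × ℝ) 1) = closedBall 0 1 := closure_ball _ one_ne_zero
  rw [← this]
  exact ContinuousOn.image_closure (this ▸ h.cont)

lemma IsCell.overlap (h : IsCell η) (h' : IsCell κ) {y : S} (hy : η '' closedBall 0 1 ∈ 𝓝 y)
    (hy' : κ '' closedBall 0 1 ∈ 𝓝 y) : (η '' ball 0 1 ∩ κ '' ball 0 1).Nonempty := by
  have h1 := closedBall_subset_closure_image h (mem_of_mem_nhds hy)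
  have h2 : interior (η '' closedBall 0 1) ∩ interior (κ '' closedBall 0 1) ∈ 𝓝 y :=
    inter_mem (interior_mem_nhds.2 hy) (interior_mem_nhds.2 hy')
  obtain ⟨z, ⟨hz1, hz2⟩, hz3⟩ := mem_closure_iff_nhds.1 h1 _ h2
  have h3 := closedBall_subset_closure_image h' (interior_subset hz2)
  obtain ⟨w, hw1, hw2⟩ := mem_closure_iff_nhds.1 h3 _ (h.isOpen.mem_nhds hz3)
  exact ⟨w, hw1, hw2⟩

lemma cellExt_apply (h : IsCell η) (g : ℝ × ℝ → ℝ × ℝ) {v : ℝ × ℝ}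
    (hv : v ∈ closedBall (0 : ℝ × ℝ) 1) : cellExt η g (η v) = η (g v) := by
  rw [cellExt, if_pos (mem_image_of_mem _ hv), h.inj.leftInvOn_invFunOn hv]

lemma cellExt_of_notMem (h : IsCell η) {g : ℝ × ℝ → ℝ × ℝ}
    (hs : ∀ v ∈ sphere (0 : ℝ × ℝ) 1, g v = v) {x : S} (hx : x ∉ η '' ball 0 1) :
    cellExt η g x = x := by
  by_cases hx' : x ∈ η '' closedBall 0 1
  · obtain ⟨v, hv, rfl⟩ := hx'
    rw [cellExt_apply h g hv, hs]
    rw [← ball_union_sphere] at hv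
    exact hv.resolve_left fun h1 => hx (mem_image_of_mem _ h1)
  · rw [cellExt, if_neg hx']

lemma IsCell.isCompact_image (h : IsCell η) : IsCompact (η '' closedBall 0 1) :=
  (isCompact_closedBall _ _).image_of_continuousOn h.cont

variable [T2Space S]

lemma continuousOn_image_of_comp {X Y Z : Type*} [TopologicalSpace X] [TopologicalSpace Y]
    [T2Space Y] [TopologicalSpace Z] {κ : X → Y} {F : Y → Z} {K : Set X} (hK : IsCompact K)
    (hκ : ContinuousOn κ K) (hF : ContinuousOn (F ∘ κ) K) : ContinuousOn F (κ '' K) := by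
  rw [continuousOn_iff_isClosed]
  intro t ht
  obtain ⟨u, hu, hu'⟩ := continuousOn_iff_isClosed.1 hF t ht
  refine ⟨κ '' (u ∩ K), ((hK.inter_left hu).image_of_continuousOn
    (hκ.mono inter_subset_right)).isClosed, ?_⟩
  rw [← hu']
  ext y
  constructor
  · rintro ⟨hy, x, hx, rfl⟩
    exact ⟨⟨x, ⟨hy, hx⟩, rfl⟩, x, hx, rfl⟩
  · rintro ⟨⟨x, ⟨h1, h2⟩, rfl⟩, -⟩
    exact ⟨h1, x, h2, rfl⟩

lemma continuousOn_invFunOn_of_isCompact {X Y : Type*} [TopologicalSpace X] [TopologicalSpace Y]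
    [T2Space Y] [Nonempty X] {κ : X → Y} {K : Set X} (hK : IsCompact K)
    (hκ : ContinuousOn κ K) (hi : InjOn κ K) : ContinuousOn (Function.invFunOn κ K) (κ '' K) :=
  continuousOn_image_of_comp hK hκ (continuousOn_id.congr fun _ hx => hi.leftInvOn_invFunOn hx)

lemma IsCell.isClosed_image (h : IsCell η) {K : Set (ℝ × ℝ)} (hK : IsClosed K)
    (hs : K ⊆ closedBall 0 1) : IsClosed (η '' K) :=
  (((isCompact_closedBall _ _).of_isClosed_subset hK hs).image_of_continuousOn
    (h.cont.mono hs)).isClosed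

lemma IsCell.isOpen_image (h : IsCell η) {V : Set (ℝ × ℝ)} (hV : IsOpen V)
    (hs : V ⊆ ball 0 1) : IsOpen (η '' V) := by
  have h1 : η '' V = η '' ball 0 1 \ η '' (closedBall 0 1 \ V) := by
    ext y
    constructor
    · rintro ⟨v, hv, rfl⟩
      refine ⟨mem_image_of_mem _ (hs hv), ?_⟩
      rintro ⟨w, hw, hw'⟩
      exact hw.2 (h.inj hw.1 (ball_subset_closedBall (hs hv)) hw' ▸ hv)
    · rintro ⟨⟨v, hv, rfl⟩, h2⟩
      by_contra h3
      exact h2 ⟨v, ⟨ball_subset_closedBall hv, fun h4 => h3 ⟨v, h4, rfl⟩⟩, rfl⟩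
  rw [h1]
  exact h.isOpen.sdiff (h.isClosed_image (isClosed_closedBall.sdiff hV) sdiff_subset)

lemma continuous_cellExt (h : IsCell η) {g : ℝ × ℝ → ℝ × ℝ} (hc : ContinuousOn g (closedBall 0 1))
    (hm : MapsTo g (closedBall 0 1) (closedBall 0 1)) (hs : ∀ v ∈ sphere (0 : ℝ × ℝ) 1, g v = v) :
    Continuous (cellExt η g) := by
  have h1 : ContinuousOn (cellExt η g) (η '' closedBall 0 1) :=
    continuousOn_image_of_comp (isCompact_closedBall _ _) h.cont
      ((h.cont.comp hc hm).congr fun v hv => cellExt_apply h g hv)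
  have h2 : ContinuousOn (cellExt η g) (η '' ball 0 1)ᶜ :=
    continuousOn_id.congr fun x hx => cellExt_of_notMem h hs hx
  have h3 := h1.union_of_isClosed h2 (h.isClosed_image isClosed_closedBall subset_rfl)
    h.isOpen.isClosed_compl
  rw [← continuousOn_univ]
  refine h3.mono fun x _ => ?_
  by_cases hx : x ∈ η '' ball 0 1
  · exact Or.inl (image_mono ball_subset_closedBall hx)
  · exact Or.inr hx

lemma IsCell.exists_homeo (h : IsCell η) {g : ℝ × ℝ → ℝ × ℝ}
    (hc : ContinuousOn g (closedBall 0 1)) (hb : BijOn g (closedBall 0 1) (closedBall 0 1))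
    (hs : ∀ v ∈ sphere (0 : ℝ × ℝ) 1, g v = v) :
    ∃ Ψ : S ≃ₜ S, (∀ v ∈ closedBall (0 : ℝ × ℝ) 1, Ψ (η v) = η (g v)) ∧
      ∀ x ∉ η '' ball 0 1, Ψ x = x := by
  set g' := Function.invFunOn g (closedBall 0 1)
  have hl : LeftInvOn g' g (closedBall 0 1) := hb.injOn.leftInvOn_invFunOn
  have hr : RightInvOn g' g (closedBall 0 1) := hb.surjOn.rightInvOn_invFunOn
  have hm' : MapsTo g' (closedBall 0 1) (closedBall 0 1) := hb.surjOn.mapsTo_invFunOn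
  have hc' : ContinuousOn g' (closedBall 0 1) := by
    have := continuousOn_invFunOn_of_isCompact (isCompact_closedBall _ _) hc hb.injOn
    rwa [hb.image_eq] at this
  have hs' : ∀ v ∈ sphere (0 : ℝ × ℝ) 1, g' v = v := fun v hv => by
    conv_lhs => rw [← hs v hv]
    exact hl (sphere_subset_closedBall hv)
  have key : ∀ {a b : ℝ × ℝ → ℝ × ℝ}, LeftInvOn b a (closedBall 0 1) →
      MapsTo a (closedBall 0 1) (closedBall 0 1) →
      (∀ v ∈ sphere (0 : ℝ × ℝ) 1, a v = v) → (∀ v ∈ sphere (0 : ℝ × ℝ) 1, b v = v) →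
      ∀ x, cellExt η b (cellExt η a x) = x := by
    intro a b hab ha hsa hsb x
    by_cases hx : x ∈ η '' ball 0 1
    · obtain ⟨v, hv, rfl⟩ := hx
      have hv' := ball_subset_closedBall hv
      rw [cellExt_apply h _ hv', cellExt_apply h _ (ha hv'), hab hv']
    · rw [cellExt_of_notMem h hsa hx, cellExt_of_notMem h hsb hx]
  exact ⟨⟨⟨cellExt η g, cellExt η g', key hl hb.mapsTo hs hs', key hr hm' hs' hs⟩,
    continuous_cellExt h hc hb.mapsTo hs, continuous_cellExt h hc' hm' hs'⟩,
    fun v hv => cellExt_apply h g hv, fun x hx => cellExt_of_notMem h hs hx⟩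

/-- The map of the unit ball that moves `0` to `b` and is affine on rays. -/
def push (b v : ℝ × ℝ) : ℝ × ℝ := v + (1 - ‖v‖) • b

lemma continuous_push (b : ℝ × ℝ) : Continuous (push b) := by
  unfold push; fun_prop

lemma push_of_mem_sphere (b : ℝ × ℝ) : ∀ v ∈ sphere (0 : ℝ × ℝ) 1, push b v = v := by
  intro v hv
  rw [mem_sphere_zero_iff_norm] at hv
  simp [push, hv]

lemma bijOn_push {b : ℝ × ℝ} (hb : ‖b‖ < 1) :
    BijOn (push b) (closedBall 0 1) (closedBall 0 1) := by
  refine ⟨fun v hv => ?_, fun v hv w hw h => ?_, fun y hy => ?_⟩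
  · rw [mem_closedBall_zero_iff] at hv ⊢
    calc ‖push b v‖ ≤ ‖v‖ + ‖(1 - ‖v‖) • b‖ := norm_add_le _ _
      _ = ‖v‖ + (1 - ‖v‖) * ‖b‖ := by
        rw [norm_smul, Real.norm_of_nonneg (by linarith)]
      _ ≤ 1 := by nlinarith [norm_nonneg b, norm_nonneg v]
  · have h1 : v - w = (‖v‖ - ‖w‖) • b := by
      simp only [push, sub_smul, one_smul] at h ⊢
      have := sub_eq_zero.2 h
      rw [← sub_eq_zero, ← this]; abel
    have h2 : ‖v - w‖ ≤ ‖v - w‖ * ‖b‖ := by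
      conv_lhs => rw [h1, norm_smul]
      exact mul_le_mul_of_nonneg_right (abs_norm_sub_norm_le v w) (norm_nonneg b)
    have h3 : ‖v - w‖ = 0 := by nlinarith [norm_nonneg (v - w)]
    exact sub_eq_zero.1 (norm_eq_zero.1 h3)
  · rw [mem_closedBall_zero_iff] at hy
    have hc : ContinuousOn (fun r : ℝ => 1 - ‖y - r • b‖ - r) (Icc 0 1) := by fun_prop
    have := intermediate_value_Icc' (zero_le_one' ℝ) hc
    obtain ⟨r, hr, hr'⟩ := this (show (0 : ℝ) ∈ _ by constructor <;> simp [hy])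
    simp only at hr'
    refine ⟨y - r • b, ?_, ?_⟩
    · rw [mem_closedBall_zero_iff]; linarith [hr.1]
    · have : 1 - ‖y - r • b‖ = r := by linarith
      simp only [push, this]; abel

/-- The radial map of the unit ball that contracts its interior towards `0`. -/
def squeeze (k : ℕ) (v : ℝ × ℝ) : ℝ × ℝ := ‖v‖ ^ k • v

lemma continuous_squeeze (k : ℕ) : Continuous (squeeze k) := by
  unfold squeeze; fun_prop

lemma norm_squeeze (k : ℕ) (v : ℝ × ℝ) : ‖squeeze k v‖ = ‖v‖ ^ (k + 1) := by
  rw [squeeze, norm_smul, norm_pow, norm_norm, pow_succ]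

lemma squeeze_of_mem_sphere (k : ℕ) : ∀ v ∈ sphere (0 : ℝ × ℝ) 1, squeeze k v = v := by
  intro v hv
  rw [mem_sphere_zero_iff_norm] at hv
  simp [squeeze, hv]

lemma bijOn_squeeze (k : ℕ) : BijOn (squeeze k) (closedBall 0 1) (closedBall 0 1) := by
  refine ⟨fun v hv => ?_, fun v hv w hw h => ?_, fun y hy => ?_⟩
  · rw [mem_closedBall_zero_iff] at hv ⊢
    rw [norm_squeeze]
    exact pow_le_one₀ (norm_nonneg _) hv
  · have h1 : ‖v‖ ^ (k + 1) = ‖w‖ ^ (k + 1) := by rw [← norm_squeeze, ← norm_squeeze, h]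
    have h2 : ‖v‖ = ‖w‖ := (pow_left_inj₀ (norm_nonneg _) (norm_nonneg _) (by omega)).1 h1
    by_cases hv0 : v = 0
    · subst hv0
      rw [norm_zero] at h2
      exact (norm_eq_zero.1 h2.symm).symm
    · simp only [squeeze, h2] at h
      exact smul_right_injective _ (pow_ne_zero k (h2 ▸ norm_ne_zero_iff.2 hv0)) h
  · rw [mem_closedBall_zero_iff] at hy
    by_cases hy0 : y = 0
    · exact ⟨0, by simp, by simp [squeeze, hy0]⟩
    have hc : ContinuousOn (fun r : ℝ => r ^ (k + 1)) (Icc 0 1) := by fun_prop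
    obtain ⟨r, hr, hr'⟩ := intermediate_value_Icc (zero_le_one' ℝ) hc
      (show ‖y‖ ∈ _ from ⟨by simp, by simpa using hy⟩)
    simp only at hr'
    have hn : ‖(r / ‖y‖) • y‖ = r := by
      rw [norm_smul, norm_div, norm_norm, Real.norm_of_nonneg hr.1,
        div_mul_cancel₀ _ (norm_ne_zero_iff.2 hy0)]
    refine ⟨(r / ‖y‖) • y, ?_, ?_⟩
    · rw [mem_closedBall_zero_iff, hn]; exact hr.2
    · rw [squeeze, hn, smul_smul, ← mul_div_assoc, ← pow_succ, hr',
        div_self (norm_ne_zero_iff.2 hy0), one_smul]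

lemma IsCell.exists_move (h : IsCell η) {a b : ℝ × ℝ} (ha : a ∈ ball (0 : ℝ × ℝ) 1)
    (hb : b ∈ ball (0 : ℝ × ℝ) 1) :
    ∃ Ψ : S ≃ₜ S, Ψ (η a) = η b ∧ ∀ x ∉ η '' ball 0 1, Ψ x = x := by
  have key : ∀ c ∈ ball (0 : ℝ × ℝ) 1, ∃ Ψ : S ≃ₜ S, Ψ (η 0) = η c ∧
      ∀ x ∉ η '' ball 0 1, Ψ x = x := by
    intro c hc
    obtain ⟨Ψ, h1, h2⟩ := h.exists_homeo (continuous_push c).continuousOn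
      (bijOn_push (mem_ball_zero_iff.1 hc)) (push_of_mem_sphere c)
    exact ⟨Ψ, by rw [h1 0 (by simp)]; simp [push], h2⟩
  obtain ⟨Ψ, h1, h2⟩ := key a ha
  obtain ⟨Φ, h3, h4⟩ := key b hb
  refine ⟨Ψ.symm.trans Φ, ?_, fun x hx => ?_⟩
  · rw [← h1]; simp [h3]
  · rw [Homeomorph.trans_apply, (Ψ.symm_apply_eq).2 (h2 x hx).symm, h4 x hx]

/-- Every point has arbitrarily small neighbourhoods which are closed squares; the point
may lie on the boundary of the square. -/
def Surf (S : Type*) [TopologicalSpace S] : Prop :=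
  ∀ x : S, ∀ U ∈ 𝓝 x, ∃ η : ℝ × ℝ → S, IsCell η ∧ η '' closedBall 0 1 ⊆ U ∧
    η '' closedBall 0 1 ∈ 𝓝 x

/-- Invariance of domain. -/
lemma Surf.isOpen_image (hS : Surf S) {f : ℝ × ℝ → S} {U : Set (ℝ × ℝ)} (hU : IsOpen U)
    (hc : ContinuousOn f U) (hi : InjOn f U) : IsOpen (f '' U) := by
  rw [isOpen_iff_mem_nhds]
  rintro _ ⟨z, hz, rfl⟩
  obtain ⟨η, h, -, hη⟩ := hS (f z) univ univ_mem
  have hV : U ∩ f ⁻¹' (η '' closedBall 0 1) ∈ 𝓝 z :=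
    inter_mem (hU.mem_nhds hz) ((hc.continuousAt (hU.mem_nhds hz)).preimage_mem_nhds hη)
  obtain ⟨V, hVs, hVo, hzV⟩ := _root_.mem_nhds_iff.1 hV
  set κ := Function.invFunOn η (closedBall 0 1)
  have hinv : ∀ w ∈ V, η (κ (f w)) = f w ∧ κ (f w) ∈ closedBall (0 : ℝ × ℝ) 1 := fun w hw =>
    ⟨Function.invFunOn_eq (hVs hw).2, Function.invFunOn_mem (hVs hw).2⟩
  have hκ := continuousOn_invFunOn_of_isCompact (isCompact_closedBall _ _) h.cont h.inj
  have hgo : IsOpen ((κ ∘ f) '' V) := by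
    refine isOpen_image_prod hVo (hκ.comp (hc.mono fun w hw => (hVs hw).1)
      fun w hw => (hVs hw).2) fun v hv w hw hvw => ?_
    refine hi (hVs hv).1 (hVs hw).1 ?_
    rw [← (hinv v hv).1, ← (hinv w hw).1]
    exact congrArg η hvw
  have hgs : (κ ∘ f) '' V ⊆ ball 0 1 := by
    rw [← interior_closedBall _ one_ne_zero]
    refine interior_maximal ?_ hgo
    rintro _ ⟨w, hw, rfl⟩
    exact (hinv w hw).2
  refine mem_of_superset ((h.isOpen_image hgo hgs).mem_nhds
    ⟨_, ⟨z, hzV, rfl⟩, (hinv z hzV).1⟩) ?_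
  rintro _ ⟨_, ⟨w, hw, rfl⟩, rfl⟩
  exact ⟨w, (hVs hw).1, (hinv w hw).1.symm⟩

lemma Surf.exists_homeo_center (hS : Surf S) [ConnectedSpace S] (h : IsCell η) (h' : IsCell κ) :
    ∃ Ψ : S ≃ₜ S, Ψ (η 0) = κ 0 := by
  let T : Set S := {x | ∃ ζ, IsCell ζ ∧ ζ '' closedBall 0 1 ∈ 𝓝 x ∧ ∃ Ψ : S ≃ₜ S, Ψ (η 0) = ζ 0}
  have step : ∀ {ζ ξ : ℝ × ℝ → S} {y : S}, IsCell ζ → IsCell ξ → ζ '' closedBall 0 1 ∈ 𝓝 y →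
      ξ '' closedBall 0 1 ∈ 𝓝 y → (∃ Ψ : S ≃ₜ S, Ψ (η 0) = ζ 0) →
      ∃ Ψ : S ≃ₜ S, Ψ (η 0) = ξ 0 := by
    rintro ζ ξ y hζ hξ h1 h2 ⟨Ψ, hΨ⟩
    obtain ⟨z, ⟨a, ha, haz⟩, ⟨b, hb, hbz⟩⟩ := hζ.overlap hξ h1 h2
    obtain ⟨Ψ1, h3, -⟩ := hζ.exists_move (mem_ball_self one_pos) ha
    obtain ⟨Ψ2, h4, -⟩ := hξ.exists_move hb (mem_ball_self one_pos)
    exact ⟨(Ψ.trans Ψ1).trans Ψ2, by simp [hΨ, h3, haz, ← hbz, h4]⟩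
  have hnhd : ∀ {ζ : ℝ × ℝ → S}, IsCell ζ → ζ '' closedBall 0 1 ∈ 𝓝 (ζ 0) := fun hζ =>
    mem_of_superset (hζ.isOpen.mem_nhds ⟨0, mem_ball_self one_pos, rfl⟩)
      (image_mono ball_subset_closedBall)
  have hTo : IsOpen T := by
    rw [isOpen_iff_mem_nhds]
    rintro x ⟨ζ, h1, h2, h3⟩
    filter_upwards [interior_mem_nhds.2 h2] with y hy
    exact ⟨ζ, h1, mem_interior_iff_mem_nhds.1 hy, h3⟩
  have hTc : IsClosed T := by
    rw [isClosed_iff_nhds]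
    intro x hx
    obtain ⟨ξ, h1, -, h2⟩ := hS x univ univ_mem
    obtain ⟨y, hy, ζ, h3, h4, h5⟩ := hx _ (interior_mem_nhds.2 h2)
    exact ⟨ξ, h1, h2, step h3 h1 h4 (mem_interior_iff_mem_nhds.1 hy) h5⟩
  have hT : T = univ := IsClopen.eq_univ ⟨hTc, hTo⟩ ⟨η 0, η, h, hnhd h, Homeomorph.refl S, rfl⟩
  obtain ⟨ζ, h1, h2, h3⟩ := hT.symm.subset (mem_univ (κ 0))
  exact step h1 h' h2 (hnhd h') h3

end Cells

section Mobius

variable {S Z : Type*} [TopologicalSpace S]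

/-- A parametrization of a closed Möbius band in `S` by its universal cover. -/
structure IsMobius (m : ℝ × ℝ → S) : Prop where
  cont : Continuous m
  twist : ∀ s t, m (s + 1, -t) = m (s, t)
  inj : ∀ {s t s' t' : ℝ}, |t| ≤ 1 → |t'| ≤ 1 → m (s, t) = m (s', t') →
    ∃ k : ℤ, s' = s + k ∧ t' = (-1) ^ k * t

lemma mobiusRel_exact {p q : unitInterval × unitInterval}
    (h : Quot.mk mobiusRel p = Quot.mk mobiusRel q) :
    p = q ∨ mobiusRel p q ∨ mobiusRel q p := by
  have h1 := Quot.eqvGen_exact h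
  clear h
  induction h1 with
  | rel x y h => exact Or.inr (Or.inl h)
  | refl x => exact Or.inl rfl
  | symm x y _ ih =>
    rcases ih with h | h | h
    · exact Or.inl h.symm
    · exact Or.inr (Or.inr h)
    · exact Or.inr (Or.inl h)
  | trans x y z h1 h2 ih1 ih2 =>
    rcases ih1 with rfl | h1 | h1
    · exact ih2
    · rcases ih2 with rfl | h2 | h2
      · exact Or.inr (Or.inl h1)
      · exact absurd (h2.1.symm.trans h1.2.1) zero_ne_one
      · refine Or.inl (Prod.ext (h1.1.trans h2.1.symm) (Subtype.ext ?_))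
        linarith [h1.2.2, h2.2.2]
    · rcases ih2 with rfl | h2 | h2
      · exact Or.inr (Or.inr h1)
      · refine Or.inl (Prod.ext (h1.2.1.trans h2.2.1.symm) (Subtype.ext ?_))
        linarith [h1.2.2, h2.2.2]
      · exact absurd (h1.1.symm.trans h2.2.1) zero_ne_one

/-- The chart of the Möbius band on the strip `[k, k + 1] × ℝ`. -/
def mobiusPiece (k : ℤ) (p : ℝ × ℝ) : MobiusBand :=
  Quot.mk mobiusRel (projIcc 0 1 zero_le_one (p.1 - k),
    projIcc 0 1 zero_le_one (((-1) ^ k * p.2 + 1) / 2))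

lemma continuous_mobiusPiece (k : ℤ) : Continuous (mobiusPiece k) := by
  refine continuous_quot_mk.comp ?_
  have h := continuous_projIcc (a := (0 : ℝ)) (b := 1) (h := zero_le_one)
  exact (h.comp (by fun_prop)).prodMk (h.comp (by fun_prop))

lemma coe_projIcc (x : ℝ) : (projIcc (0 : ℝ) 1 zero_le_one x : ℝ) = max 0 (min 1 x) := rfl

lemma neg_one_zpow_cases (k : ℤ) : ((-1 : ℝ) ^ k = 1) ∨ ((-1 : ℝ) ^ k = -1) := by
  rcases Int.even_or_odd k with h | h
  · exact Or.inl h.neg_one_zpow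
  · exact Or.inr h.neg_one_zpow

lemma mobiusPiece_succ (k : ℤ) (t : ℝ) :
    mobiusPiece (k + 1) (k + 1, t) = mobiusPiece k (k + 1, t) := by
  refine Quot.sound ⟨?_, ?_, ?_⟩
  · apply Subtype.ext; simp
  · apply Subtype.ext; simp
  · simp only [coe_projIcc]
    rw [zpow_add₀ (by norm_num), zpow_one]
    rcases neg_one_zpow_cases k with h | h <;> rw [h] <;>
    simp only [max_def, min_def] <;> split_ifs <;> linarith

/-- The universal covering map of the Möbius band, with clamped second coordinate. -/
def mobiusCover (p : ℝ × ℝ) : MobiusBand := mobiusPiece ⌊p.1⌋ p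

lemma mobiusCover_eq {k : ℤ} {p : ℝ × ℝ} (h1 : k ≤ p.1) (h2 : p.1 ≤ k + 1) :
    mobiusCover p = mobiusPiece k p := by
  rcases h2.lt_or_eq with h2 | h2
  · rw [mobiusCover, Int.floor_eq_iff.2 ⟨h1, h2⟩]
  · obtain ⟨s, t⟩ := p
    simp only at h2
    subst h2
    rw [← mobiusPiece_succ, mobiusCover]
    simp

lemma locallyFinite_Icc_int :
    LocallyFinite fun k : ℤ => Icc (k : ℝ) (k + 1) ×ˢ (univ : Set ℝ) := by
  intro p
  refine ⟨Ioo (p.1 - 1) (p.1 + 1) ×ˢ univ, prod_mem_nhds (Ioo_mem_nhds (by linarith) (by linarith))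
    univ_mem, (Set.finite_Icc (⌊p.1⌋ - 2) (⌊p.1⌋ + 2)).subset ?_⟩
  rintro k ⟨q, ⟨⟨h1, h2⟩, -⟩, ⟨⟨h3, h4⟩, -⟩⟩
  have h5 := Int.floor_le p.1
  have h6 := Int.lt_floor_add_one p.1
  constructor
  · have : ((⌊p.1⌋ - 2 : ℤ) : ℝ) ≤ k := by push_cast; linarith
    exact_mod_cast this
  · have : (k : ℝ) ≤ ((⌊p.1⌋ + 2 : ℤ) : ℝ) := by push_cast; linarith
    exact_mod_cast this

lemma continuous_mobiusCover : Continuous mobiusCover := by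
  refine locallyFinite_Icc_int.continuous ?_ (fun k => isClosed_Icc.prod isClosed_univ)
    fun k => (continuous_mobiusPiece k).continuousOn.congr fun p hp =>
      mobiusCover_eq hp.1.1 hp.1.2
  refine eq_univ_of_forall fun p => mem_iUnion.2 ⟨⌊p.1⌋, ⟨Int.floor_le _, ?_⟩, mem_univ _⟩
  exact (Int.lt_floor_add_one _).le

lemma isMobius_mobiusCover : IsMobius mobiusCover where
  cont := continuous_mobiusCover
  twist s t := by
    unfold mobiusCover mobiusPiece
    simp only [Int.floor_add_one, zpow_add₀ (show (-1 : ℝ) ≠ 0 by norm_num)]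
    push_cast
    simp
    rfl
  inj := by
    intro s t s' t' ht ht' h
    have a1 := Int.floor_le s
    have a2 := Int.lt_floor_add_one s
    have b1 := Int.floor_le s'
    have b2 := Int.lt_floor_add_one s'
    rw [abs_le] at ht ht'
    rcases mobiusRel_exact h with h | h | h
    · have e1 := congrArg (fun p => (p.1 : ℝ)) h
      have e2 := congrArg (fun p => (p.2 : ℝ)) h
      simp only [coe_projIcc] at e1 e2
      rw [min_eq_right (by linarith), min_eq_right (by linarith), max_eq_right (by linarith),
        max_eq_right (by linarith)] at e1
      refine ⟨⌊s'⌋ - ⌊s⌋, by push_cast; linarith, ?_⟩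
      rw [zpow_sub₀ (by norm_num)]
      rcases neg_one_zpow_cases ⌊s⌋ with h1 | h1 <;> rcases neg_one_zpow_cases ⌊s'⌋ with h2 | h2 <;>
      rw [h1, h2] at e2 ⊢ <;>
      rw [min_eq_right (by linarith), min_eq_right (by linarith), max_eq_right (by linarith),
        max_eq_right (by linarith)] at e2 <;>
      linarith
    · have := congrArg Subtype.val h.2.1
      simp only [coe_projIcc] at this
      rw [min_eq_right (by linarith), max_eq_right (by linarith)] at this
      change s' - ⌊s'⌋ = (1 : ℝ) at this
      linarith
    · have := congrArg Subtype.val h.2.1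
      simp only [coe_projIcc] at this
      rw [min_eq_right (by linarith), max_eq_right (by linarith)] at this
      change s - ⌊s⌋ = (1 : ℝ) at this
      linarith

variable {m : ℝ × ℝ → S}

lemma IsMobius.comp {S' : Type*} [TopologicalSpace S'] (hm : IsMobius m) {e : S → S'}
    (he : Continuous e) (hi : Function.Injective e) : IsMobius (e ∘ m) where
  cont := he.comp hm.cont
  twist s t := congrArg e (hm.twist s t)
  inj h1 h2 h := hm.inj h1 h2 (hi h)

lemma exists_isMobius {A : Set S} (e : A ≃ₜ MobiusBand) : ∃ m : ℝ × ℝ → S, IsMobius m :=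
  ⟨_, isMobius_mobiusCover.comp (e := fun x => (e.symm x : S))
    (continuous_subtype_val.comp e.symm.continuous)
    (Subtype.val_injective.comp e.symm.injective)⟩

lemma eq_of_twist {F : ℝ × ℝ → Z} (h : ∀ s t, F (s + 1, -t) = F (s, t)) (k : ℤ) (s t : ℝ) :
    F (s + k, (-1) ^ k * t) = F (s, t) := by
  induction k using Int.induction_on with
  | zero => simp
  | succ k ih =>
    rw [← ih, ← h (s + (k : ℤ)), zpow_add₀ (by norm_num), zpow_one]
    push_cast
    congr 2 <;> ring
  | pred k ih =>
    rw [← ih, ← h (s + (-k - 1 : ℤ)), zpow_sub₀ (by norm_num), zpow_one]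
    push_cast
    congr 2 <;> ring

open Classical in
/-- The function on `S` induced by a function `F` on the cover of a Möbius band, extended by `d`. -/
def mobLift (m : ℝ × ℝ → S) (F : ℝ × ℝ → Z) (d : S → Z) (x : S) : Z :=
  if h : ∃ p : ℝ × ℝ, |p.2| ≤ 1 ∧ m p = x then F h.choose else d x

lemma IsMobius.mobLift_apply (hm : IsMobius m) {F : ℝ × ℝ → Z} {d : S → Z}
    (hF : ∀ s t, F (s + 1, -t) = F (s, t)) {p : ℝ × ℝ} (hp : |p.2| ≤ 1) :
    mobLift m F d (m p) = F p := by
  have h : ∃ q : ℝ × ℝ, |q.2| ≤ 1 ∧ m q = m p := ⟨p, hp, rfl⟩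
  rw [mobLift, dif_pos h]
  obtain ⟨k, h1, h2⟩ := hm.inj hp h.choose_spec.1 h.choose_spec.2.symm
  have h3 : h.choose = (p.1 + k, (-1) ^ k * p.2) := Prod.ext h1 h2
  rw [h3, eq_of_twist hF]

/-- The closed strip of half-width `r`. -/
def strip (r : ℝ) : Set (ℝ × ℝ) := {p | |p.2| ≤ r}

/-- The open strip of half-width `r`. -/
def ostrip (r : ℝ) : Set (ℝ × ℝ) := {p | |p.2| < r}

lemma isOpen_ostrip (r : ℝ) : IsOpen (ostrip r) :=
  isOpen_lt (by fun_prop) continuous_const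

lemma ostrip_subset_strip {r r' : ℝ} (h : r ≤ r') : ostrip r ⊆ strip r' :=
  fun _ hp => (le_of_lt hp).trans h

omit [TopologicalSpace S] in
lemma mobLift_of_notMem {F : ℝ × ℝ → Z} {d : S → Z} {x : S} (hx : x ∉ m '' strip 1) :
    mobLift m F d x = d x := by
  rw [mobLift, dif_neg]
  rintro ⟨p, hp, rfl⟩
  exact hx ⟨p, hp, rfl⟩

lemma abs_neg_one_zpow_mul (k : ℤ) (t : ℝ) : |(-1) ^ k * t| = |t| := by
  rcases neg_one_zpow_cases k with h | h <;> simp [h]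

lemma IsMobius.image_strip (hm : IsMobius m) (r : ℝ) :
    m '' strip r = m '' (Icc 0 1 ×ˢ Icc (-r) r) := by
  refine Subset.antisymm ?_ (image_mono fun p hp => abs_le.2 hp.2)
  rintro _ ⟨⟨s, t⟩, hp, rfl⟩
  refine ⟨(s + (-⌊s⌋ : ℤ), (-1) ^ (-⌊s⌋) * t), ⟨⟨?_, ?_⟩, ?_⟩, eq_of_twist hm.twist _ s t⟩
  · push_cast; linarith [Int.floor_le s]
  · push_cast; linarith [Int.lt_floor_add_one s]
  · rw [← abs_le.trans mem_Icc.symm]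
    change |(-1) ^ (-⌊s⌋) * t| ≤ r
    rw [abs_neg_one_zpow_mul]; exact hp

lemma IsMobius.isCompact_strip (hm : IsMobius m) (r : ℝ) : IsCompact (m '' strip r) := by
  rw [hm.image_strip]
  exact (isCompact_Icc.prod isCompact_Icc).image hm.cont

lemma IsMobius.mem_image_iff (hm : IsMobius m) {P : ℝ × ℝ → Prop}
    (hP : ∀ s t, P (s + 1, -t) = P (s, t)) {p : ℝ × ℝ} (hp : |p.2| ≤ 1)
    (hP1 : ∀ p, P p → |p.2| ≤ 1) : m p ∈ m '' {q | P q} ↔ P p := by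
  refine ⟨?_, fun h => ⟨p, h, rfl⟩⟩
  rintro ⟨⟨s, t⟩, hq, hqp⟩
  obtain ⟨k, h1, h2⟩ := hm.inj (hP1 _ hq) hp hqp
  have h3 : p = (s + k, (-1) ^ k * t) := Prod.ext h1 h2
  rw [h3, eq_of_twist hP]
  exact hq

lemma IsMobius.mem_strip_iff (hm : IsMobius m) {p : ℝ × ℝ} (hp : |p.2| ≤ 1) {r : ℝ}
    (hr : r ≤ 1) : m p ∈ m '' strip r ↔ |p.2| ≤ r :=
  hm.mem_image_iff (P := fun p => |p.2| ≤ r) (by simp) hp fun _ h => h.trans hr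

lemma IsMobius.mem_ostrip_iff (hm : IsMobius m) {p : ℝ × ℝ} (hp : |p.2| ≤ 1) {r : ℝ}
    (hr : r ≤ 1) : m p ∈ m '' ostrip r ↔ |p.2| < r :=
  hm.mem_image_iff (P := fun p => |p.2| < r) (by simp) hp fun _ h => h.le.trans hr

lemma IsMobius.injOn (hm : IsMobius m) {V : Set (ℝ × ℝ)} (hV : V ⊆ strip 1)
    (hd : ∀ p ∈ V, ∀ q ∈ V, |q.1 - p.1| < 1) : InjOn m V := by
  rintro ⟨s, t⟩ hp ⟨s', t'⟩ hq h
  obtain ⟨k, h1, h2⟩ := hm.inj (hV hp) (hV hq) h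
  have h3 := hd _ hp _ hq
  simp only [h1, add_sub_cancel_left] at h3
  have h4 : |k| < 1 := by exact_mod_cast h3
  rw [Int.abs_lt_one_iff] at h4
  subst h4
  simp at h1 h2
  rw [h1, h2]

variable [T2Space S] (hS : Surf S)
include hS

lemma IsMobius.isOpen_image (hm : IsMobius m) {V : Set (ℝ × ℝ)} (hV : IsOpen V)
    (hs : V ⊆ ostrip 1) : IsOpen (m '' V) := by
  have h1 : m '' V = ⋃ p : ℝ × ℝ, m '' (V ∩ ball p (1 / 2)) := by
    rw [← image_iUnion, ← inter_iUnion]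
    congr 1
    refine (inter_eq_left.2 fun p _ => mem_iUnion.2 ⟨p, mem_ball_self (by norm_num)⟩).symm
  rw [h1]
  refine isOpen_iUnion fun p => hS.isOpen_image (hV.inter isOpen_ball) hm.cont.continuousOn
    (hm.injOn (fun q hq => ostrip_subset_strip le_rfl (hs hq.1)) fun a ha b hb => ?_)
  have h2 : dist b a < 1 := by
    have := dist_triangle_right b a p
    have h3 : dist a p < 1 / 2 := ha.2
    have h4 : dist b p < 1 / 2 := hb.2
    linarith
  rw [← Real.dist_eq]
  exact (le_max_left _ _).trans_lt h2

lemma IsMobius.continuousAt_mobLift [TopologicalSpace Z] (hm : IsMobius m) {F : ℝ × ℝ → Z}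
    {d : S → Z} (hF : ∀ s t, F (s + 1, -t) = F (s, t)) {p : ℝ × ℝ} (hp : p ∈ ostrip 1)
    (hc : ContinuousAt F p) : ContinuousAt (mobLift m F d) (m p) := by
  intro N hN
  rw [hm.mobLift_apply hF (le_of_lt hp)] at hN
  obtain ⟨V, hV, hVo, hpV⟩ := _root_.mem_nhds_iff.1
    (inter_mem (hc hN) ((isOpen_ostrip 1).mem_nhds hp))
  rw [mem_map]
  refine mem_of_superset ((hm.isOpen_image hS hVo fun q hq => (hV hq).2).mem_nhds ⟨p, hpV, rfl⟩) ?_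
  rintro _ ⟨q, hq, rfl⟩
  rw [mem_preimage, hm.mobLift_apply hF (le_of_lt (hV hq).2)]
  exact (hV hq).1

lemma IsMobius.continuous_mobLift [TopologicalSpace Z] (hm : IsMobius m) {F : ℝ × ℝ → Z}
    {d : S → Z} (hF : ∀ s t, F (s + 1, -t) = F (s, t)) (hc : Continuous F) {r : ℝ} (hr : r < 1)
    (hd : ∀ p : ℝ × ℝ, r < |p.2| → |p.2| ≤ 1 → F p = d (m p)) (hdc : Continuous d) :
    Continuous (mobLift m F d) := by
  rw [continuous_iff_continuousAt]
  intro x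
  by_cases hx : x ∈ m '' strip r
  · obtain ⟨p, hp, rfl⟩ := hx
    exact hm.continuousAt_mobLift hS hF (lt_of_le_of_lt hp hr) hc.continuousAt
  · refine hdc.continuousAt.congr ?_
    filter_upwards [(hm.isCompact_strip r).isClosed.isOpen_compl.mem_nhds hx] with y hy
    by_cases hy1 : y ∈ m '' strip 1
    · obtain ⟨p, hp, rfl⟩ := hy1
      rw [hm.mobLift_apply hF hp, hd p _ hp]
      by_contra h
      exact hy ⟨p, not_lt.1 h, rfl⟩
    · rw [mobLift_of_notMem hy1]

/-- Rotating a Möbius band along its core, with speed depending on the distance to the core. -/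
lemma IsMobius.exists_shift (hm : IsMobius m) {τ : ℝ → ℝ} (hτ : Continuous τ)
    (he : ∀ t, τ (-t) = τ t) (h0 : ∀ t, 3 / 4 ≤ |t| → τ t = 0) :
    ∃ H : S ≃ₜ S, (∀ s t, |t| ≤ 1 → H (m (s, t)) = m (s + τ t, t)) ∧
      ∀ x ∉ m '' strip (3 / 4), H x = x := by
  let F : (ℝ → ℝ) → ℝ × ℝ → S := fun τ p => m (p.1 + τ p.2, p.2)
  have hF : ∀ τ : ℝ → ℝ, (∀ t, τ (-t) = τ t) → ∀ s t, F τ (s + 1, -t) = F τ (s, t) := by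
    intro τ he s t
    simp only [F]
    rw [he, ← hm.twist (s + τ t)]
    congr 2; ring
  have hap : ∀ τ : ℝ → ℝ, (∀ t, τ (-t) = τ t) → ∀ s t, |t| ≤ 1 →
      mobLift m (F τ) id (m (s, t)) = m (s + τ t, t) := fun τ he s t ht =>
    hm.mobLift_apply (hF τ he) ht
  have hct : ∀ τ : ℝ → ℝ, Continuous τ → (∀ t, τ (-t) = τ t) → (∀ t, 3 / 4 ≤ |t| → τ t = 0) →
      Continuous (mobLift m (F τ) id) := fun τ hτ he h0 =>
    hm.continuous_mobLift hS (hF τ he) (hm.cont.comp (by fun_prop)) (r := 3 / 4) (by norm_num)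
      (fun p hp _ => by simp [F, h0 _ hp.le]) continuous_id
  have hinv : ∀ τ τ' : ℝ → ℝ, (∀ t, τ (-t) = τ t) → (∀ t, τ' (-t) = τ' t) →
      (∀ t, τ t + τ' t = 0) → ∀ x, mobLift m (F τ') id (mobLift m (F τ) id x) = x := by
    intro τ τ' he he' hs x
    by_cases hx : x ∈ m '' strip 1
    · obtain ⟨⟨s, t⟩, hp, rfl⟩ := hx
      rw [hap τ he _ _ hp, hap τ' he' _ _ hp, add_assoc, hs, add_zero]
    · rw [mobLift_of_notMem hx]
      exact mobLift_of_notMem hx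
  have he' : ∀ t, (fun t => -τ t) (-t) = (fun t => -τ t) t := fun t => by simp [he]
  refine ⟨⟨⟨mobLift m (F τ) id, mobLift m (F fun t => -τ t) id,
    hinv τ (fun t => -τ t) he he' (by simp), hinv (fun t => -τ t) τ he' he (by simp)⟩, hct _ hτ he h0,
    hct _ hτ.neg he' (by simpa using h0)⟩, hap τ he, fun x hx => ?_⟩
  change mobLift m (F τ) id x = x
  by_cases hx1 : x ∈ m '' strip 1
  · obtain ⟨⟨s, t⟩, hp, rfl⟩ := hx1
    rw [hap τ he _ _ hp, h0, add_zero]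
    by_contra h
    exact hx ⟨(s, t), (not_le.1 h).le, rfl⟩
  · exact mobLift_of_notMem hx1

end Mobius

section Angle

variable {S : Type*} [TopologicalSpace S]

/-- `θ` winds a nonzero number of times around the doubled core of the Möbius band. -/
def Winds (θ : S → Circle) (m : ℝ × ℝ → S) : Prop :=
  ∃ (v : ℝ → ℝ) (d : ℝ), Continuous v ∧ d ≠ 0 ∧ (∀ s, θ (m (s, 0)) = Circle.exp (v s)) ∧
    ∀ s, v (s + 2) = v s + d

/-- A tent function supported in `[-1/2, 1/2]`. -/
def tent (t : ℝ) : ℝ := max 0 (1 - 2 * |t|)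

/-- A planar vector field on the strip, equivariant up to sign, with zeros at the translates
of `(s₀, c * tent t₀)`. -/
def planeField (s₀ c : ℝ) (p : ℝ × ℝ) : ℂ :=
  ⟨Real.sin (Real.pi * (p.1 - s₀)) * tent p.2,
    p.2 - c * tent p.2 * Real.cos (Real.pi * (p.1 - s₀))⟩

lemma continuous_planeField (s₀ c : ℝ) : Continuous (planeField s₀ c) := by
  have h : planeField s₀ c = fun p => Complex.equivRealProdCLM.symm
      (Real.sin (Real.pi * (p.1 - s₀)) * tent p.2,
        p.2 - c * tent p.2 * Real.cos (Real.pi * (p.1 - s₀))) := by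
    funext p; rfl
  rw [h]
  unfold tent
  fun_prop

lemma tent_neg (t : ℝ) : tent (-t) = tent t := by simp [tent]

lemma planeField_twist (s₀ c s t : ℝ) : planeField s₀ c (s + 1, -t) = -planeField s₀ c (s, t) := by
  have h : Real.pi * (s + 1 - s₀) = Real.pi * (s - s₀) + Real.pi := by ring
  apply Complex.ext <;> simp only [planeField, tent_neg, h, Real.sin_add_pi, Real.cos_add_pi,
    Complex.neg_re, Complex.neg_im] <;> ring

lemma eq_of_mul_tent_eq {a t : ℝ} (ha : |a| < 1 / 2) (h : t * tent a = a * tent t) (ht : tent t ≠ 0) :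
    t = a := by
  have ht' : 1 - 2 * |t| > 0 := by
    by_contra hh
    exact ht (max_eq_left (not_lt.1 hh))
  rw [tent, tent, max_eq_right (by linarith), max_eq_right (by linarith)] at h
  rcases abs_cases a with ⟨h1, h1'⟩ | ⟨h1, h1'⟩ <;> rcases abs_cases t with ⟨h2, h2'⟩ | ⟨h2, h2'⟩ <;>
    rw [h1, h2] at h <;> rw [h1] at ha <;> rw [h2] at ht' <;> nlinarith

lemma cos_pi_mul_int (k : ℤ) : Real.cos (Real.pi * k) = (-1) ^ k := by
  rw [mul_comm, Real.cos_int_mul_pi]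

lemma planeField_eq_zero {s₀ t₀ s t : ℝ} (h0 : |t₀| < 1 / 2)
    (h : planeField s₀ (t₀ / tent t₀) (s, t) = 0) :
    ∃ k : ℤ, s = s₀ + k ∧ t = (-1) ^ k * t₀ := by
  have hre := congrArg Complex.re h
  have him := congrArg Complex.im h
  simp only [planeField, Complex.zero_re, Complex.zero_im] at hre him
  have ht0 : tent t₀ ≠ 0 := by rw [tent, max_eq_right (by linarith)]; linarith
  rcases mul_eq_zero.1 hre with h1 | h1
  · obtain ⟨k, hk⟩ := Real.sin_eq_zero_iff.1 h1
    have hk' : s - s₀ = k := by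
      have := Real.pi_pos
      field_simp at hk
      nlinarith
    rw [hk', cos_pi_mul_int] at him
    refine ⟨k, by linarith, ?_⟩
    have hte : tent ((-1) ^ k * t₀) = tent t₀ := by rw [tent, tent, abs_neg_one_zpow_mul]
    by_cases ht : tent t = 0
    · exfalso
      rw [ht] at him
      have : t = 0 := by linarith
      rw [this] at ht
      simp [tent] at ht
    refine eq_of_mul_tent_eq (by rwa [abs_neg_one_zpow_mul]) ?_ ht
    rw [hte]
    field_simp at him
    linarith
  · exfalso
    rw [h1] at him
    have : t = 0 := by linarith
    rw [this] at h1
    simp [tent] at h1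

variable [T2Space S] {m : ℝ × ℝ → S}

/-- A circle valued function with a single singularity in the Möbius band. -/
lemma IsMobius.exists_angle (hS : Surf S) (hm : IsMobius m) {s₀ t₀ : ℝ} (h0 : |t₀| < 1 / 2)
    (h0' : t₀ ≠ 0) : ∃ f : S → Circle, (∀ x, x ≠ m (s₀, t₀) → ContinuousAt f x) ∧ Winds f m := by
  set L := planeField s₀ (t₀ / tent t₀)
  have hL : Continuous L := continuous_planeField _ _
  have hL0 : ∀ p : ℝ × ℝ, |p.2| ≤ 1 → m p ≠ m (s₀, t₀) → L p ≠ 0 := by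
    rintro ⟨s, t⟩ hp hne h
    obtain ⟨k, rfl, rfl⟩ := planeField_eq_zero h0 h
    exact hne (eq_of_twist hm.twist _ _ _)
  set F : ℝ × ℝ → Circle := fun p => dir (L p) * dir (L p)
  have hF : ∀ s t, F (s + 1, -t) = F (s, t) := by
    intro s t
    simp only [F, L, planeField_twist]
    by_cases h : planeField s₀ (t₀ / tent t₀) (s, t) = 0
    · simp [h]
    · rw [dir_neg h, mul_mul_mul_comm, ← Circle.exp_add, ← two_mul, Circle.exp_two_pi, one_mul]
  refine ⟨mobLift m F fun _ => Circle.exp Real.pi, fun x hx => ?_, ?_⟩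
  · by_cases hx1 : x ∈ m '' strip (3 / 4)
    · obtain ⟨p, hp, rfl⟩ := hx1
      have hp1 : |p.2| ≤ 3 / 4 := hp
      refine hm.continuousAt_mobLift hS hF (show |p.2| < 1 by linarith) ?_
      have := (continuousAt_dir (hL0 p (by linarith) hx)).comp hL.continuousAt
      exact this.mul this
    · refine (continuousAt_const (y := Circle.exp Real.pi)).congr ?_
      filter_upwards [(hm.isCompact_strip _).isClosed.isOpen_compl.mem_nhds hx1] with y hy
      by_cases hy1 : y ∈ m '' strip 1
      · obtain ⟨p, hp, rfl⟩ := hy1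
        have hp1 : |p.2| ≤ 1 := hp
        have hp2 : ¬ |p.2| ≤ 3 / 4 := fun h => hy ⟨p, h, rfl⟩
        rw [hm.mobLift_apply hF hp1]
        have ht : tent p.2 = 0 := max_eq_left (by linarith)
        have hp0 : p.2 ≠ 0 := fun h => by rw [h] at hp2; norm_num at hp2
        have hLp : L p = p.2 * Complex.I := by
          apply Complex.ext <;> simp [L, planeField, ht]
        have hne : L p ≠ 0 := by simp [hLp, hp0]
        change _ = dir (L p) * dir (L p)
        rw [← dir_mul hne hne, hLp, dir]
        congr 1
        have : (p.2 * Complex.I * (p.2 * Complex.I) : ℂ) = ((-(p.2 * p.2) : ℝ) : ℂ) := by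
          rw [mul_mul_mul_comm, Complex.I_mul_I]; push_cast; ring
        rw [this, Complex.arg_ofReal_of_neg]
        have := mul_self_pos.2 hp0
        linarith
      · rw [mobLift_of_notMem hy1]
  · have hne : ∀ s, L (s, 0) ≠ 0 := by
      intro s h
      obtain ⟨k, -, h2⟩ := planeField_eq_zero h0 h
      rcases mul_eq_zero.1 h2.symm with h3 | h3
      · exact zpow_ne_zero k (by norm_num) h3
      · exact h0' h3
    have hc : Continuous fun s : ℝ => dir (L (s, 0)) := by
      rw [continuous_iff_continuousAt]
      intro s
      exact ContinuousAt.comp (g := dir) (f := fun s => L (s, 0)) (continuousAt_dir (hne s))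
        (hL.comp (by fun_prop)).continuousAt
    obtain ⟨w, hw, hwe⟩ := exists_circle_lift hc
    obtain ⟨k, hk⟩ := exists_int_of_exp_eq (F := fun s => w (s + 1)) (G := fun s => Real.pi + w s)
      isPreconnected_univ (by fun_prop) (by fun_prop) (fun s _ => by
        rw [hwe, Circle.exp_add, hwe, ← dir_neg (hne s)]
        congr 1
        simpa [L] using planeField_twist s₀ (t₀ / tent t₀) s 0)
    refine ⟨fun s => w s + w s, 4 * Real.pi * (1 + 2 * k), by fun_prop, ?_, fun s => ?_, fun s => ?_⟩
    · refine mul_ne_zero (by positivity) ?_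
      have : (1 + 2 * k : ℤ) ≠ 0 := by omega
      exact_mod_cast this
    · rw [hm.mobLift_apply hF (by simp), Circle.exp_add, hwe]
    · have e1 := hk s trivial
      have e2 := hk (s + 1) trivial
      simp only [show s + 1 + 1 = s + 2 by ring] at e1 e2
      simp only [e2, e1]
      ring

end Angle

section Ray

/-- A form of König's lemma. -/
lemma exists_ray {V : Type*} (adj : V → V → Prop) (hfin : ∀ a, {b | adj a b}.Finite) (a₀ : V)
    (hinf : {b | Relation.ReflTransGen adj a₀ b}.Infinite) :
    ∃ a : ℕ → V, a 0 = a₀ ∧ Function.Injective a ∧ ∀ n, adj (a n) (a (n + 1)) := by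
  let comp : Set V → V → Set V := fun A a =>
    {b | Relation.ReflTransGen (fun x y => adj x y ∧ y ∉ A) a b}
  have step : ∀ (A : Set V) (a : V), (comp A a).Infinite →
      ∃ b, adj a b ∧ b ∉ insert a A ∧ (comp (insert a A) b).Infinite := by
    intro A a h
    by_contra! hcon
    have hsub : comp A a ⊆ {a} ∪ ⋃ b ∈ {b | adj a b ∧ b ∉ insert a A}, comp (insert a A) b := by
      intro y hy
      induction hy with
      | refl => exact Or.inl rfl
      | @tail x y _ hxy ih =>
        by_cases hya : y = a
        · exact Or.inl hya
        have hy : y ∉ insert a A := by simp [hya, hxy.2]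
        refine Or.inr ?_
        rcases ih with rfl | ih
        · exact mem_iUnion₂.2 ⟨y, ⟨hxy.1, hy⟩, Relation.ReflTransGen.refl⟩
        · obtain ⟨b, hb, hxb⟩ := mem_iUnion₂.1 ih
          exact mem_iUnion₂.2 ⟨b, hb, hxb.tail ⟨hxy.1, hy⟩⟩
    refine h (Set.Finite.subset ((finite_singleton a).union (Set.Finite.biUnion
      ((hfin a).subset fun b hb => hb.1) fun b hb => ?_)) hsub)
    exact hcon b hb.1 hb.2
  choose! nxt h1 h2 h3 using step
  let st : ℕ → Set V × V := fun n => Nat.rec (∅, a₀) (fun _ q => (insert q.2 q.1, nxt q.1 q.2)) n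
  have hinf' : ∀ n, (comp (st n).1 (st n).2).Infinite := by
    intro n
    induction n with
    | zero => simpa [comp, st] using hinf
    | succ n ih => exact h3 _ _ ih
  have hmem : ∀ n k, (st n).2 ∈ (st (n + 1 + k)).1 := by
    intro n k
    induction k with
    | zero => exact mem_insert _ _
    | succ k ih => exact mem_insert_of_mem _ ih
  have hne : ∀ n k, (st (n + 1 + k)).2 ≠ (st n).2 := by
    intro n k h
    have h4 := h2 _ _ (hinf' (n + k))
    have h5 : (st (n + k + 1)).2 ∉ (st (n + k + 1)).1 := h4
    rw [show n + k + 1 = n + 1 + k by omega] at h5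
    exact h5 (h ▸ hmem n k)
  refine ⟨fun n => (st n).2, rfl, fun n n' h => ?_, fun n => h1 _ _ (hinf' n)⟩
  rcases lt_trichotomy n n' with hlt | rfl | hlt
  · obtain ⟨k, rfl⟩ := Nat.exists_eq_add_of_le (Nat.succ_le_of_lt hlt)
    exact absurd h.symm (hne n k)
  · rfl
  · obtain ⟨k, rfl⟩ := Nat.exists_eq_add_of_le (Nat.succ_le_of_lt hlt)
    exact absurd h (hne n' k)

lemma exists_ray_of_cover {S V : Type*} [TopologicalSpace S] [PreconnectedSpace S]
    [NoncompactSpace S] (I : V → Set S) (ho : ∀ a, IsOpen (I a)) (hne : ∀ a, (I a).Nonempty)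
    (hcov : ⋃ a, I a = univ) (hlf : LocallyFinite I) (K : V → Set S)
    (hK : ∀ a, IsCompact (K a)) (hIK : ∀ a, I a ⊆ K a) (a₀ : V) :
    ∃ a : ℕ → V, a 0 = a₀ ∧ Function.Injective a ∧ ∀ n, (I (a n) ∩ I (a (n + 1))).Nonempty := by
  refine exists_ray (fun a b => (I a ∩ I b).Nonempty) (fun a => ?_) a₀ fun hfin => ?_
  · refine (hlf.finite_nonempty_inter_compact (hK a)).subset ?_
    rintro b ⟨x, hx1, hx2⟩
    exact ⟨x, hx2, hIK a hx1⟩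
  · set R := {b | Relation.ReflTransGen (fun a b => (I a ∩ I b).Nonempty) a₀ b}
    have hcl : IsClopen (⋃ a ∈ R, I a) := by
      refine ⟨?_, isOpen_biUnion fun a _ => ho a⟩
      have : ⋃ a ∈ R, I a = (⋃ a ∈ Rᶜ, I a)ᶜ := by
        refine Subset.antisymm ?_ fun x hx => ?_
        · refine iUnion₂_subset fun a ha x hx hx' => ?_
          obtain ⟨b, hb, hxb⟩ := mem_iUnion₂.1 hx'
          exact hb (Relation.ReflTransGen.tail ha ⟨x, hx, hxb⟩)
        · obtain ⟨a, ha⟩ := mem_iUnion.1 (hcov.symm.subset (mem_univ x))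
          by_contra h
          exact hx (mem_iUnion₂.2 ⟨a, fun haR => h (mem_iUnion₂.2 ⟨a, haR, ha⟩), ha⟩)
      rw [this]
      exact (isOpen_biUnion fun a _ => ho a).isClosed_compl
    have hu := hcl.eq_univ (by
      obtain ⟨x, hx⟩ := hne a₀
      exact ⟨x, mem_iUnion₂.2 ⟨a₀, Relation.ReflTransGen.refl, hx⟩⟩)
    have hc : IsCompact (⋃ a ∈ R, K a) := hfin.isCompact_biUnion fun a _ => hK a
    refine noncompact_univ S (hc.of_isClosed_subset isClosed_univ ?_)
    rw [← hu]
    exact iUnion₂_mono fun a _ => hIK a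

variable {S : Type*} [TopologicalSpace S] [T2Space S]

lemma exists_push_along {f : S → Circle} {η : ℕ → ℝ × ℝ → S} {p : ℕ → S}
    (hη : ∀ n, IsCell (η n)) (hlf : LocallyFinite fun n => η n '' closedBall 0 1)
    (hp : ∀ n, p n ∈ η n '' ball 0 1) (hp' : ∀ n, p (n + 1) ∈ η n '' ball 0 1)
    (hf : ∀ x, x ≠ p 0 → ContinuousAt f x) :
    ∃ θ : S → Circle, Continuous θ ∧ ∀ x, (∀ n, x ∉ η n '' closedBall 0 1) → θ x = f x := by
  have hψ : ∀ n, ∃ ψ : S ≃ₜ S, ψ (p (n + 1)) = p n ∧ ∀ x ∉ η n '' ball 0 1, ψ x = x := by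
    intro n
    obtain ⟨a, ha, ha'⟩ := hp n
    obtain ⟨b, hb, hb'⟩ := hp' n
    rw [← ha', ← hb']
    exact (hη n).exists_move hb ha
  choose ψ hψ1 hψ2 using hψ
  let F : ℕ → S → Circle := fun n => Nat.rec f (fun n g => g ∘ ψ n) n
  have hFs : ∀ n x, F (n + 1) x = F n (ψ n x) := fun n x => rfl
  have hFc : ∀ n x, x ≠ p n → ContinuousAt (F n) x := by
    intro n
    induction n with
    | zero => exact hf
    | succ n ih =>
      intro x hx
      refine ContinuousAt.comp (ih _ fun h => hx ((ψ n).injective ?_)) (ψ n).continuous.continuousAt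
      rw [h, hψ1]
  have hsub : ∀ n, η n '' ball 0 1 ⊆ η n '' closedBall 0 1 :=
    fun n => image_mono ball_subset_closedBall
  have hlf' : LocallyFinite fun n => {x | F (n + 1) x ≠ F n x} := by
    refine hlf.subset fun n x hx => ?_
    by_contra h
    refine hx ?_
    rw [hFs, hψ2 n x fun h' => h (hsub n h')]
  obtain ⟨θ, hθ⟩ := hlf'.exists_forall_eventually_atTop_eventuallyEq
  refine ⟨θ, ?_, fun x hx => ?_⟩
  · rw [continuous_iff_continuousAt]
    intro x
    have h1 : ∀ᶠ n in atTop, x ∉ η n '' closedBall 0 1 := by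
      rw [← Nat.cofinite_eq_atTop]
      have := (hlf.point_finite x).compl_mem_cofinite
      filter_upwards [this] with n hn using hn
    obtain ⟨n, h2, h3⟩ := ((hθ x).and h1).exists
    exact (hFc n x fun h => h3 (hsub n (h ▸ hp n))).congr h2
  · have h1 : ∀ n, F n x = f x := by
      intro n
      induction n with
      | zero => rfl
      | succ n ih => rw [hFs, hψ2 n x fun h' => hx n (hsub n h'), ih]
    obtain ⟨n, hn⟩ := (hθ x).exists
    rw [← hn.eq_of_nhds, h1]

lemma IsMobius.exists_winds [SigmaCompactSpace S] [PreconnectedSpace S] [NoncompactSpace S]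
    (hS : Surf S) {m : ℝ × ℝ → S} (hm : IsMobius m) :
    ∃ θ : S → Circle, Continuous θ ∧ Winds θ m := by
  have hlc : WeaklyLocallyCompactSpace S := ⟨fun x => by
    obtain ⟨η, h1, -, h2⟩ := hS x univ univ_mem
    exact ⟨_, h1.isCompact_image, h2⟩⟩
  have hW : IsOpen (m '' ostrip (1 / 2)) :=
    hm.isOpen_image hS (isOpen_ostrip _) fun p (hp : |p.2| < 1 / 2) =>
      show |p.2| < 1 by linarith
  have hZ : IsClosed (m '' strip 0) := (hm.isCompact_strip 0).isClosed
  have hZW : m '' strip 0 ⊆ m '' ostrip (1 / 2) :=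
    image_mono fun p (hp : |p.2| ≤ 0) => show |p.2| < 1 / 2 by linarith
  have hB : ∀ x ∈ (m '' ostrip (1 / 2))ᶜ, (𝓝 x).HasBasis
      (fun η : ℝ × ℝ → S => IsCell η ∧ η '' closedBall 0 1 ∈ 𝓝 x ∧
        Disjoint (η '' closedBall 0 1) (m '' strip 0))
      (fun η => interior (η '' closedBall 0 1)) := by
    intro x hx
    refine ⟨fun U => ⟨fun hU => ?_, ?_⟩⟩
    · obtain ⟨η, h1, h2, h3⟩ := hS x (U ∩ (m '' strip 0)ᶜ)
        (inter_mem hU (hZ.isOpen_compl.mem_nhds fun h => hx (hZW h)))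
      exact ⟨η, ⟨h1, h3, disjoint_left.2 fun y hy => (h2 hy).2⟩,
        fun y hy => (h2 (interior_subset hy)).1⟩
    · rintro ⟨η, ⟨-, h2, -⟩, h3⟩
      exact mem_of_superset (interior_mem_nhds.2 h2) h3
  obtain ⟨α, c, r, hcr, hcov, hlf⟩ :=
    refinement_of_locallyCompact_sigmaCompact_of_nhds_basis_set hW.isClosed_compl hB
  have hcl : ∀ a, r a '' closedBall 0 1 ⊆ closure (interior (r a '' closedBall 0 1)) := fun a =>
    (closedBall_subset_closure_image (hcr a).2.1).trans
      (closure_mono (interior_maximal (image_mono ball_subset_closedBall) (hcr a).2.1.isOpen))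
  let I : Option α → Set S := fun o =>
    o.elim (m '' ostrip (1 / 2)) fun a => interior (r a '' closedBall 0 1)
  let K : Option α → Set S := fun o => o.elim (m '' strip (1 / 2)) fun a => r a '' closedBall 0 1
  have hIlf : LocallyFinite I := by
    intro x
    obtain ⟨t, ht, hft⟩ := hlf x
    refine ⟨t, ht, ((hft.image some).union (finite_singleton none)).subset ?_⟩
    rintro (_ | a) h
    · exact Or.inr rfl
    · exact Or.inl ⟨a, h, rfl⟩
  obtain ⟨b, hb0, hbi, hb⟩ := exists_ray_of_cover I (by
      rintro (_ | a)
      · exact hW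
      · exact isOpen_interior) (by
      rintro (_ | a)
      · exact ⟨m (0, 0), (0, 0), by simp [ostrip], rfl⟩
      · exact ⟨c a, mem_interior_iff_mem_nhds.2 (hcr a).2.2.1⟩) (by
      refine eq_univ_of_forall fun x => ?_
      by_cases hx : x ∈ m '' ostrip (1 / 2)
      · exact mem_iUnion.2 ⟨none, hx⟩
      · obtain ⟨a, ha⟩ := mem_iUnion.1 (hcov hx)
        exact mem_iUnion.2 ⟨some a, ha⟩) hIlf K (by
      rintro (_ | a)
      · exact hm.isCompact_strip _
      · exact (hcr a).2.1.isCompact_image) (by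
      rintro (_ | a)
      · exact image_mono (ostrip_subset_strip le_rfl)
      · exact interior_subset) none
  have hbs : ∀ n, ∃ a, b (n + 1) = some a := fun n => by
    refine Option.ne_none_iff_exists'.1 fun h => ?_
    have := hbi (h.trans hb0.symm)
    omega
  choose a ha using hbs
  have hai : Function.Injective a := fun n n' h => by
    have := hbi (a₁ := n + 1) (a₂ := n' + 1) (by rw [ha, ha, h])
    omega
  have hcell : ∀ n, IsCell (r (a n)) := fun n => (hcr (a n)).2.1
  have hlf2 : LocallyFinite fun n => r (a n) '' closedBall 0 1 :=
    (hlf.closure.subset hcl).comp_injective hai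
  obtain ⟨p0, hp0, hp0'⟩ : (m '' ostrip (1 / 2) ∩ r (a 0) '' ball 0 1).Nonempty := by
    obtain ⟨x, hx, hx'⟩ := hb 0
    rw [hb0] at hx
    rw [ha] at hx'
    exact mem_closure_iff.1 (closedBall_subset_closure_image (hcell 0) (interior_subset hx'))
      _ hW hx
  have hnext : ∀ n, (r (a n) '' ball 0 1 ∩ r (a (n + 1)) '' ball 0 1).Nonempty := by
    intro n
    obtain ⟨x, hx, hx'⟩ := hb (n + 1)
    rw [ha] at hx hx'
    exact (hcell n).overlap (hcell (n + 1)) (mem_interior_iff_mem_nhds.1 hx)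
      (mem_interior_iff_mem_nhds.1 hx')
  choose q hq hq' using hnext
  obtain ⟨⟨s₀, t₀⟩, ht, rfl⟩ := hp0
  obtain ⟨f, hf, v, d, hv, hd, hfv, hvd⟩ := hm.exists_angle hS (s₀ := s₀) (t₀ := t₀) ht (by
    rintro rfl
    exact disjoint_left.1 (hcr (a 0)).2.2.2 (image_mono ball_subset_closedBall hp0')
      ⟨_, by simp [strip], rfl⟩)
  obtain ⟨θ, hθ, hθf⟩ := exists_push_along (f := f) (η := fun n => r (a n))
    (p := fun n => Nat.casesOn n (m (s₀, t₀)) q) hcell hlf2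
    (by rintro (_ | n); exacts [hp0', hq' n]) hq hf
  refine ⟨θ, hθ, v, d, hv, hd, fun s => ?_, hvd⟩
  rw [← hfv]
  exact hθf _ fun n hn => disjoint_left.1 (hcr (a n)).2.2.2 hn ⟨_, by simp [strip], rfl⟩

end Ray

section Charts

/-- The coordinates of a point of the half-plane. -/
def toP (x : EuclideanHalfSpace 2) : ℝ × ℝ := (x.1 0, x.1 1)

/-- The retraction of the plane onto the half-plane. -/
def ofP (p : ℝ × ℝ) : EuclideanHalfSpace 2 := ⟨!₂[max p.1 0, p.2], by simp⟩

lemma continuous_toP : Continuous toP := by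
  have h : Continuous (fun x : EuclideanHalfSpace 2 => x.1) := continuous_subtype_val
  unfold toP
  fun_prop

lemma continuous_ofP : Continuous ofP := by
  refine Continuous.subtype_mk (?_ : Continuous fun p : ℝ × ℝ => !₂[max p.1 0, p.2]) _
  refine (PiLp.continuous_toLp 2 _).comp (continuous_pi fun i => ?_)
  fin_cases i
  · exact continuous_fst.max continuous_const
  · exact continuous_snd

lemma toP_nonneg (x : EuclideanHalfSpace 2) : 0 ≤ (toP x).1 := x.2

lemma ofP_toP (x : EuclideanHalfSpace 2) : ofP (toP x) = x := by
  apply Subtype.ext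
  ext i
  fin_cases i
  · exact max_eq_left x.2
  · rfl

lemma toP_ofP {p : ℝ × ℝ} (hp : 0 ≤ p.1) : toP (ofP p) = p := by
  simp [toP, ofP, hp]

lemma toP_injective : Function.Injective toP := Function.LeftInverse.injective ofP_toP

variable {M : Type*} [TopologicalSpace M]

lemma pos_of_isOpen {V : Set (ℝ × ℝ)} (hV : IsOpen V) (h : ∀ p ∈ V, 0 ≤ p.1) {p : ℝ × ℝ}
    (hp : p ∈ V) : 0 < p.1 := by
  have h1 : Prod.fst '' V ⊆ interior (Ici (0 : ℝ)) := by
    refine interior_maximal ?_ (isOpenMap_fst _ hV)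
    rintro _ ⟨q, hq, rfl⟩
    exact h q hq
  rw [interior_Ici] at h1
  exact h1 ⟨p, hp, rfl⟩

/-- Invariance of the boundary. -/
lemma chart_pos_of_pos (e e' : OpenPartialHomeomorph M (EuclideanHalfSpace 2)) {y : M}
    (hy : y ∈ e.source) (hy' : y ∈ e'.source) (h : 0 < (toP (e y)).1) : 0 < (toP (e' y)).1 := by
  let U : Set (ℝ × ℝ) := {p | 0 < p.1} ∩ ofP ⁻¹' (e.target ∩ e.symm ⁻¹' e'.source)
  have hU : IsOpen U := (isOpen_lt continuous_const continuous_fst).inter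
    ((e.symm.isOpen_inter_preimage e'.open_source).preimage continuous_ofP)
  let f : ℝ × ℝ → ℝ × ℝ := fun p => toP (e' (e.symm (ofP p)))
  have hf : ContinuousOn f U := continuous_toP.comp_continuousOn
    (e'.continuousOn.comp (e.symm.continuousOn.comp continuous_ofP.continuousOn
      fun p hp => hp.2.1) fun p hp => hp.2.2)
  have hi : InjOn f U := by
    intro p hp q hq hpq
    have h1 := e'.injOn hp.2.2 hq.2.2 (toP_injective hpq)
    have h2 := e.symm.injOn hp.2.1 hq.2.1 h1
    rw [← toP_ofP (le_of_lt hp.1), h2, toP_ofP (le_of_lt hq.1)]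
  refine pos_of_isOpen (isOpen_image_prod hU hf hi) ?_ ⟨toP (e y), ⟨h, ?_⟩, ?_⟩
  · rintro _ ⟨p, -, rfl⟩
    exact toP_nonneg _
  · simp only [mem_preimage, ofP_toP, mem_inter_iff]
    exact ⟨e.map_source hy, by rwa [e.left_inv hy]⟩
  · simp only [f, ofP_toP, e.left_inv hy]

variable [ChartedSpace (EuclideanHalfSpace 2) M]

lemma mem_surfaceBoundary_iff (e : OpenPartialHomeomorph M (EuclideanHalfSpace 2)) {y : M}
    (hy : y ∈ e.source) : y ∈ surfaceBoundary M ↔ (toP (e y)).1 = 0 := by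
  have h1 : y ∈ surfaceBoundary M ↔ (toP (chartAt (EuclideanHalfSpace 2) y y)).1 = 0 := by
    change extChartAt (modelWithCornersEuclideanHalfSpace 2) y y ∈
      frontier (range (modelWithCornersEuclideanHalfSpace 2)) ↔ _
    rw [frontier_range_modelWithCornersEuclideanHalfSpace]
    exact eq_comm
  rw [h1]
  have hy' := mem_chart_source (EuclideanHalfSpace 2) y
  constructor
  · intro h
    by_contra h2
    exact (chart_pos_of_pos e _ hy hy' (lt_of_le_of_ne (toP_nonneg _) (Ne.symm h2))).ne' h
  · intro h
    by_contra h2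
    exact (chart_pos_of_pos _ e hy' hy (lt_of_le_of_ne (toP_nonneg _) (Ne.symm h2))).ne' h

lemma homeo_mem_surfaceBoundary_iff (g : M ≃ₜ M) (x : M) :
    g x ∈ surfaceBoundary M ↔ x ∈ surfaceBoundary M := by
  have h := mem_chart_source (EuclideanHalfSpace 2) (g x)
  rw [mem_surfaceBoundary_iff _ h, mem_surfaceBoundary_iff
    (g.toOpenPartialHomeomorph.trans (chartAt (EuclideanHalfSpace 2) (g x))) (by simp)]
  rfl

/-- A planar affine map acting separately on the two coordinates. -/
def affHomeo (c₁ c₂ : ℝ) {r₁ r₂ : ℝ} (h₁ : 0 < r₁) (h₂ : 0 < r₂) : ℝ × ℝ ≃ₜ ℝ × ℝ where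
  toFun v := (c₁ + r₁ * v.1, c₂ + r₂ * v.2)
  invFun v := ((v.1 - c₁) / r₁, (v.2 - c₂) / r₂)
  left_inv v := by ext <;> simp <;> field_simp
  right_inv v := by ext <;> simp <;> field_simp <;> ring
  continuous_toFun := by fun_prop
  continuous_invFun := by fun_prop

section
omit [ChartedSpace (EuclideanHalfSpace 2) M]
variable (e : OpenPartialHomeomorph M (EuclideanHalfSpace 2)) (A : ℝ × ℝ ≃ₜ ℝ × ℝ)

/-- The inverse of a chart in affine coordinates. -/
def chartParam (v : ℝ × ℝ) : M := e.symm (ofP (A v))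

variable {e A} {V : Set (ℝ × ℝ)}

lemma continuousOn_chartParam (hV : ∀ v ∈ V, ofP (A v) ∈ e.target) :
    ContinuousOn (chartParam e A) V :=
  e.symm.continuousOn.comp (continuous_ofP.comp A.continuous).continuousOn hV

lemma toP_chartParam {v : ℝ × ℝ} (hV : ofP (A v) ∈ e.target) (hV' : 0 ≤ (A v).1) :
    toP (e (chartParam e A v)) = A v := by
  rw [chartParam, e.right_inv hV, toP_ofP hV']

lemma chartParam_mem_source {v : ℝ × ℝ} (hV : ofP (A v) ∈ e.target) :
    chartParam e A v ∈ e.source := e.map_target hV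

lemma injOn_chartParam (hV : ∀ v ∈ V, ofP (A v) ∈ e.target) (hV' : ∀ v ∈ V, 0 ≤ (A v).1) :
    InjOn (chartParam e A) V := by
  intro v hv w hw h
  apply A.injective
  rw [← toP_chartParam (hV v hv) (hV' v hv), ← toP_chartParam (hV w hw) (hV' w hw), h]

lemma image_chartParam (hV : ∀ v ∈ V, ofP (A v) ∈ e.target) (hV' : ∀ v ∈ V, 0 ≤ (A v).1) :
    chartParam e A '' V = e.source ∩ e ⁻¹' ((fun x => A.symm (toP x)) ⁻¹' V) := by
  ext y
  constructor
  · rintro ⟨v, hv, rfl⟩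
    refine ⟨chartParam_mem_source (hV v hv), ?_⟩
    simp only [mem_preimage]
    rwa [toP_chartParam (hV v hv) (hV' v hv), A.symm_apply_apply]
  · rintro ⟨h1, h2⟩
    refine ⟨_, h2, ?_⟩
    simp only [chartParam, A.apply_symm_apply, ofP_toP, e.left_inv h1]

lemma isOpen_image_chartParam (hV : ∀ v ∈ V, ofP (A v) ∈ e.target) (hV' : ∀ v ∈ V, 0 ≤ (A v).1)
    {W : Set (ℝ × ℝ)} (hW : IsOpen W) (h : ∀ v ∈ W, 0 ≤ (A v).1 → v ∈ V) (hVW : V ⊆ W) :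
    IsOpen (chartParam e A '' V) := by
  have h1 : (fun x => A.symm (toP x)) ⁻¹' V = (fun x => A.symm (toP x)) ⁻¹' W := by
    ext x
    exact ⟨fun hx => hVW hx, fun hx => h _ hx (by simpa using toP_nonneg x)⟩
  rw [image_chartParam hV hV', h1]
  exact e.isOpen_inter_preimage (hW.preimage (A.symm.continuous.comp continuous_toP))

lemma exists_delta {x : M} (hx : x ∈ e.source) {U : Set M} (hU : U ∈ 𝓝 x) :
    ∃ δ > 0, ∀ p ∈ closedBall (toP (e x)) δ, ofP p ∈ e.target ∧ e.symm (ofP p) ∈ U := by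
  have h1 : ∀ᶠ h in 𝓝 (e x), h ∈ e.target ∧ e.symm h ∈ U := by
    refine (e.open_target.eventually_mem (e.map_source hx)).and ?_
    have := (e.continuousAt_symm (e.map_source hx))
    rw [ContinuousAt, e.left_inv hx] at this
    exact this hU
  have h2 : ∀ᶠ p in 𝓝 (toP (e x)), ofP p ∈ e.target ∧ e.symm (ofP p) ∈ U := by
    have h3 := continuous_ofP.tendsto (toP (e x))
    rw [ofP_toP] at h3
    exact h3.eventually h1
  obtain ⟨δ, hδ, h⟩ := nhds_basis_closedBall.eventually_iff.1 h2
  exact ⟨δ, hδ, fun p hp => h hp⟩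

end

lemma surf_of_chartedSpace : Surf M := by
  intro x U hU
  set e := chartAt (EuclideanHalfSpace 2) x
  have hx : x ∈ e.source := mem_chart_source _ x
  obtain ⟨δ, hδ, h⟩ := exists_delta hx hU
  set p := toP (e x)
  have hp : 0 ≤ p.1 := toP_nonneg _
  have hr : 0 < (p.1 + δ - max 0 (p.1 - δ)) / 2 := by
    rcases max_cases 0 (p.1 - δ) with ⟨h1, -⟩ | ⟨h1, -⟩ <;> rw [h1] <;> linarith
  set A := affHomeo ((p.1 + δ + max 0 (p.1 - δ)) / 2) p.2 hr hδ
  have hA1 : ∀ v, (A v).1 = (p.1 + δ + max 0 (p.1 - δ)) / 2 +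
    (p.1 + δ - max 0 (p.1 - δ)) / 2 * v.1 := fun v => rfl
  have hA2 : ∀ v, (A v).2 = p.2 + δ * v.2 := fun v => rfl
  have hm0 := le_max_left 0 (p.1 - δ)
  have hm1 := le_max_right 0 (p.1 - δ)
  have hcb : ∀ v ∈ closedBall (0 : ℝ × ℝ) 1, -1 ≤ v.1 ∧ v.1 ≤ 1 ∧ -1 ≤ v.2 ∧ v.2 ≤ 1 := by
    intro v hv
    rw [mem_closedBall_zero_iff, norm_prod_le_iff, Real.norm_eq_abs, Real.norm_eq_abs, abs_le,
      abs_le] at hv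
    exact ⟨hv.1.1, hv.1.2, hv.2.1, hv.2.2⟩
  have hnn : ∀ v ∈ closedBall (0 : ℝ × ℝ) 1, 0 ≤ (A v).1 := by
    intro v hv
    rw [hA1]
    nlinarith [(hcb v hv).1]
  have hball : ∀ v ∈ closedBall (0 : ℝ × ℝ) 1, A v ∈ closedBall p δ := by
    intro v hv
    obtain ⟨h1, h2, h3, h4⟩ := hcb v hv
    rw [mem_closedBall_iff_norm, norm_prod_le_iff, Real.norm_eq_abs, Real.norm_eq_abs, abs_le,
      abs_le, Prod.fst_sub, Prod.snd_sub, hA1, hA2]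
    refine ⟨⟨?_, ?_⟩, ?_, ?_⟩ <;> nlinarith
  have ht : ∀ v ∈ closedBall (0 : ℝ × ℝ) 1, ofP (A v) ∈ e.target := fun v hv => (h _ (hball v hv)).1
  refine ⟨chartParam e A, ⟨continuousOn_chartParam ht, injOn_chartParam ht hnn, ?_⟩, ?_, ?_⟩
  · exact isOpen_image_chartParam (fun v hv => ht v (ball_subset_closedBall hv))
      (fun v hv => hnn v (ball_subset_closedBall hv)) isOpen_ball (fun v hv _ => hv) subset_rfl
  · rintro _ ⟨v, hv, rfl⟩
    exact (h _ (hball v hv)).2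
  · rw [image_chartParam ht hnn]
    have h1 : e.source ∩ e ⁻¹' (toP ⁻¹' ball p δ) ∈ 𝓝 x :=
      (e.isOpen_inter_preimage (isOpen_ball.preimage continuous_toP)).mem_nhds
        ⟨hx, mem_ball_self hδ⟩
    refine mem_of_superset h1 ?_
    rintro y ⟨hy1, hy2⟩
    refine ⟨hy1, ?_⟩
    have h3 : toP (e y) ∈ ball p δ := hy2
    have h0 := toP_nonneg (e y)
    rw [mem_ball_iff_norm, Prod.norm_def, max_lt_iff, Real.norm_eq_abs, Real.norm_eq_abs, abs_lt,
      abs_lt] at h3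
    simp only [Prod.fst_sub, Prod.snd_sub] at h3
    obtain ⟨⟨h4, h5⟩, h6, h7⟩ := h3
    have h8 : max 0 (p.1 - δ) ≤ (toP (e y)).1 := max_le h0 (by linarith)
    change A.symm (toP (e y)) ∈ closedBall (0 : ℝ × ℝ) 1
    rw [mem_closedBall_zero_iff, norm_prod_le_iff, Real.norm_eq_abs, Real.norm_eq_abs, abs_le,
      abs_le]
    have hs : A.symm (toP (e y)) = (((toP (e y)).1 - (p.1 + δ + max 0 (p.1 - δ)) / 2) /
      ((p.1 + δ - max 0 (p.1 - δ)) / 2), ((toP (e y)).2 - p.2) / δ) := rfl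
    rw [hs]
    refine ⟨⟨?_, ?_⟩, ?_, ?_⟩
    · rw [le_div_iff₀ hr]; linarith
    · rw [div_le_iff₀ hr]; linarith
    · rw [le_div_iff₀ hδ]; linarith
    · rw [div_le_iff₀ hδ]; linarith

/-- The closed right half of the square. -/
def halfSq : Set (ℝ × ℝ) := closedBall 0 1 ∩ {v | 0 ≤ v.1}

/-- A half-square in `M` with one side on `C`. -/
structure IsHalfCell (C : Set M) (ψ : ℝ × ℝ → M) : Prop where
  cont : ContinuousOn ψ halfSq
  inj : InjOn ψ halfSq
  isOpen : IsOpen (ψ '' (ball 0 1 ∩ {v | 0 ≤ v.1}))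
  mem_iff : ∀ v ∈ halfSq, ψ v ∈ C ↔ v.1 = 0

lemma exists_isHalfCell_surfaceBoundary {x : M} (hx : x ∈ surfaceBoundary M) {U : Set M}
    (hU : U ∈ 𝓝 x) : ∃ ψ : ℝ × ℝ → M, IsHalfCell (surfaceBoundary M) ψ ∧ ψ 0 = x ∧
      ψ '' halfSq ⊆ U := by
  set e := chartAt (EuclideanHalfSpace 2) x
  have hxs : x ∈ e.source := mem_chart_source _ x
  obtain ⟨δ, hδ, h⟩ := exists_delta hxs hU
  have hp0 : (toP (e x)).1 = 0 := (mem_surfaceBoundary_iff e hxs).1 hx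
  set p := toP (e x) with hp
  set A := affHomeo 0 p.2 hδ hδ
  have hA1 : ∀ v, (A v).1 = δ * v.1 := fun v => zero_add _
  have hA2 : ∀ v, (A v).2 = p.2 + δ * v.2 := fun v => rfl
  have hA0 : ∀ v, 0 ≤ (A v).1 ↔ 0 ≤ v.1 := fun v => by rw [hA1, mul_nonneg_iff_of_pos_left hδ]
  have hball : ∀ v ∈ closedBall (0 : ℝ × ℝ) 1, A v ∈ closedBall p δ := by
    intro v hv
    have h1 : A v - p = δ • v := by
      ext
      · simp [hA1, hp0]
      · simp [hA2]
    rw [mem_closedBall_zero_iff] at hv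
    rw [mem_closedBall_iff_norm, h1, norm_smul, Real.norm_of_nonneg hδ.le]
    exact mul_le_of_le_one_right hδ.le hv
  have ht : ∀ v ∈ halfSq, ofP (A v) ∈ e.target := fun v hv => (h _ (hball v hv.1)).1
  have hnn : ∀ v ∈ halfSq, 0 ≤ (A v).1 := fun v hv => (hA0 v).2 hv.2
  have hsub : ball (0 : ℝ × ℝ) 1 ∩ {v | 0 ≤ v.1} ⊆ halfSq := fun v hv =>
    ⟨ball_subset_closedBall hv.1, hv.2⟩
  refine ⟨chartParam e A, ⟨continuousOn_chartParam ht, injOn_chartParam ht hnn, ?_, ?_⟩, ?_, ?_⟩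
  · exact isOpen_image_chartParam (fun v hv => ht v (hsub hv)) (fun v hv => hnn v (hsub hv))
      isOpen_ball (fun v hv hv' => ⟨hv, (hA0 v).1 hv'⟩) inter_subset_left
  · intro v hv
    rw [mem_surfaceBoundary_iff e (chartParam_mem_source (ht v hv)),
      toP_chartParam (ht v hv) (hnn v hv), hA1]
    simp [hδ.ne']
  · have : A 0 = toP (e x) := by
      ext
      · rw [hA1, ← hp, hp0]; simp
      · rw [hA2]; simp [hp]
    rw [chartParam, this, ofP_toP, e.left_inv hxs]
  · rintro _ ⟨v, hv, rfl⟩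
    exact (h _ (hball v hv.1)).2

lemma exists_isHalfCell {C : Set M}
    (hC : ∃ x ∈ surfaceBoundary M, C = connectedComponentIn (surfaceBoundary M) x) {x : M}
    (hx : x ∈ C) {U : Set M} (hU : U ∈ 𝓝 x) :
    ∃ ψ : ℝ × ℝ → M, IsHalfCell C ψ ∧ IsHalfCell (surfaceBoundary M) ψ ∧ ψ 0 = x ∧
      ψ '' halfSq ⊆ U := by
  obtain ⟨y, hy, rfl⟩ := hC
  have hsub := connectedComponentIn_subset (surfaceBoundary M) y
  obtain ⟨ψ, h1, h2, h3⟩ := exists_isHalfCell_surfaceBoundary (hsub hx) hU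
  refine ⟨ψ, ⟨h1.cont, h1.inj, h1.isOpen, fun v hv => ⟨fun h => (h1.mem_iff v hv).1 (hsub h), ?_⟩⟩,
    h1, h2, h3⟩
  intro hv0
  rw [connectedComponentIn_eq hx]
  have hconv : Convex ℝ (closedBall (0 : ℝ × ℝ) 1 ∩ {v | v.1 = 0}) := by
    refine (convex_closedBall _ _).inter ?_
    intro a ha b hb s t _ _ _
    have ha' : a.1 = 0 := ha
    have hb' : b.1 = 0 := hb
    simp [ha', hb']
  have hss : closedBall (0 : ℝ × ℝ) 1 ∩ {v | v.1 = 0} ⊆ halfSq := fun v hv =>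
    ⟨hv.1, (show v.1 = 0 from hv.2).ge⟩
  have hpre := hconv.isPreconnected.image ψ (h1.cont.mono hss)
  refine hpre.subset_connectedComponentIn ⟨0, ⟨by simp, rfl⟩, h2⟩ ?_ ⟨v, ⟨hv.1, hv0⟩, rfl⟩
  rintro _ ⟨w, hw, rfl⟩
  exact (h1.mem_iff w (hss hw)).2 hw.2

lemma exists_isOpen_inter_surfaceBoundary {C : Set M}
    (hC : ∃ x ∈ surfaceBoundary M, C = connectedComponentIn (surfaceBoundary M) x) :
    ∃ W, IsOpen W ∧ C ⊆ W ∧ ∀ x ∈ W, x ∈ surfaceBoundary M → x ∈ C := by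
  have h : ∀ x : C, ∃ V : Set M, IsOpen V ∧ (x : M) ∈ V ∧
      ∀ y ∈ V, y ∈ surfaceBoundary M → y ∈ C := by
    intro x
    obtain ⟨ψ, h1, h2, h3, -⟩ := exists_isHalfCell hC x.2 univ_mem
    refine ⟨_, h1.isOpen, ⟨0, by simp, h3⟩, ?_⟩
    rintro _ ⟨v, hv, rfl⟩ hy
    have hv' : v ∈ halfSq := ⟨ball_subset_closedBall hv.1, hv.2⟩
    exact (h1.mem_iff v hv').2 ((h2.mem_iff v hv').1 hy)
  choose V h1 h2 h3 using h
  refine ⟨⋃ x, V x, isOpen_iUnion h1, fun x hx => mem_iUnion.2 ⟨⟨x, hx⟩, h2 _⟩, fun x hx => ?_⟩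
  obtain ⟨y, hy⟩ := mem_iUnion.1 hx
  exact h3 y x hy

lemma homeo_image_component {C : Set M}
    (hC : ∃ x ∈ surfaceBoundary M, C = connectedComponentIn (surfaceBoundary M) x) (g : M ≃ₜ M) :
    (∀ x ∈ C, g x ∈ C) ∨ ∀ x ∈ C, g x ∉ C := by
  by_contra! h
  obtain ⟨⟨a, ha, ha'⟩, b, hb, hb'⟩ := h
  obtain ⟨y, hy, rfl⟩ := hC
  refine ha' ?_
  rw [connectedComponentIn_eq hb']
  have hpre : IsPreconnected (g '' connectedComponentIn (surfaceBoundary M) y) :=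
    isPreconnected_connectedComponentIn.image _ g.continuous.continuousOn
  refine hpre.subset_connectedComponentIn ⟨b, hb, rfl⟩ ?_ ⟨a, ha, rfl⟩
  rintro _ ⟨x, hx, rfl⟩
  exact (homeo_mem_surfaceBoundary_iff g x).2 (connectedComponentIn_subset _ _ hx)

end Charts

section Capping

/-- A circle `C` in `M` parametrized by rays in the plane. -/
structure IsLoop {M : Type*} [TopologicalSpace M] (C : Set M) (γ : ℝ × ℝ → M) : Prop where
  cont : ContinuousOn γ {0}ᶜ
  smul : ∀ (r : ℝ) v, 0 < r → γ (r • v) = γ v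
  bij : BijOn γ (sphere 0 1) C

/-- `S` is obtained from `M` by gluing a disc along `C`. -/
structure IsCap {M S : Type*} [TopologicalSpace M] [TopologicalSpace S] (C : Set M)
    (γ : ℝ × ℝ → M) (i : M → S) (j : ℝ × ℝ → S) : Prop where
  emb : IsClosedEmbedding i
  cont : ContinuousOn j (closedBall 0 1)
  inj : InjOn j (closedBall 0 1)
  eq : ∀ v ∈ sphere (0 : ℝ × ℝ) 1, j v = i (γ v)
  notMem : ∀ v ∈ ball (0 : ℝ × ℝ) 1, ∀ x, j v ≠ i x
  cover : ∀ p, (∃ x, i x = p) ∨ ∃ v ∈ closedBall (0 : ℝ × ℝ) 1, j v = p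

lemma exists_isLoop {M : Type*} [TopologicalSpace M] {C : Set M} (φ : C ≃ₜ Circle2) :
    ∃ γ, IsLoop C γ := by
  let E : ℝ × ℝ → EuclideanSpace ℝ (Fin 2) := fun v => !₂[v.1, v.2]
  have hE : Continuous E := by
    refine (PiLp.continuous_toLp 2 _).comp (continuous_pi fun i => ?_)
    fin_cases i
    · exact continuous_fst
    · exact continuous_snd
  have hEi : Function.Injective E := by
    intro v w h
    have h0 := congrArg (fun u : EuclideanSpace ℝ (Fin 2) => u 0) h
    have h1 := congrArg (fun u : EuclideanSpace ℝ (Fin 2) => u 1) h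
    exact Prod.ext h0 h1
  have hE0 : E 0 = 0 := by ext i; fin_cases i <;> rfl
  have hEne : ∀ v, v ≠ 0 → E v ≠ 0 := fun v hv h => hv (hEi (h.trans hE0.symm))
  have hEs : ∀ (r : ℝ) v, E (r • v) = r • E v := by
    intro r v; ext i; fin_cases i <;> rfl
  have hN : ∀ v, v ≠ 0 → ‖E v‖⁻¹ • E v ∈ sphere (0 : EuclideanSpace ℝ (Fin 2)) 1 := by
    intro v hv
    rw [mem_sphere_zero_iff_norm, norm_smul, norm_inv, norm_norm,
      inv_mul_cancel₀ (norm_ne_zero_iff.2 (hEne v hv))]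
  classical
  let u₀ : Circle2 := ⟨_, hN (1, 0) (by simp)⟩
  let N : ℝ × ℝ → Circle2 := fun v => if hv : v = 0 then u₀ else ⟨_, hN v hv⟩
  have hNv : ∀ v, v ≠ 0 → (N v : EuclideanSpace ℝ (Fin 2)) = ‖E v‖⁻¹ • E v := by
    intro v hv
    simp only [N, dif_neg hv]
  refine ⟨fun v => (φ.symm (N v) : M), ?_, ?_, ?_, ?_, ?_⟩
  · refine (continuous_subtype_val.comp φ.symm.continuous).comp_continuousOn ?_
    rw [IsEmbedding.subtypeVal.continuousOn_iff]
    have h1 : ContinuousOn (fun v => ‖E v‖⁻¹ • E v) {0}ᶜ :=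
      ((hE.norm.continuousOn).inv₀ fun v hv => norm_ne_zero_iff.2 (hEne v hv)).smul hE.continuousOn
    exact h1.congr fun v hv => hNv v hv
  · intro r v hr
    congr 2
    by_cases hv : v = 0
    · simp [hv]
    · apply Subtype.ext
      rw [hNv _ (smul_ne_zero hr.ne' hv), hNv v hv, hEs, norm_smul, Real.norm_of_nonneg hr.le,
        smul_smul, mul_inv_rev, mul_assoc, inv_mul_cancel₀ hr.ne', mul_one]
  · exact fun v _ => (φ.symm (N v)).2
  · intro v hv w hw h
    have hv0 : v ≠ 0 := ne_of_mem_sphere hv one_ne_zero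
    have hw0 : w ≠ 0 := ne_of_mem_sphere hw one_ne_zero
    have h1 := congrArg Subtype.val (φ.symm.injective (Subtype.ext h))
    rw [hNv v hv0, hNv w hw0] at h1
    have hvp : 0 < ‖E v‖ := norm_pos_iff.2 (hEne v hv0)
    have hwp : 0 < ‖E w‖ := norm_pos_iff.2 (hEne w hw0)
    have h2 : v = (‖E v‖ * ‖E w‖⁻¹) • w := by
      apply hEi
      rw [hEs, mul_smul, ← h1, smul_smul, mul_inv_cancel₀ hvp.ne', one_smul]
    rw [mem_sphere_zero_iff_norm] at hv hw
    have h3 := congrArg norm h2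
    rw [norm_smul, hv, hw, mul_one, Real.norm_of_nonneg (by positivity)] at h3
    rw [h2, ← h3, one_smul]
  · intro x hx
    set u := φ ⟨x, hx⟩ with hu
    let v : ℝ × ℝ := (u.1 0, u.1 1)
    have hEv : E v = u.1 := by ext i; fin_cases i <;> rfl
    have hu1 : ‖u.1‖ = 1 := mem_sphere_zero_iff_norm.1 u.2
    have hv : v ≠ 0 := by
      intro h
      rw [← hEv, h, hE0, norm_zero] at hu1
      exact zero_ne_one hu1
    have hvp := norm_pos_iff.2 hv
    refine ⟨‖v‖⁻¹ • v, ?_, ?_⟩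
    · rw [mem_sphere_zero_iff_norm, norm_smul, norm_inv, norm_norm, inv_mul_cancel₀ hvp.ne']
    · have : N (‖v‖⁻¹ • v) = u := by
        apply Subtype.ext
        rw [hNv _ (smul_ne_zero (inv_ne_zero hvp.ne') hv), hEs, norm_smul, hEv, hu1, norm_inv,
          norm_norm, mul_one, inv_inv, smul_smul, mul_inv_cancel₀ hvp.ne', one_smul]
      simp only [this, hu, φ.symm_apply_apply]

variable {M : Type*} [TopologicalSpace M] {C : Set M} {γ : ℝ × ℝ → M}

lemma IsLoop.isCompact (hγ : IsLoop C γ) : IsCompact C := by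
  rw [← hγ.bij.image_eq]
  exact (isCompact_sphere _ _).image_of_continuousOn
    (hγ.cont.mono fun v hv => ne_of_mem_sphere hv one_ne_zero)

lemma IsLoop.mem (hγ : IsLoop C γ) {v : ℝ × ℝ} (hv : v ≠ 0) : γ v ∈ C := by
  have h := norm_pos_iff.2 hv
  rw [← hγ.smul ‖v‖⁻¹ v (inv_pos.2 h)]
  refine hγ.bij.mapsTo ?_
  rw [mem_sphere_zero_iff_norm, norm_smul, norm_inv, norm_norm, inv_mul_cancel₀ h.ne']

lemma IsLoop.eq_of (hγ : IsLoop C γ) {v w : ℝ × ℝ} (hv : v ≠ 0) (hn : ‖v‖ = ‖w‖)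
    (h : γ v = γ w) : v = w := by
  have h1 := norm_pos_iff.2 hv
  have h2 : ‖v‖⁻¹ • v = ‖v‖⁻¹ • w := by
    refine hγ.bij.injOn ?_ ?_ (by rw [hγ.smul _ _ (inv_pos.2 h1), hγ.smul _ _ (inv_pos.2 h1), h])
    · rw [mem_sphere_zero_iff_norm, norm_smul, norm_inv, norm_norm, inv_mul_cancel₀ h1.ne']
    · rw [mem_sphere_zero_iff_norm, norm_smul, norm_inv, norm_norm, ← hn, inv_mul_cancel₀ h1.ne']
  exact smul_right_injective _ (inv_ne_zero h1.ne') h2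

/-- The union of an embedded copy of `M` at height one and the cone over `C`. -/
def coneSet {E : Type*} [AddCommGroup E] [Module ℝ E] (C : Set M) (ι : M → E) : Set (ℝ × E) :=
  {p | (∃ x, p = (1, ι x)) ∨ ∃ t ∈ Icc (0 : ℝ) 1, ∃ c ∈ C, p = (t, t • ι c)}

lemma exists_isCap_of_isEmbedding {E : Type} [NormedAddCommGroup E] [NormedSpace ℝ E]
    {ι : M → E} (hι : IsEmbedding ι) (hγ : IsLoop C γ) :
    ∃ (i : M → coneSet C ι) (j : ℝ × ℝ → coneSet C ι), IsCap C γ i j := by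
  classical
  have hCne : C.Nonempty := ⟨_, hγ.mem (v := (1, 0)) (by simp)⟩
  obtain ⟨c₀, hc₀⟩ := hCne
  let i : M → coneSet C ι := fun x => ⟨(1, ι x), Or.inl ⟨x, rfl⟩⟩
  let f : ℝ × ℝ → ℝ × E := fun v => (‖v‖, ‖v‖ • ι (γ v))
  have hf : ∀ v ∈ closedBall (0 : ℝ × ℝ) 1, f v ∈ coneSet C ι := by
    intro v hv
    rw [mem_closedBall_zero_iff] at hv
    refine Or.inr ⟨‖v‖, ⟨norm_nonneg _, hv⟩, ?_⟩
    by_cases hv0 : v = 0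
    · exact ⟨c₀, hc₀, by simp [f, hv0]⟩
    · exact ⟨γ v, hγ.mem hv0, rfl⟩
  let j : ℝ × ℝ → coneSet C ι := fun v =>
    if hv : v ∈ closedBall (0 : ℝ × ℝ) 1 then ⟨f v, hf v hv⟩ else i c₀
  have hj : ∀ v ∈ closedBall (0 : ℝ × ℝ) 1, (j v : ℝ × E) = f v := by
    intro v hv
    simp only [j, dif_pos hv]
  have hie : IsEmbedding i := by
    refine IsEmbedding.of_comp ?_ continuous_subtype_val ?_
    · exact Continuous.subtype_mk (continuous_const.prodMk hι.continuous) _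
    · exact (isEmbedding_prodMkRight (1 : ℝ)).comp hι
  refine ⟨i, j, ⟨hie, ?_⟩, ?_, ?_, ?_, ?_, ?_⟩
  · have : range i = {p | p.1.1 = 1} := by
      ext p
      constructor
      · rintro ⟨x, rfl⟩
        rfl
      · intro hp
        obtain ⟨x, hx⟩ | ⟨t, ht, c, hc, hx⟩ := p.2
        · exact ⟨x, Subtype.ext hx.symm⟩
        · have h1 : p.1.1 = 1 := hp
          rw [hx] at h1
          obtain rfl : t = 1 := h1
          exact ⟨c, Subtype.ext (by rw [hx, one_smul])⟩
    rw [this]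
    exact isClosed_singleton.preimage (continuous_fst.comp continuous_subtype_val)
  · rw [IsEmbedding.subtypeVal.continuousOn_iff]
    refine ContinuousOn.congr ?_ fun v hv => hj v hv
    refine continuous_norm.continuousOn.prodMk fun v _ => ContinuousAt.continuousWithinAt ?_
    by_cases hv0 : v = 0
    · subst hv0
      obtain ⟨B, hB⟩ := (hγ.isCompact.image hι.continuous).isBounded.exists_norm_le
      rw [ContinuousAt, norm_zero, zero_smul]
      refine squeeze_zero_norm (a := fun v : ℝ × ℝ => ‖v‖ * B) (fun v => ?_) ?_
      · by_cases hv0 : v = 0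
        · simp [hv0]
        · rw [norm_smul, norm_norm]
          exact mul_le_mul_of_nonneg_left (hB _ ⟨_, hγ.mem hv0, rfl⟩) (norm_nonneg _)
      · have : Continuous fun v : ℝ × ℝ => ‖v‖ * B := by fun_prop
        simpa using this.tendsto 0
    · have h1 : ContinuousAt γ v := hγ.cont.continuousAt (isOpen_compl_singleton.mem_nhds hv0)
      exact continuous_norm.continuousAt.smul (hι.continuous.continuousAt.comp h1)
  · intro v hv w hw h
    have h1 := congrArg Subtype.val h
    rw [hj v hv, hj w hw] at h1
    have hn : ‖v‖ = ‖w‖ := congrArg Prod.fst h1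
    by_cases hv0 : v = 0
    · rw [hv0, norm_zero] at hn
      rw [hv0, norm_eq_zero.1 hn.symm]
    · refine hγ.eq_of hv0 hn (hι.injective ?_)
      have h2 : ‖v‖ • ι (γ v) = ‖w‖ • ι (γ w) := congrArg Prod.snd h1
      rw [← hn] at h2
      exact smul_right_injective _ (norm_ne_zero_iff.2 hv0) h2
  · intro v hv
    apply Subtype.ext
    rw [hj v (sphere_subset_closedBall hv)]
    rw [mem_sphere_zero_iff_norm] at hv
    simp [f, i, hv]
  · intro v hv x h
    have h1 := congrArg Subtype.val h
    rw [hj v (ball_subset_closedBall hv)] at h1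
    have h2 : ‖v‖ = 1 := congrArg Prod.fst h1
    rw [mem_ball_zero_iff] at hv
    exact hv.ne h2
  · intro p
    obtain ⟨x, hx⟩ | ⟨t, ht, c, hc, hx⟩ := p.2
    · exact Or.inl ⟨x, Subtype.ext hx.symm⟩
    · right
      obtain ⟨v, hv, rfl⟩ := hγ.bij.surjOn hc
      rw [mem_sphere_zero_iff_norm] at hv
      have hn : ‖t • v‖ = t := by rw [norm_smul, hv, mul_one, Real.norm_of_nonneg ht.1]
      have hm : t • v ∈ closedBall (0 : ℝ × ℝ) 1 := by
        rw [mem_closedBall_zero_iff, hn]; exact ht.2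
      refine ⟨t • v, hm, Subtype.ext ?_⟩
      rw [hj _ hm, hx]
      rcases ht.1.eq_or_lt with h0 | h0
      · simp [f, ← h0]
      · simp only [f, hn, hγ.smul t v h0]

lemma exists_isCap [T3Space M] [SecondCountableTopology M] (hγ : IsLoop C γ) :
    ∃ (S : Type) (_ : TopologicalSpace S) (_ : T2Space S) (_ : NormalSpace S) (i : M → S)
      (j : ℝ × ℝ → S), IsCap C γ i j := by
  obtain ⟨ι, hι⟩ := TopologicalSpace.exists_embedding_l_infty M
  exact ⟨coneSet C ι, inferInstance, inferInstance, inferInstance,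
    exists_isCap_of_isEmbedding hι hγ⟩

variable {S : Type*} [TopologicalSpace S] {i : M → S} {j : ℝ × ℝ → S}

lemma IsCap.sigmaCompactSpace [SigmaCompactSpace M] (h : IsCap C γ i j) :
    SigmaCompactSpace S := by
  refine isSigmaCompact_univ_iff.1 ?_
  have h1 : (univ : Set S) = range i ∪ j '' closedBall 0 1 :=
    (eq_univ_of_forall fun p => h.cover p).symm
  rw [h1, union_eq_iUnion]
  refine isSigmaCompact_iUnion _ fun b => ?_
  cases b
  · exact ((isCompact_closedBall _ _).image_of_continuousOn h.cont).isSigmaCompact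
  · exact isSigmaCompact_range h.emb.continuous

lemma IsCap.connectedSpace [ConnectedSpace M] (h : IsCap C γ i j) : ConnectedSpace S := by
  refine connectedSpace_iff_univ.2 ?_
  have h1 : (univ : Set S) = range i ∪ j '' closedBall 0 1 :=
    (eq_univ_of_forall fun p => h.cover p).symm
  rw [h1]
  have hmem : ((1, 0) : ℝ × ℝ) ∈ sphere (0 : ℝ × ℝ) 1 := by
    rw [mem_sphere_zero_iff_norm]; simp [Prod.norm_def]
  refine (isConnected_range h.emb.continuous).union ?_
    (((convex_closedBall _ _).isConnected ⟨0, by simp⟩).image j h.cont)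
  exact ⟨j (1, 0), ⟨_, (h.eq _ hmem).symm⟩, _, sphere_subset_closedBall hmem, rfl⟩

lemma IsCap.noncompactSpace (hM : ¬ CompactSpace M) (h : IsCap C γ i j) : NoncompactSpace S := by
  have := not_compactSpace_iff.1 hM
  exact h.emb.noncompactSpace

variable [T2Space S]

lemma IsCap.isOpen_of (h : IsCap C γ i j) {P : Set S} (h1 : IsOpen (i ⁻¹' P)) {V : Set (ℝ × ℝ)}
    (hV : IsOpen V) (h2 : ∀ v ∈ closedBall (0 : ℝ × ℝ) 1, j v ∈ P ↔ v ∈ V) : IsOpen P := by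
  have h3 : Pᶜ = i '' (i ⁻¹' P)ᶜ ∪ j '' (closedBall 0 1 \ V) := by
    ext p
    constructor
    · intro hp
      rcases h.cover p with ⟨x, rfl⟩ | ⟨v, hv, rfl⟩
      · exact Or.inl ⟨x, hp, rfl⟩
      · exact Or.inr ⟨v, ⟨hv, fun hv' => hp ((h2 v hv).2 hv')⟩, rfl⟩
    · rintro (⟨x, hx, rfl⟩ | ⟨v, hv, rfl⟩)
      · exact hx
      · exact fun hp => hv.2 ((h2 v hv.1).1 hp)
  rw [← isClosed_compl_iff, h3]
  exact (h.emb.isClosedMap _ h1.isClosed_compl).union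
    (((isCompact_closedBall _ _).diff hV).image_of_continuousOn (h.cont.mono sdiff_subset)).isClosed

omit [T2Space S] in
lemma IsCap.mem_sphere (h : IsCap C γ i j) {v : ℝ × ℝ} (hv : v ∈ closedBall (0 : ℝ × ℝ) 1) {x : M}
    (hx : j v = i x) : v ∈ sphere (0 : ℝ × ℝ) 1 := by
  rw [← ball_union_sphere] at hv
  rcases hv with hv | hv
  · exact absurd hx (h.notMem v hv x)
  · exact hv

lemma IsCap.isCell (h : IsCap C γ i j) : IsCell j where
  cont := h.cont
  inj := h.inj
  isOpen := by
    have h1 : i ⁻¹' (j '' ball 0 1) = ∅ := by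
      refine eq_empty_of_forall_notMem ?_
      rintro x ⟨v, hv, hx⟩
      exact h.notMem v hv x hx
    refine h.isOpen_of (V := ball 0 1) (h1 ▸ isOpen_empty) isOpen_ball fun v hv => ?_
    refine ⟨?_, fun hv' => ⟨v, hv', rfl⟩⟩
    rintro ⟨w, hw, hwv⟩
    rwa [← h.inj (ball_subset_closedBall hw) hv hwv]

lemma IsCap.isOpen_image (hγ : IsLoop C γ) (h : IsCap C γ i j) {O : Set M} (hO : IsOpen O)
    (hOC : Disjoint O C) : IsOpen (i '' O) := by
  refine h.isOpen_of (by rwa [preimage_image_eq _ h.emb.injective]) isOpen_empty fun v hv => ?_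
  refine iff_of_false ?_ (notMem_empty v)
  rintro ⟨x, hx, hxv⟩
  have h1 := h.mem_sphere hv hxv.symm
  rw [h.eq v h1] at hxv
  rw [h.emb.injective hxv] at hx
  exact hOC.le_bot ⟨hx, hγ.bij.mapsTo h1⟩

lemma IsCell.exists_subcell {η : ℝ × ℝ → S} (h : IsCell η) {v : ℝ × ℝ}
    (hv : v ∈ ball (0 : ℝ × ℝ) 1) {U : Set S} (hU : U ∈ 𝓝 (η v)) :
    ∃ κ : ℝ × ℝ → S, IsCell κ ∧ κ '' closedBall 0 1 ⊆ U ∧ κ 0 = η v := by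
  have h1 : ball (0 : ℝ × ℝ) 1 ∩ η ⁻¹' U ∈ 𝓝 v :=
    inter_mem (isOpen_ball.mem_nhds hv) ((h.cont.continuousAt
      (mem_of_superset (isOpen_ball.mem_nhds hv) ball_subset_closedBall)).preimage_mem_nhds hU)
  obtain ⟨δ, hδ, hb⟩ := nhds_basis_closedBall.mem_iff.1 h1
  let a : ℝ × ℝ → ℝ × ℝ := fun w => v + δ • w
  have ha : Continuous a := by fun_prop
  have hai : Function.Injective a := fun w w' hw =>
    smul_right_injective _ hδ.ne' (add_left_cancel hw)
  have hm : MapsTo a (closedBall 0 1) (ball 0 1 ∩ η ⁻¹' U) := by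
    intro w hw
    refine hb ?_
    rw [mem_closedBall_zero_iff] at hw
    rw [mem_closedBall_iff_norm, add_sub_cancel_left, norm_smul, Real.norm_of_nonneg hδ.le]
    exact mul_le_of_le_one_right hδ.le hw
  have hao : IsOpen (a '' ball 0 1) := by
    have : a = (Homeomorph.addLeft v) ∘ (Homeomorph.smulOfNeZero δ hδ.ne') := rfl
    rw [this]
    exact (Homeomorph.isOpenMap _).comp (Homeomorph.isOpenMap _) _ isOpen_ball
  refine ⟨η ∘ a, ⟨?_, ?_, ?_⟩, ?_, by simp [a]⟩
  · exact h.cont.comp ha.continuousOn fun w hw => ball_subset_closedBall (hm hw).1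
  · exact h.inj.comp hai.injOn fun w hw => ball_subset_closedBall (hm hw).1
  · rw [image_comp]
    refine h.isOpen_image hao ?_
    rintro _ ⟨w, hw, rfl⟩
    exact (hm (ball_subset_closedBall hw)).1
  · rintro _ ⟨w, hw, rfl⟩
    exact (hm hw).2

omit [T2Space S] in
lemma IsCell.image_closedBall_mem_nhds {η : ℝ × ℝ → S} (h : IsCell η) :
    η '' closedBall 0 1 ∈ 𝓝 (η 0) :=
  mem_of_superset (h.isOpen.mem_nhds ⟨0, by simp, rfl⟩) (image_mono ball_subset_closedBall)

end Capping

section Glued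

variable {M : Type*} [TopologicalSpace M] {C : Set M} {γ : ℝ × ℝ → M}
  {S : Type*} [TopologicalSpace S] [T2Space S] {i : M → S} {j : ℝ × ℝ → S}

lemma mem_closedBall_iff_abs {v : ℝ × ℝ} :
    v ∈ closedBall (0 : ℝ × ℝ) 1 ↔ |v.1| ≤ 1 ∧ |v.2| ≤ 1 := by
  rw [mem_closedBall_zero_iff, norm_prod_le_iff, Real.norm_eq_abs, Real.norm_eq_abs]

lemma mem_ball_iff_abs {v : ℝ × ℝ} : v ∈ ball (0 : ℝ × ℝ) 1 ↔ |v.1| < 1 ∧ |v.2| < 1 := by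
  rw [mem_ball_zero_iff, Prod.norm_def, max_lt_iff, Real.norm_eq_abs, Real.norm_eq_abs]

/-- A half-square in `M` extends to a square in the capped surface. -/
lemma IsCap.exists_glued [T2Space M] (hγ : IsLoop C γ) (h : IsCap C γ i j) {ψ : ℝ × ℝ → M}
    (hψ : IsHalfCell C ψ) :
    ∃ G : ℝ × ℝ → S, IsCell G ∧ (∀ v ∈ halfSq, G v = i (ψ v)) ∧
      ∀ v ∈ closedBall (0 : ℝ × ℝ) 1, v.1 < 0 → ∃ u ∈ ball (0 : ℝ × ℝ) 1, G v = j u := by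
  set w : ℝ → ℝ × ℝ := fun y => Function.invFunOn γ (sphere 0 1) (ψ (0, y)) with hwdef
  have h0 : ∀ y, |y| ≤ 1 → ((0, y) : ℝ × ℝ) ∈ halfSq := fun y hy =>
    ⟨mem_closedBall_iff_abs.2 ⟨by simp, hy⟩, le_refl (0 : ℝ)⟩
  have hwC : ∀ y, |y| ≤ 1 → ψ (0, y) ∈ γ '' sphere 0 1 := fun y hy => by
    rw [hγ.bij.image_eq]
    exact (hψ.mem_iff _ (h0 y hy)).2 rfl
  have hws : ∀ y, |y| ≤ 1 → w y ∈ sphere (0 : ℝ × ℝ) 1 := fun y hy =>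
    Function.invFunOn_mem (hwC y hy)
  have hwn : ∀ y, |y| ≤ 1 → ‖w y‖ = 1 := fun y hy => mem_sphere_zero_iff_norm.1 (hws y hy)
  have hwγ : ∀ y, |y| ≤ 1 → γ (w y) = ψ (0, y) := fun y hy => Function.invFunOn_eq (hwC y hy)
  have hwc : ContinuousOn w {y | |y| ≤ 1} := by
    refine (continuousOn_invFunOn_of_isCompact (isCompact_sphere _ _)
      (hγ.cont.mono fun v hv => ne_of_mem_sphere hv one_ne_zero) hγ.bij.injOn).comp
      (hψ.cont.comp (by fun_prop) h0) hwC
  set B : ℝ × ℝ → ℝ × ℝ := fun v => (1 + v.1 / 2) • w v.2 with hB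
  have hBn : ∀ v ∈ closedBall (0 : ℝ × ℝ) 1, ‖B v‖ = 1 + v.1 / 2 := by
    intro v hv
    obtain ⟨h1, h2⟩ := mem_closedBall_iff_abs.1 hv
    rw [abs_le] at h1
    rw [hB, norm_smul, hwn _ h2, mul_one, Real.norm_of_nonneg (by linarith)]
  have hBγ : ∀ v ∈ closedBall (0 : ℝ × ℝ) 1, γ (B v) = ψ (0, v.2) := by
    intro v hv
    obtain ⟨h1, h2⟩ := mem_closedBall_iff_abs.1 hv
    rw [abs_le] at h1
    rw [hB, hγ.smul _ _ (by linarith), hwγ _ h2]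
  have hBcB : ∀ v ∈ closedBall (0 : ℝ × ℝ) 1, v.1 ≤ 0 → B v ∈ closedBall (0 : ℝ × ℝ) 1 := by
    intro v hv hv0
    rw [mem_closedBall_zero_iff, hBn v hv]; linarith
  have hBb : ∀ v ∈ closedBall (0 : ℝ × ℝ) 1, v.1 < 0 → B v ∈ ball (0 : ℝ × ℝ) 1 := by
    intro v hv hv0
    rw [mem_ball_zero_iff, hBn v hv]; linarith
  have hB0 : ∀ v ∈ closedBall (0 : ℝ × ℝ) 1, B v ≠ 0 := by
    intro v hv h
    have h1 := hBn v hv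
    obtain ⟨h2, -⟩ := mem_closedBall_iff_abs.1 hv
    rw [abs_le] at h2
    rw [h, norm_zero] at h1
    linarith
  classical
  set G : ℝ × ℝ → S := fun v => if 0 ≤ v.1 then i (ψ v) else j (B v) with hG
  have hGp : ∀ v : ℝ × ℝ, 0 ≤ v.1 → G v = i (ψ v) := fun v hv => if_pos hv
  have hGn' : ∀ v : ℝ × ℝ, v.1 < 0 → G v = j (B v) := fun v hv => if_neg hv.not_ge
  have hGn : ∀ v ∈ closedBall (0 : ℝ × ℝ) 1, v.1 ≤ 0 → G v = j (B v) := by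
    intro v hv hv0
    rcases hv0.lt_or_eq with h1 | h1
    · exact hGn' v h1
    · rw [hGp v h1.ge, h.eq (B v) (by rw [mem_sphere_zero_iff_norm, hBn v hv, h1]; simp), hBγ v hv,
        ← h1]
  have hcont : ContinuousOn G (closedBall 0 1) := by
    have h1 : closedBall (0 : ℝ × ℝ) 1 = halfSq ∪ (closedBall 0 1 ∩ {v | v.1 ≤ 0}) := by
      rw [halfSq, ← inter_union_distrib_left]
      refine (inter_eq_left.2 fun v _ => ?_).symm
      exact le_total 0 v.1
    rw [h1]
    refine ContinuousOn.union_of_isClosed ?_ ?_ ?_ ?_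
    · exact (h.emb.continuous.comp_continuousOn hψ.cont).congr fun v hv => hGp v hv.2
    · refine ContinuousOn.congr ?_ fun v hv => hGn v hv.1 hv.2
      refine h.cont.comp ?_ fun v hv => hBcB v hv.1 hv.2
      refine ContinuousOn.smul (f := fun v : ℝ × ℝ => 1 + v.1 / 2) (by fun_prop)
        (hwc.comp continuous_snd.continuousOn fun v hv => ?_)
      exact (mem_closedBall_iff_abs.1 hv.1).2
    · exact isClosed_closedBall.inter (isClosed_le continuous_const continuous_fst)
    · exact isClosed_closedBall.inter (isClosed_le continuous_fst continuous_const)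
  refine ⟨G, ⟨hcont, ?_, ?_⟩, fun v hv => hGp v hv.2, fun v hv hv0 =>
    ⟨B v, hBb v hv hv0, hGn' v hv0⟩⟩
  · intro v hv v' hv' hvv
    rcases le_or_gt 0 v.1 with h1 | h1 <;> rcases le_or_gt 0 v'.1 with h2 | h2
    · rw [hGp v h1, hGp v' h2] at hvv
      exact hψ.inj ⟨hv, h1⟩ ⟨hv', h2⟩ (h.emb.injective hvv)
    · rw [hGp v h1, hGn' v' h2] at hvv
      exact absurd hvv.symm (h.notMem _ (hBb v' hv' h2) _)
    · rw [hGn' v h1, hGp v' h2] at hvv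
      exact absurd hvv (h.notMem _ (hBb v hv h1) _)
    · rw [hGn' v h1, hGn' v' h2] at hvv
      have h3 := h.inj (hBcB v hv h1.le) (hBcB v' hv' h2.le) hvv
      have h4 := hBn v hv
      have h5 := hBγ v hv
      rw [h3, hBn v' hv'] at h4
      rw [h3, hBγ v' hv'] at h5
      have h6 := hψ.inj (h0 _ (mem_closedBall_iff_abs.1 hv').2)
        (h0 _ (mem_closedBall_iff_abs.1 hv).2) h5
      refine Prod.ext (by linarith) (congrArg Prod.snd h6).symm
  · set O := ψ '' (ball 0 1 ∩ {v | 0 ≤ v.1}) with hO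
    have h1 : i ⁻¹' (G '' ball 0 1) = O := by
      ext x
      constructor
      · rintro ⟨v, hv, hvx⟩
        rcases le_or_gt 0 v.1 with h1 | h1
        · rw [hGp v h1] at hvx
          exact ⟨v, ⟨hv, h1⟩, h.emb.injective hvx⟩
        · rw [hGn' v h1] at hvx
          exact absurd hvx (h.notMem _ (hBb v (ball_subset_closedBall hv) h1) _)
      · rintro ⟨v, ⟨hv, hv0⟩, rfl⟩
        exact ⟨v, hv, hGp v hv0⟩
    have hV : IsOpen ({v : ℝ × ℝ | 1 / 2 < ‖v‖} ∩ ({0}ᶜ ∩ γ ⁻¹' O)) :=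
      (isOpen_lt continuous_const continuous_norm).inter
        (hγ.cont.isOpen_inter_preimage isOpen_compl_singleton hψ.isOpen)
    refine h.isOpen_of (h1 ▸ hψ.isOpen) hV fun u hu => ⟨?_, ?_⟩
    · rintro ⟨v, hv, hvu⟩
      have hv' := ball_subset_closedBall hv
      obtain ⟨ha, hb⟩ := mem_ball_iff_abs.1 hv
      rw [abs_lt] at ha
      have hy : ψ (0, v.2) ∈ O := by
        refine ⟨(0, v.2), ⟨mem_ball_iff_abs.2 ⟨by simp, hb⟩, le_refl (0 : ℝ)⟩, rfl⟩
      rcases le_or_gt v.1 0 with h2 | h2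
      · rw [hGn v hv' h2] at hvu
        have h3 := h.inj (hBcB v hv' h2) hu hvu
        subst h3
        refine ⟨?_, hB0 v hv', ?_⟩
        · change 1 / 2 < ‖B v‖
          rw [hBn v hv']; linarith
        · rwa [mem_preimage, hBγ v hv']
      · rw [hGp v h2.le] at hvu
        have h3 := h.mem_sphere hu hvu.symm
        rw [h.eq u h3] at hvu
        refine absurd ((hψ.mem_iff v ⟨hv', h2.le⟩).1 ?_) h2.ne'
        rw [h.emb.injective hvu]
        exact hγ.bij.mapsTo h3
    · rintro ⟨hu1, hu0, v, ⟨hv, hv0⟩, hvu⟩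
      have hv' := ball_subset_closedBall hv
      obtain ⟨ha, hb⟩ := mem_ball_iff_abs.1 hv
      have hvC : v.1 = 0 := (hψ.mem_iff v ⟨hv', hv0⟩).1 (hvu ▸ hγ.mem hu0)
      rw [mem_closedBall_zero_iff] at hu
      have hu1' : 1 / 2 < ‖u‖ := hu1
      have hv2 : ((2 * (‖u‖ - 1), v.2) : ℝ × ℝ) ∈ ball (0 : ℝ × ℝ) 1 := by
        rw [mem_ball_iff_abs, abs_lt]
        exact ⟨⟨by simp only; linarith, by simp only; linarith⟩, hb⟩
      refine ⟨_, hv2, ?_⟩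
      rw [hGn _ (ball_subset_closedBall hv2) (by simp only; linarith)]
      congr 1
      refine hγ.eq_of (hB0 _ (ball_subset_closedBall hv2)) ?_ ?_
      · rw [hBn _ (ball_subset_closedBall hv2)]; simp only; ring
      · rw [hBγ _ (ball_subset_closedBall hv2), ← hvu]
        congr 1
        exact Prod.ext hvC.symm rfl

variable [ChartedSpace (EuclideanHalfSpace 2) M] [T2Space M]

lemma IsCap.surf (hC : ∃ x ∈ surfaceBoundary M, C = connectedComponentIn (surfaceBoundary M) x)
    (hγ : IsLoop C γ) (h : IsCap C γ i j) : Surf S := by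
  have key : ∀ η : ℝ × ℝ → S, IsCell η → ∀ v ∈ ball (0 : ℝ × ℝ) 1, ∀ U ∈ 𝓝 (η v),
      ∃ κ : ℝ × ℝ → S, IsCell κ ∧ κ '' closedBall 0 1 ⊆ U ∧ κ '' closedBall 0 1 ∈ 𝓝 (η v) := by
    intro η hη v hv U hU
    obtain ⟨κ, h1, h2, h3⟩ := hη.exists_subcell hv hU
    exact ⟨κ, h1, h2, h3 ▸ h1.image_closedBall_mem_nhds⟩
  have hiC : ∀ x, x ∈ C → ∀ U ∈ 𝓝 (i x),
      ∃ κ : ℝ × ℝ → S, IsCell κ ∧ κ '' closedBall 0 1 ⊆ U ∧ κ '' closedBall 0 1 ∈ 𝓝 (i x) := by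
    intro x hx U hU
    obtain ⟨ψ, h1, -, h2, -⟩ := exists_isHalfCell hC hx univ_mem
    obtain ⟨G, h3, h4, -⟩ := h.exists_glued hγ h1
    have h5 : G 0 = i x := by rw [h4 0 ⟨by simp, le_refl (0 : ℝ)⟩, h2]
    rw [← h5] at hU ⊢
    exact key G h3 0 (by simp) U hU
  intro p U hU
  rcases h.cover p with ⟨x, rfl⟩ | ⟨v, hv, rfl⟩
  · by_cases hx : x ∈ C
    · exact hiC x hx U hU
    · have h1 : i ⁻¹' U ∩ Cᶜ ∈ 𝓝 x := inter_mem (h.emb.continuous.continuousAt hU)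
        (hγ.isCompact.isClosed.isOpen_compl.mem_nhds hx)
      obtain ⟨η, h2, h3, h4⟩ := surf_of_chartedSpace x _ h1
      refine ⟨i ∘ η, ⟨h.emb.continuous.comp_continuousOn h2.cont,
        h.emb.injective.comp_injOn h2.inj, ?_⟩, ?_, ?_⟩
      · rw [image_comp]
        refine h.isOpen_image hγ h2.isOpen ?_
        rw [disjoint_left]
        intro y hy
        exact (h3 (image_mono ball_subset_closedBall hy)).2
      · rintro _ ⟨v, hv, rfl⟩
        exact (h3 ⟨v, hv, rfl⟩).1
      · rw [image_comp]
        refine mem_of_superset ((h.isOpen_image hγ isOpen_interior ?_).mem_nhds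
          ⟨x, mem_interior_iff_mem_nhds.2 h4, rfl⟩) (image_mono interior_subset)
        rw [disjoint_left]
        intro y hy
        exact (h3 (interior_subset hy)).2
  · rw [← ball_union_sphere] at hv
    rcases hv with hv | hv
    · exact key j h.isCell v hv U hU
    · rw [h.eq v hv] at hU ⊢
      exact hiC _ (hγ.bij.mapsTo hv) U hU

/-- The glued disc can be pushed into its interior. -/
lemma IsCap.exists_homeo_into_ball
    (hC : ∃ x ∈ surfaceBoundary M, C = connectedComponentIn (surfaceBoundary M) x)
    (hγ : IsLoop C γ) (h : IsCap C γ i j) :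
    ∃ Ψ : S ≃ₜ S, ∀ v ∈ closedBall (0 : ℝ × ℝ) 1, Ψ (j v) ∈ j '' ball 0 1 := by
  have key : ∃ Ψ : S ≃ₜ S, (∀ p ∈ j '' ball 0 1, Ψ p ∈ j '' ball 0 1) ∧
      (∀ x ∈ C, Ψ (i x) = i x ∨ Ψ (i x) ∈ j '' ball 0 1) ∧
      ∀ x ∈ C, x ∈ C → Ψ (i x) ∈ j '' ball 0 1 := by
    refine hγ.isCompact.induction_on (p := fun K => ∃ Ψ : S ≃ₜ S,
      (∀ p ∈ j '' ball 0 1, Ψ p ∈ j '' ball 0 1) ∧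
      (∀ x ∈ C, Ψ (i x) = i x ∨ Ψ (i x) ∈ j '' ball 0 1) ∧
      ∀ x ∈ C, x ∈ K → Ψ (i x) ∈ j '' ball 0 1)
      ?_ ?_ ?_ ?_
    · exact ⟨Homeomorph.refl S, fun p hp => hp, fun x _ => Or.inl rfl, fun x _ hx => hx.elim⟩
    · rintro K K' hK ⟨Ψ, h1, h2, h3⟩
      exact ⟨Ψ, h1, h2, fun x hx hx' => h3 x hx (hK hx')⟩
    · rintro K K' ⟨Ψ, h1, h2, h3⟩ ⟨Φ, h4, h5, h6⟩
      refine ⟨Ψ.trans Φ, fun p hp => h4 _ (h1 p hp), fun x hx => ?_, fun x hx hxK => ?_⟩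
      · rw [Homeomorph.trans_apply]
        rcases h2 x hx with h7 | h7
        · rw [h7]
          exact h5 x hx
        · exact Or.inr (h4 _ h7)
      · rw [Homeomorph.trans_apply]
        rcases hxK with hxK | hxK
        · exact h4 _ (h3 x hx hxK)
        · rcases h2 x hx with h7 | h7
          · rw [h7]
            exact h6 x hx hxK
          · exact h4 _ h7
    · intro x hx
      obtain ⟨ψ, h1, -, h2, -⟩ := exists_isHalfCell hC hx univ_mem
      obtain ⟨G, h3, h4, h5⟩ := h.exists_glued hγ h1
      set b : ℝ × ℝ := (-(1 / 2), 0) with hb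
      have hbn : ‖b‖ < 1 := by
        simp only [hb, Prod.norm_def, norm_neg, norm_zero, max_lt_iff]
        norm_num
      obtain ⟨Ψ, h6, h7⟩ := h3.exists_homeo (continuous_push b).continuousOn (bijOn_push hbn)
        (push_of_mem_sphere b)
      have hin : ∀ v ∈ ball (0 : ℝ × ℝ) 1, v.1 ≤ 0 → Ψ (G v) ∈ j '' ball 0 1 := by
        intro v hv hv0
        have hv' := ball_subset_closedBall hv
        rw [h6 v hv']
        obtain ⟨u, hu, hGu⟩ := h5 (push b v) ((bijOn_push hbn).mapsTo hv') (by
          rw [mem_ball_zero_iff] at hv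
          simp only [push, hb, Prod.fst_add, Prod.smul_fst, smul_eq_mul]
          linarith)
        exact ⟨u, hu, hGu.symm⟩
      have hC' : ∀ x ∈ C, i x ∈ G '' ball 0 1 → Ψ (i x) ∈ j '' ball 0 1 := by
        rintro y hy ⟨v, hv, hvy⟩
        rw [← hvy]
        refine hin v hv ?_
        by_contra! hv0
        have hvh : v ∈ halfSq := ⟨ball_subset_closedBall hv, hv0.le⟩
        rw [h4 v hvh] at hvy
        exact hv0.ne' ((h1.mem_iff v hvh).1 (h.emb.injective hvy ▸ hy))
      refine ⟨ψ '' (ball 0 1 ∩ {v | 0 ≤ v.1}), mem_nhdsWithin_of_mem_nhds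
        (h1.isOpen.mem_nhds ⟨0, by simp, h2⟩), Ψ, fun p hp => ?_, fun y hy => ?_, fun y hy hyK => ?_⟩
      · by_cases hpG : p ∈ G '' ball 0 1
        · obtain ⟨v, hv, rfl⟩ := hpG
          refine hin v hv ?_
          by_contra! hv0
          obtain ⟨u, hu, hu'⟩ := hp
          rw [h4 v ⟨ball_subset_closedBall hv, hv0.le⟩] at hu'
          exact h.notMem u hu _ hu'
        · rwa [h7 p hpG]
      · by_cases hpG : i y ∈ G '' ball 0 1
        · exact Or.inr (hC' y hy hpG)
        · exact Or.inl (h7 _ hpG)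
      · obtain ⟨v, hv, rfl⟩ := hyK
        exact hC' _ hy ⟨v, hv.1, h4 v ⟨ball_subset_closedBall hv.1, hv.2⟩⟩
  obtain ⟨Ψ, h1, -, h3⟩ := key
  refine ⟨Ψ, fun v hv => ?_⟩
  rw [← ball_union_sphere] at hv
  rcases hv with hv | hv
  · exact h1 _ ⟨v, hv, rfl⟩
  · rw [h.eq v hv]
    exact h3 _ (hγ.bij.mapsTo hv) (hγ.bij.mapsTo hv)

end Glued

section Placement

variable {S : Type*} [TopologicalSpace S] [T2Space S] {j m : ℝ × ℝ → S}

lemma IsMobius.isCell (hS : Surf S) (hm : IsMobius m) :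
    IsCell fun v => m ((1 / 4 : ℝ) • v) := by
  have hs : ∀ v ∈ closedBall (0 : ℝ × ℝ) 1, |((1 / 4 : ℝ) • v).1| ≤ 1 / 4 ∧
      |((1 / 4 : ℝ) • v).2| ≤ 1 / 4 := by
    intro v hv
    obtain ⟨h1, h2⟩ := mem_closedBall_iff_abs.1 hv
    simp only [Prod.smul_fst, Prod.smul_snd, smul_eq_mul, abs_mul]
    rw [abs_of_pos (by norm_num : (0 : ℝ) < 1 / 4)]
    constructor <;> linarith
  refine ⟨(hm.cont.comp (by fun_prop)).continuousOn, ?_, ?_⟩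
  · have h1 : InjOn m {p : ℝ × ℝ | |p.1| ≤ 1 / 4 ∧ |p.2| ≤ 1 / 4} := by
      refine hm.injOn (fun p hp => ?_) fun p hp q hq => ?_
      · have := hp.2
        change |p.2| ≤ 1
        linarith
      · have h2 := abs_le.1 hp.1
        have h3 := abs_le.1 hq.1
        rw [abs_lt]
        constructor <;> linarith
    exact h1.comp (smul_right_injective _ (by norm_num : (1 / 4 : ℝ) ≠ 0)).injOn hs
  · have h1 : (fun v => m ((1 / 4 : ℝ) • v)) '' ball 0 1 =
        m '' ((fun v : ℝ × ℝ => (1 / 4 : ℝ) • v) '' ball 0 1) := by rw [image_image]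
    rw [h1]
    refine hm.isOpen_image hS ?_ ?_
    · exact (Homeomorph.smulOfNeZero (1 / 4 : ℝ) (by norm_num)).isOpenMap _ isOpen_ball
    · rintro _ ⟨v, hv, rfl⟩
      have := (hs v (ball_subset_closedBall hv)).2
      change |((1 / 4 : ℝ) • v).2| < 1
      linarith

lemma IsMobius.exists_homeo_into (hS : Surf S) [ConnectedSpace S] (hm : IsMobius m)
    (hj : IsCell j) {Φ : S ≃ₜ S} (hΦ : ∀ v ∈ closedBall (0 : ℝ × ℝ) 1, Φ (j v) ∈ j '' ball 0 1) :
    ∃ Ψ : S ≃ₜ S, ∀ v ∈ closedBall (0 : ℝ × ℝ) 1, Ψ (j v) ∈ m '' ostrip (1 / 2) := by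
  obtain ⟨Ψ, hΨ⟩ := hS.exists_homeo_center hj (hm.isCell hS)
  rw [smul_zero] at hΨ
  -- the image of the disc lies in a smaller concentric disc
  have hr : ∃ r < 1, 0 ≤ r ∧ ∀ v ∈ closedBall (0 : ℝ × ℝ) 1, ∃ u ∈ closedBall (0 : ℝ × ℝ) 1,
      ‖u‖ ≤ r ∧ Φ (j v) = j u := by
    set K := closedBall (0 : ℝ × ℝ) 1
    set f : ℝ × ℝ → ℝ × ℝ := fun v => Function.invFunOn j K (Φ (j v))
    have hsub : ∀ v ∈ K, Φ (j v) ∈ j '' K := fun v hv => image_mono ball_subset_closedBall (hΦ v hv)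
    have hf : ContinuousOn f K :=
      (continuousOn_invFunOn_of_isCompact (isCompact_closedBall _ _) hj.cont hj.inj).comp
        (Φ.continuous.comp_continuousOn hj.cont) hsub
    obtain ⟨v₀, hv₀, hmax⟩ := (isCompact_closedBall (0 : ℝ × ℝ) 1).exists_isMaxOn
      ⟨0, by simp⟩ hf.norm
    refine ⟨‖f v₀‖, ?_, norm_nonneg _, fun v hv => ⟨f v, Function.invFunOn_mem (hsub v hv),
      hmax hv, (Function.invFunOn_eq (hsub v hv)).symm⟩⟩
    obtain ⟨u, hu, hu'⟩ := hΦ v₀ hv₀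
    have : f v₀ = u := by
      simp only [f, ← hu']
      exact hj.inj.leftInvOn_invFunOn (ball_subset_closedBall hu)
    rw [this]
    exact mem_ball_zero_iff.1 hu
  obtain ⟨r, hr1, hr0, hr⟩ := hr
  have hε : ∃ ε > 0, ∀ v : ℝ × ℝ, ‖v‖ < ε → Ψ (j v) ∈ m '' ostrip (1 / 2) := by
    have hO : IsOpen (m '' ostrip (1 / 2)) := hm.isOpen_image hS (isOpen_ostrip _)
      fun p (hp : |p.2| < 1 / 2) => show |p.2| < 1 by linarith
    have h0 : Ψ (j 0) ∈ m '' ostrip (1 / 2) := by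
      rw [hΨ]
      exact ⟨0, by simp [ostrip], rfl⟩
    have hc : ContinuousAt (fun v => Ψ (j v)) 0 := Ψ.continuous.continuousAt.comp
      (hj.cont.continuousAt (closedBall_mem_nhds _ one_pos))
    obtain ⟨ε, hε, hb⟩ := Metric.mem_nhds_iff.1 (hc.preimage_mem_nhds (hO.mem_nhds h0))
    exact ⟨ε, hε, fun v hv => hb (mem_ball_zero_iff.2 hv)⟩
  obtain ⟨ε, hε, hεm⟩ := hε
  obtain ⟨k, hk⟩ := exists_pow_lt_of_lt_one hε hr1
  obtain ⟨Θ, hΘ, -⟩ := hj.exists_homeo (continuous_squeeze k).continuousOn (bijOn_squeeze k)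
    (squeeze_of_mem_sphere k)
  refine ⟨(Φ.trans Θ).trans Ψ, fun v hv => ?_⟩
  obtain ⟨u, hu, hur, huv⟩ := hr v hv
  rw [Homeomorph.trans_apply, Homeomorph.trans_apply, huv, hΘ u hu]
  refine hεm _ ?_
  rw [norm_squeeze]
  calc ‖u‖ ^ (k + 1) ≤ r ^ (k + 1) := pow_le_pow_left₀ (norm_nonneg _) hur _
    _ ≤ r ^ k := pow_le_pow_of_le_one hr0 hr1.le (Nat.le_succ k)
    _ < ε := hk

/-- The angle function can be normalized on a disc. -/
lemma IsMobius.exists_winds_one [NormalSpace S] [SigmaCompactSpace S] [PreconnectedSpace S]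
    [NoncompactSpace S] (hS : Surf S) (hm : IsMobius m) (hj : IsCell j) :
    ∃ θ : S → Circle, Continuous θ ∧ Winds θ m ∧
      ∀ v ∈ closedBall (0 : ℝ × ℝ) 1, θ (j v) = 1 := by
  obtain ⟨θ, hθ, v, d, hv, hd, hvθ, hvd⟩ := hm.exists_winds hS
  let ρ : ℝ × ℝ → ℝ × ℝ := fun p => (max (-1) (min 1 p.1), max (-1) (min 1 p.2))
  have hρ : Continuous ρ := by fun_prop
  have hρm : ∀ p, ρ p ∈ closedBall (0 : ℝ × ℝ) 1 := by
    intro p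
    rw [mem_closedBall_iff_abs, abs_le, abs_le]
    refine ⟨⟨le_max_left _ _, max_le (by norm_num) (min_le_left _ _)⟩,
      ⟨le_max_left _ _, max_le (by norm_num) (min_le_left _ _)⟩⟩
  have hρe : ∀ p ∈ closedBall (0 : ℝ × ℝ) 1, ρ p = p := by
    intro p hp
    rw [mem_closedBall_iff_abs, abs_le, abs_le] at hp
    exact Prod.ext (by simp [ρ, hp.1.1, hp.1.2]) (by simp [ρ, hp.2.1, hp.2.2])
  obtain ⟨F, hF, hFθ⟩ := exists_circle_lift
    (hθ.comp (hj.cont.comp_continuous hρ hρm) : Continuous (θ ∘ (j ∘ ρ)))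
  set D := j '' closedBall 0 1
  have hD : IsClosed D := hj.isCompact_image.isClosed
  have hinv : ContinuousOn (Function.invFunOn j (closedBall 0 1)) D :=
    continuousOn_invFunOn_of_isCompact (isCompact_closedBall _ _) hj.cont hj.inj
  obtain ⟨g, hg⟩ := ContinuousMap.exists_restrict_eq hD
    ⟨D.domRestrict (F ∘ Function.invFunOn j (closedBall 0 1)),
      continuousOn_iff_continuous_domRestrict.1 (hF.comp_continuousOn hinv)⟩
  have hgj : ∀ p ∈ closedBall (0 : ℝ × ℝ) 1, g (j p) = F p := by
    intro p hp
    have h1 := congrArg (fun f : C(D, ℝ) => f ⟨j p, p, hp, rfl⟩) hg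
    have h2 : g (j p) = F (Function.invFunOn j (closedBall 0 1) (j p)) := h1
    rwa [hj.inj.leftInvOn_invFunOn hp] at h2
  refine ⟨fun x => θ x * Circle.exp (-g x), ?_, ⟨fun s => v s - g (m (s, 0)), d, ?_, hd, ?_, ?_⟩,
    ?_⟩
  · exact hθ.mul (Circle.exp.continuous.comp g.continuous.neg)
  · exact hv.sub (g.continuous.comp (hm.cont.comp (by fun_prop)))
  · intro s
    simp only [hvθ, sub_eq_add_neg, Circle.exp_add]
  · intro s
    have h1 := hm.twist s 0
    have h2 := hm.twist (s + 1) 0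
    rw [neg_zero] at h1 h2
    have h3 : m (s + 2, 0) = m (s, 0) := by rw [← h1, ← h2]; congr 2; ring
    simp only [hvd, h3]
    ring
  · intro p hp
    have h1 := hFθ p
    simp only [Function.comp_apply, hρe p hp] at h1
    simp only [hgj p hp, ← h1, ← Circle.exp_add, add_neg_cancel, Circle.exp_zero]

lemma exists_capped {M : Type*} [TopologicalSpace M] [T2Space M] [SigmaCompactSpace M]
    [ChartedSpace (EuclideanHalfSpace 2) M] [ConnectedSpace M] (hnc : ¬ CompactSpace M)
    {A : Set M} (e : A ≃ₜ MobiusBand) {C : Set M}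
    (hC : ∃ x ∈ surfaceBoundary M, C = connectedComponentIn (surfaceBoundary M) x)
    (φ : C ≃ₜ Circle2) :
    ∃ (S : Type) (_ : TopologicalSpace S) (_ : T2Space S) (γ : ℝ × ℝ → M) (i : M → S)
      (j m : ℝ × ℝ → S) (θ : S → Circle), IsLoop C γ ∧ IsCap C γ i j ∧ Surf S ∧ IsMobius m ∧
      (∀ v ∈ closedBall (0 : ℝ × ℝ) 1, j v ∈ m '' ostrip (1 / 2)) ∧ Continuous θ ∧ Winds θ m ∧
      ∀ v ∈ closedBall (0 : ℝ × ℝ) 1, θ (j v) = 1 := by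
  have := (modelWithCornersEuclideanHalfSpace 2).secondCountableTopology
  have := (modelWithCornersEuclideanHalfSpace 2).locallyCompactSpace
  have := ChartedSpace.secondCountable_of_sigmaCompact (EuclideanHalfSpace 2) M
  have := ChartedSpace.locallyCompactSpace (EuclideanHalfSpace 2) M
  obtain ⟨γ, hγ⟩ := exists_isLoop φ
  obtain ⟨S, _, _, _, i, j, h⟩ := exists_isCap hγ
  have hS := h.surf hC hγ
  have := h.sigmaCompactSpace
  have := h.connectedSpace
  have := h.noncompactSpace hnc
  obtain ⟨m, hm⟩ := exists_isMobius e
  obtain ⟨Φ, hΦ⟩ := h.exists_homeo_into_ball hC hγ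
  have hm1 : IsMobius (i ∘ m) := hm.comp h.emb.continuous h.emb.injective
  obtain ⟨Ψ, hΨ⟩ := hm1.exists_homeo_into hS h.isCell hΦ
  have hm2 : IsMobius (Ψ.symm ∘ (i ∘ m)) := hm1.comp Ψ.symm.continuous Ψ.symm.injective
  obtain ⟨θ, h1, h2, h3⟩ := hm2.exists_winds_one hS h.isCell
  refine ⟨S, inferInstance, inferInstance, γ, i, j, _, θ, hγ, h, hS, hm2, fun v hv => ?_, h1, h2,
    h3⟩
  obtain ⟨p, hp, hpv⟩ := hΨ v hv
  exact ⟨p, hp, by rw [Function.comp_apply, hpv, Ψ.symm_apply_apply]⟩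

end Placement

lemma exists_pos_tendsto_zero (M : Type*) [TopologicalSpace M] [T2Space M] [SigmaCompactSpace M]
    [LocallyCompactSpace M] :
    ∃ ε : M → ℝ, Continuous ε ∧ (∀ x, 0 < ε x ∧ ε x < 1) ∧ Tendsto ε (cocompact M) (𝓝 0) := by
  let K : CompactExhaustion M := default
  obtain ⟨ε, hε⟩ := exists_continuous_forall_mem_convex_of_local_const
    (t := fun x : M => Ioo (0 : ℝ) (1 / ((K.find x : ℝ) + 1))) (fun x => convex_Ioo _ _) (fun x => by
      refine ⟨1 / ((K.find x : ℝ) + 3), ?_⟩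
      have hx : x ∈ interior (K (K.find x + 1)) := K.subset_interior_succ _ (K.mem_find x)
      filter_upwards [isOpen_interior.mem_nhds hx] with y hy
      have h1 : K.find y ≤ K.find x + 1 := K.mem_iff_find_le.1 (interior_subset hy)
      have h2 : (K.find y : ℝ) ≤ K.find x + 1 := by exact_mod_cast h1
      refine ⟨by positivity, one_div_lt_one_div_of_lt (by positivity) (by linarith)⟩)
  refine ⟨ε, ε.continuous, fun x => ⟨(hε x).1, (hε x).2.trans_le ?_⟩, ?_⟩
  · rw [div_le_one (by positivity)]
    have : (0 : ℝ) ≤ K.find x := by positivity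
    linarith
  · rw [Metric.tendsto_nhds]
    intro r hr
    obtain ⟨n, hn⟩ := exists_nat_one_div_lt hr
    filter_upwards [(K.isCompact n).compl_mem_cocompact] with x hx
    have h1 : n ≤ K.find x := by
      by_contra h
      exact hx (K.mem_iff_find_le.2 (by omega))
    have h2 : (n : ℝ) ≤ K.find x := by exact_mod_cast h1
    rw [Real.dist_eq, sub_zero, abs_of_pos (hε x).1]
    refine ((hε x).2.trans_le ?_).trans hn
    exact one_div_le_one_div_of_le (by positivity) (by linarith)

/-- Homeomorphisms that preserve `C` and change `θ` by a phase which has a lift to `ℝ`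
vanishing on `C` and at infinity. -/
def phaseSet {M : Type*} [TopologicalSpace M] (C : Set M) (θ : M → Circle) : Set (M ≃ₜ M) :=
  {g | (∀ x ∈ C, g x ∈ C) ∧ ∃ Λ : M → ℝ, Continuous Λ ∧
    (∀ x, Circle.exp (Λ x) * θ x = θ (g x)) ∧ (∀ x ∈ C, Λ x = 0) ∧ Tendsto Λ (cocompact M) (𝓝 0)}

section
variable {M : Type*} [TopologicalSpace M]

lemma mem_phaseSet_of_lift {C : Set M} {θ : M → Circle} {f g : M ≃ₜ M} (hf : ∀ x ∈ C, f x ∈ C)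
    (hg : g ∈ phaseSet C θ) {Δ : M → ℝ} (hΔ : Continuous Δ)
    (h : ∀ x, Circle.exp (Δ x) * θ (g x) = θ (f x)) (h0 : ∀ x ∈ C, Δ x = 0)
    (hlim : Tendsto Δ (cocompact M) (𝓝 0)) : f ∈ phaseSet C θ := by
  obtain ⟨-, Λ, hΛ, h1, h2, h3⟩ := hg
  refine ⟨hf, fun x => Δ x + Λ x, hΔ.add hΛ, fun x => ?_, fun x hx => ?_, ?_⟩
  · rw [Circle.exp_add, mul_assoc, h1, h]
  · simp [h0 x hx, h2 x hx]
  · simpa using hlim.add h3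

lemma refl_mem_phaseSet (C : Set M) (θ : M → Circle) : Homeomorph.refl M ∈ phaseSet C θ :=
  ⟨fun _ hx => hx, fun _ => 0, continuous_const, fun x => by simp, fun _ _ => rfl,
    tendsto_const_nhds⟩

lemma circle_mem_slitPlane {z : Circle} (hz : dist z 1 < 1) : (z : ℂ) ∈ Complex.slitPlane := by
  have h1 : ‖(z : ℂ) - 1‖ < 1 := by
    have h2 : dist (z : ℂ) ((1 : Circle) : ℂ) < 1 := hz
    rwa [dist_eq_norm, Circle.coe_one] at h2
  left
  have h2 := (abs_lt.1 ((Complex.abs_re_le_norm _).trans_lt h1)).1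
  simp at h2
  linarith

/-- Homeomorphisms close enough to each other at infinity differ by a phase with a small lift. -/
lemma exists_phase_of_close [LocallyCompactSpace M] {C : Set M} {θ : M → Circle}
    (hθ : Continuous θ) (hθC : ∀ x ∈ C, θ x = 1) {f g : M ≃ₜ M} {ε : M → ℝ}
    (hε : ∀ x, ε x < 1) (hε0 : Tendsto ε (cocompact M) (𝓝 0))
    (h : ∀ x, dist (θ (f x) / θ (g x)) 1 < ε x)
    (hf : ∀ x ∈ C, f x ∈ C) (hg : ∀ x ∈ C, g x ∈ C) :
    ∃ Δ : M → ℝ, Continuous Δ ∧ (∀ x, Circle.exp (Δ x) * θ (g x) = θ (f x)) ∧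
      (∀ x ∈ C, Δ x = 0) ∧ Tendsto Δ (cocompact M) (𝓝 0) := by
  have hc : Continuous fun x => θ (f x) / θ (g x) :=
    (hθ.comp f.continuous).div' (hθ.comp g.continuous)
  refine ⟨fun x => Complex.arg (θ (f x) / θ (g x) : Circle), ?_, fun x => ?_, fun x hx => ?_, ?_⟩
  · rw [continuous_iff_continuousAt]
    intro x
    have h1 := Complex.continuousAt_arg (circle_mem_slitPlane ((h x).trans (hε x)))
    exact h1.comp (f := fun x => ((θ (f x) / θ (g x) : Circle) : ℂ))
      (isEmbedding_circle_coe.continuous.comp hc).continuousAt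
  · rw [Circle.exp_arg, div_mul_cancel]
  · simp [hθC _ (hf x hx), hθC _ (hg x hx)]
  · have h1 : Tendsto (fun x => θ (f x) / θ (g x)) (cocompact M) (𝓝 1) := by
      rw [tendsto_iff_dist_tendsto_zero]
      exact squeeze_zero (fun _ => dist_nonneg) (fun x => (h x).le) hε0
    have h2 : ContinuousAt (fun z : Circle => Complex.arg z) 1 :=
      ContinuousAt.comp (f := fun z : Circle => (z : ℂ)) (g := Complex.arg)
        (Complex.continuousAt_arg (by simp)) isEmbedding_circle_coe.continuous.continuousAt
    have h3 := h2.tendsto.comp h1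
    simpa [Function.comp_def] using h3

lemma isOpen_graph_subset {U : Set (M × M)} (hU : IsOpen U) :
    IsOpen {f : M ≃ₜ M | ∀ x, (x, f x) ∈ U} :=
  TopologicalSpace.isOpen_generateFrom_of_mem ⟨U, hU, rfl⟩

variable [T2Space M] [SigmaCompactSpace M] [ChartedSpace (EuclideanHalfSpace 2) M]

lemma exists_nhds_phaseSet_iff [LocallyCompactSpace M] {C : Set M}
    (hC : ∃ x ∈ surfaceBoundary M, C = connectedComponentIn (surfaceBoundary M) x)
    (hK : IsCompact C) {θ : M → Circle} (hθ : Continuous θ) (hθC : ∀ x ∈ C, θ x = 1)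
    (g : M ≃ₜ M) : ∀ᶠ f in 𝓝 g, (f ∈ phaseSet C θ ↔ g ∈ phaseSet C θ) := by
  obtain ⟨ε, hεc, hε, hε0⟩ := exists_pos_tendsto_zero M
  obtain ⟨W, hW, hCW, hWC⟩ := exists_isOpen_inter_surfaceBoundary hC
  have hCb : C ⊆ surfaceBoundary M := by
    obtain ⟨x, -, rfl⟩ := hC
    exact connectedComponentIn_subset _ _
  rcases homeo_image_component hC g with hg | hg
  · let U : Set (M × M) := {p | dist (θ p.2 / θ (g p.1)) 1 < ε p.1} ∩ {p | p.1 ∈ Cᶜ ∨ p.2 ∈ W}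
    have hU : IsOpen U := by
      refine (isOpen_lt (((hθ.comp continuous_snd).div'
        (hθ.comp (g.continuous.comp continuous_fst))).dist continuous_const)
        (hεc.comp continuous_fst)).inter ?_
      exact (hK.isClosed.isOpen_compl.preimage continuous_fst).union (hW.preimage continuous_snd)
    have hgU : ∀ x, (x, g x) ∈ U := fun x => by
      refine ⟨?_, ?_⟩
      · simpa using (hε x).1
      · by_cases hx : x ∈ C
        · exact Or.inr (hCW (hg x hx))
        · exact Or.inl hx
    filter_upwards [(isOpen_graph_subset hU).mem_nhds hgU] with f hf
    have hfC : ∀ x ∈ C, f x ∈ C := fun x hx => by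
      rcases (hf x).2 with h | h
      · exact absurd hx h
      · exact hWC _ h ((homeo_mem_surfaceBoundary_iff f x).2 (hCb hx))
    obtain ⟨Δ, h1, h2, h3, h4⟩ := exists_phase_of_close hθ hθC (fun x => (hε x).2) hε0
      (fun x => (hf x).1) hfC hg
    refine ⟨fun h => ?_, fun h => mem_phaseSet_of_lift hfC h h1 h2 h3 h4⟩
    refine mem_phaseSet_of_lift (Δ := fun x => -Δ x) hg h h1.neg (fun x => ?_)
      (fun x hx => by simp [h3 x hx])
      (by simpa using h4.neg)
    rw [← h2, ← mul_assoc, ← Circle.exp_add]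
    simp
  · have hU : IsOpen {p : M × M | p.1 ∈ Cᶜ ∨ p.2 ∈ Cᶜ} :=
      (hK.isClosed.isOpen_compl.preimage continuous_fst).union
        (hK.isClosed.isOpen_compl.preimage continuous_snd)
    have hgU : ∀ x, (x, g x) ∈ {p : M × M | p.1 ∈ Cᶜ ∨ p.2 ∈ Cᶜ} := fun x => by
      by_cases hx : x ∈ C
      · exact Or.inr (hg x hx)
      · exact Or.inl hx
    filter_upwards [(isOpen_graph_subset hU).mem_nhds hgU] with f hf
    obtain ⟨x, hx⟩ : C.Nonempty := by
      obtain ⟨x, hx, rfl⟩ := hC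
      exact ⟨x, mem_connectedComponentIn hx⟩
    refine iff_of_false (fun h => ?_) (fun h => hg x hx (h.1 x hx))
    rcases hf x with h' | h'
    · exact h' hx
    · exact h' (h.1 x hx)

lemma H0_subset_phaseSet [LocallyCompactSpace M] {C : Set M}
    (hC : ∃ x ∈ surfaceBoundary M, C = connectedComponentIn (surfaceBoundary M) x)
    (hK : IsCompact C) {θ : M → Circle} (hθ : Continuous θ) (hθC : ∀ x ∈ C, θ x = 1) :
    H0 M ⊆ phaseSet C θ := by
  have h := exists_nhds_phaseSet_iff hC hK hθ hθC
  refine IsClopen.connectedComponent_subset ⟨⟨?_⟩, ?_⟩ (refl_mem_phaseSet C θ)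
  · rw [isOpen_iff_mem_nhds]
    intro g hg
    filter_upwards [h g] with f hf hf'
    exact hg (hf.1 hf')
  · rw [isOpen_iff_mem_nhds]
    intro g hg
    filter_upwards [h g] with f hf
    exact hf.2 hg

end

lemma eq_const_of_discrete {M : Type*} [TopologicalSpace M] [PreconnectedSpace M] {A O : Set M}
    (hA : IsClosed A) (hO : IsOpen O) (hOA : O ⊆ A) (hne : (A \ O).Nonempty) {Λ : M → ℝ}
    (hΛ : Continuous Λ) {c : ℝ} (hc : ∀ x ∈ A \ O, Λ x = c)
    (hd : ∀ x ∈ A, Λ x = c ∨ 1 ≤ |Λ x - c|) : ∀ x ∈ A, Λ x = c := by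
  have h1 : IsClosed (Oᶜ ∪ A ∩ {x | Λ x = c}) :=
    hO.isClosed_compl.union (hA.inter (isClosed_eq hΛ continuous_const))
  have h2 : (Oᶜ ∪ A ∩ {x | Λ x = c})ᶜ = A ∩ {x | 1 ≤ |Λ x - c|} := by
    ext x
    constructor
    · intro hx
      simp only [mem_compl_iff, mem_union, not_or, not_not] at hx
      have hxA := hOA hx.1
      exact ⟨hxA, (hd x hxA).resolve_left fun h => hx.2 ⟨hxA, h⟩⟩
    · rintro ⟨hxA, hx⟩ hx'
      have h3 : Λ x = c := by
        rcases hx' with h | h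
        · exact hc x ⟨hxA, h⟩
        · exact h.2
      have h4 : 1 ≤ |Λ x - c| := hx
      rw [h3, sub_self, abs_zero] at h4
      linarith
  have h3 : IsClosed (Oᶜ ∪ A ∩ {x | Λ x = c})ᶜ := by
    rw [h2]
    exact hA.inter (isClosed_le continuous_const (hΛ.sub continuous_const).abs)
  have h4 : IsClopen (Oᶜ ∪ A ∩ {x | Λ x = c}) := ⟨h1, isClosed_compl_iff.1 h3⟩
  obtain ⟨a, ha⟩ := hne
  have h5 := h4.eq_univ ⟨a, Or.inl ha.2⟩
  intro x hx
  rcases h5.ge (mem_univ x) with h | h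
  · exact hc x ⟨hx, h⟩
  · exact h.2

lemma eq_or_one_le_of_exp_eq {a b : ℝ} (h : Circle.exp a = Circle.exp b) :
    a = b ∨ 1 ≤ |a - b| := by
  obtain ⟨k, hk⟩ := Circle.exp_eq_exp.1 h
  rcases eq_or_ne k 0 with rfl | h0
  · left; simpa using hk
  · right
    have h1 : (1 : ℝ) ≤ |(k : ℝ)| := by exact_mod_cast Int.one_le_abs h0
    rw [hk, add_sub_cancel_left, abs_mul, abs_of_pos Real.two_pi_pos]
    nlinarith [Real.pi_gt_three]

/-- The angle of the shift that defines the square of the core twist of a Möbius band. -/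
def twistAngle (t : ℝ) : ℝ := max 0 (min 2 (6 - 8 * |t|))

lemma continuous_twistAngle : Continuous twistAngle := by unfold twistAngle; fun_prop

lemma twistAngle_of_le {t : ℝ} (h : |t| ≤ 1 / 2) : twistAngle t = 2 := by
  rw [twistAngle, min_eq_left (by linarith), max_eq_right (by norm_num)]

lemma twistAngle_of_ge {t : ℝ} (h : 3 / 4 ≤ |t|) : twistAngle t = 0 := by
  rw [twistAngle, max_eq_left]
  exact (min_le_right _ _).trans (by linarith)

section
variable {S : Type*} [TopologicalSpace S] {m : ℝ × ℝ → S}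

lemma IsMobius.add_two_mul (hm : IsMobius m) (s t : ℝ) (n : ℕ) : m (s + n * 2, t) = m (s, t) := by
  induction n with
  | zero => simp
  | succ n ih =>
    have h1 := hm.twist (s + n * 2 + 1) (-t)
    rw [neg_neg, hm.twist (s + n * 2) t, ih] at h1
    rw [← h1]
    congr 2
    push_cast
    ring

lemma IsMobius.exists_lift (hm : IsMobius m) {θ : S → Circle} (hθ : Continuous θ)
    (hw : Winds θ m) : ∃ (u : ℝ × ℝ → ℝ) (d : ℝ), d ≠ 0 ∧ Continuous u ∧
      (∀ p, Circle.exp (u p) = θ (m p)) ∧ ∀ s t (n : ℕ), u (s + n * 2, t) = u (s, t) + n * d := by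
  obtain ⟨u, hu, hue⟩ := exists_circle_lift (hθ.comp hm.cont)
  obtain ⟨v, d, hv, hd, hve, hvd⟩ := hw
  obtain ⟨k, hk⟩ := exists_int_of_exp_eq (s := univ) isPreconnected_univ
    (F := fun p : ℝ × ℝ => u (p.1 + 2, p.2)) (G := u) (by fun_prop) hu.continuousOn (fun p _ => by
      rw [hue, hue]
      have := hm.add_two_mul p.1 p.2 1
      simp only [Function.comp_apply]
      rw [← this]
      simp)
  obtain ⟨l, hl⟩ := exists_int_of_exp_eq (s := univ) isPreconnected_univ
    (F := v) (G := fun s => u (s, 0)) hv.continuousOn (by fun_prop) (fun s _ => by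
      rw [hue, ← hve]; rfl)
  have hdk : d = k * (2 * Real.pi) := by
    have h1 := hk (0, 0) trivial
    have h2 := hl 0 trivial
    have h3 := hl 2 trivial
    have h4 := hvd 0
    simp only [zero_add] at h1 h4
    linarith
  refine ⟨u, d, hd, hu, hue, fun s t n => ?_⟩
  induction n with
  | zero => simp
  | succ n ih =>
    have h1 := hk (s + n * 2, t) trivial
    simp only [← hdk] at h1
    have h2 : s + ((n + 1 : ℕ) : ℝ) * 2 = s + n * 2 + 2 := by push_cast; ring
    rw [h2, h1, ih]
    push_cast
    ring

lemma IsMobius.iterate_shift {m : ℝ × ℝ → S} {H : S ≃ₜ S} {τ : ℝ → ℝ}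
    (hH : ∀ s t, |t| ≤ 1 → H (m (s, t)) = m (s + τ t, t)) (n : ℕ) (s : ℝ) {t : ℝ} (ht : |t| ≤ 1) :
    H^[n] (m (s, t)) = m (s + n * τ t, t) := by
  induction n with
  | zero => simp
  | succ n ih =>
    rw [Function.iterate_succ_apply', ih, hH _ _ ht]
    congr 2
    push_cast
    ring

end

/-- A homeomorphism preserving the range of an embedding pulls back along the embedding. -/
lemma exists_homeo_pullback {M S : Type*} [TopologicalSpace M] [TopologicalSpace S] {i : M → S}
    (hi : IsEmbedding i) (H : S ≃ₜ S) (hH : ∀ x, x ∈ range i ↔ H x ∈ range i) :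
    ∃ h : M ≃ₜ M, ∀ x, i (h x) = H (i x) := by
  let e := hi.toHomeomorph
  refine ⟨(e.trans (H.subtype hH)).trans e.symm, fun x => ?_⟩
  change (e (e.symm (H.subtype hH (e x))) : S) = _
  rw [e.apply_symm_apply]
  rfl

lemma iterate_hpow {M S : Type*} [TopologicalSpace M] {i : M → S} {h : M ≃ₜ M} {H : S → S}
    (hi : ∀ x, i (h x) = H (i x)) (n : ℕ) (x : M) : i (hpow h n x) = H^[n] (i x) := by
  induction n with
  | zero => rfl
  | succ n ih =>
    rw [Function.iterate_succ_apply', ← ih, ← hi]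
    rfl

section
variable {M S : Type*} [TopologicalSpace M] [TopologicalSpace S] {C : Set M} {γ : ℝ × ℝ → M}
  {i : M → S} {j m : ℝ × ℝ → S}

lemma IsCap.mem_range_of_notMem (h : IsCap C γ i j) {r : ℝ}
    (hj : ∀ v ∈ closedBall (0 : ℝ × ℝ) 1, j v ∈ m '' ostrip r) {x : S} (hx : x ∉ m '' ostrip r) :
    x ∈ range i := by
  rcases h.cover x with h1 | ⟨v, hv, rfl⟩
  · exact h1
  · exact absurd (hj v hv) hx

lemma IsCap.range_iff_of_fixed (h : IsCap C γ i j) {H : S ≃ₜ S}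
    (hH : ∀ v ∈ closedBall (0 : ℝ × ℝ) 1, H (j v) = j v) (x : S) :
    x ∈ range i ↔ H x ∈ range i := by
  constructor
  · intro hx
    rcases h.cover (H x) with h1 | ⟨v, hv, h1⟩
    · exact h1
    · rw [← hH v hv] at h1
      rw [← h1, hH v hv, H.injective h1]
      exact hx
  · intro hx
    rcases h.cover x with h1 | ⟨v, hv, rfl⟩
    · exact h1
    · rwa [hH v hv] at hx

lemma IsCap.exists_of_mem (hγ : IsLoop C γ) (h : IsCap C γ i j) {x : M} (hx : x ∈ C) :
    ∃ v ∈ closedBall (0 : ℝ × ℝ) 1, j v = i x := by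
  obtain ⟨v, hv, rfl⟩ := hγ.bij.surjOn hx
  exact ⟨v, sphere_subset_closedBall hv, h.eq v hv⟩

/-- The core of the argument: a nontrivial power of the shift does not have a phase lift
vanishing both on the capped circle and at infinity. -/
lemma IsCap.notMem_phaseSet [T2Space S] [ConnectedSpace M] [NoncompactSpace M]
    (hγ : IsLoop C γ) (h : IsCap C γ i j) (hS : Surf S) (hm : IsMobius m)
    (hj : ∀ v ∈ closedBall (0 : ℝ × ℝ) 1, j v ∈ m '' ostrip (1 / 2)) {θ : S → Circle}
    (hθ : Continuous θ) (hw : Winds θ m) (hC : C.Nonempty) {H : S ≃ₜ S}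
    (hH : ∀ s t, |t| ≤ 1 → H (m (s, t)) = m (s + twistAngle t, t))
    (hH' : ∀ x ∉ m '' strip (3 / 4), H x = x) {g : M ≃ₜ M} {n : ℕ}
    (hg : ∀ x, i (g x) = H^[n] (i x)) (hn : 0 < n) : g ∉ phaseSet C (θ ∘ i) := by
  rintro ⟨-, Λ, hΛ, hΛe, hΛC, hΛ0⟩
  obtain ⟨u, d, hd, hu, hue, hud⟩ := hm.exists_lift hθ hw
  simp only [Function.comp_apply, hg] at hΛe
  have hA : ∀ r, IsCompact (i ⁻¹' (m '' strip r)) := fun r =>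
    h.emb.isCompact_preimage (hm.isCompact_strip r)
  have hO : ∀ r ≤ 1, IsOpen (i ⁻¹' (m '' ostrip r)) := fun r hr =>
    (hm.isOpen_image hS (isOpen_ostrip r) fun p hp => lt_of_lt_of_le hp hr).preimage
      h.emb.continuous
  have hOA : ∀ r, i ⁻¹' (m '' ostrip r) ⊆ i ⁻¹' (m '' strip r) := fun r =>
    preimage_mono (image_mono (ostrip_subset_strip le_rfl))
  have hiter := fun s t ht => IsMobius.iterate_shift hH n s (t := t) ht
  have hin : ∀ x ∈ i ⁻¹' (m '' strip (1 / 2)), Circle.exp (Λ x) = Circle.exp 0 := by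
    rintro x ⟨⟨s, t⟩, ht, hx⟩
    have ht' : |t| ≤ 1 / 2 := ht
    have h1 := hΛe x
    rw [← hx, hiter s t (by linarith), twistAngle_of_le ht', hm.add_two_mul] at h1
    simpa using h1
  have hout : ∀ x ∈ (i ⁻¹' (m '' ostrip (3 / 4)))ᶜ, Circle.exp (Λ x) = Circle.exp 0 := by
    intro x hx
    have h1 := hΛe x
    have h2 : H^[n] (i x) = i x := by
      by_cases hx' : i x ∈ m '' strip (3 / 4)
      · obtain ⟨⟨s, t⟩, ht, hxt⟩ := hx'
        have ht' : |t| ≤ 3 / 4 := ht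
        have ht2 : 3 / 4 ≤ |t| := by
          by_contra! h3
          exact hx ⟨(s, t), h3, hxt⟩
        rw [← hxt, hiter s t (by linarith), twistAngle_of_ge ht2]
        simp
      · exact Function.iterate_fixed (hH' _ hx') n
    rw [h2] at h1
    simpa using h1
  let T : Set (ℝ × ℝ) := univ ×ˢ Icc (1 / 2 : ℝ) (3 / 4)
  let b : ℝ × ℝ → M := fun p => Function.invFun i (m p)
  have habs : ∀ p ∈ T, 1 / 2 ≤ |p.2| ∧ |p.2| ≤ 3 / 4 := fun p hp => by
    rw [abs_of_nonneg (by linarith [hp.2.1])]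
    exact hp.2
  have hb : ∀ p ∈ T, i (b p) = m p := fun p hp => by
    refine Function.invFun_eq (h.mem_range_of_notMem hj ?_)
    rw [hm.mem_ostrip_iff (by linarith [(habs p hp).2]) (by norm_num)]
    exact not_lt.2 (habs p hp).1
  have hbc : ContinuousOn b T := by
    rw [h.emb.isInducing.continuousOn_iff]
    exact hm.cont.continuousOn.congr hb
  have hT : IsPreconnected T := isPreconnected_univ.prod isPreconnected_Icc
  obtain ⟨k, hk⟩ := exists_int_of_exp_eq hT (F := fun p => Λ (b p))
    (G := fun p => u (p.1 + n * twistAngle p.2, p.2) - u p) (hΛ.comp_continuousOn hbc)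
    (by have := continuous_twistAngle; fun_prop) (fun p hp => by
      have h1 := hΛe (b p)
      rw [hb p hp, ← Prod.mk.eta (p := p), hiter _ _ (by linarith [(habs p hp).2])] at h1
      rw [Circle.exp_sub, hue, hue, ← h1, Prod.mk.eta, mul_div_cancel_right])
  have hcirc : ∀ r ≤ 1, ∀ x ∈ i ⁻¹' (m '' strip r) \ i ⁻¹' (m '' ostrip r),
      ∃ s, i x = m (s, r) := by
    rintro r hr x ⟨⟨⟨s, t⟩, ht, hx⟩, hx'⟩
    have ht1 : |t| ≤ r := ht
    have ht2 : r ≤ |t| := by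
      by_contra! h3
      exact hx' ⟨(s, t), h3, hx⟩
    rcases abs_choice t with h1 | h1
    · exact ⟨s, by rw [← hx, le_antisymm ht2 ht1, h1]⟩
    · exact ⟨s + 1, by rw [← hx, le_antisymm ht2 ht1, h1, hm.twist]⟩
  have hbmem : ∀ r ∈ Icc (1 / 2 : ℝ) (3 / 4), ((0, r) : ℝ × ℝ) ∈ T := fun r hr => ⟨trivial, hr⟩
  have hbA : ∀ r ∈ Icc (1 / 2 : ℝ) (3 / 4),
      b (0, r) ∈ i ⁻¹' (m '' strip r) \ i ⁻¹' (m '' ostrip r) := by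
    intro r hr
    have h0 : |r| = r := abs_of_nonneg (by linarith [hr.1])
    have h1 : |((0, r) : ℝ × ℝ).2| ≤ 1 := by simp only [h0]; linarith [hr.2]
    refine ⟨?_, ?_⟩
    · rw [mem_preimage, hb _ (hbmem r hr), hm.mem_strip_iff h1 (by linarith [hr.2])]
      exact h0.le
    · rw [mem_preimage, hb _ (hbmem r hr), hm.mem_ostrip_iff h1 (by linarith [hr.2])]
      exact not_lt.2 h0.ge
  have hval : ∀ r ∈ Icc (1 / 2 : ℝ) (3 / 4), ∀ x s, i x = m (s, r) →
      Λ x = u (s + n * twistAngle r, r) - u (s, r) + k * (2 * Real.pi) := by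
    intro r hr x s hx
    have h1 : ((s, r) : ℝ × ℝ) ∈ T := ⟨trivial, hr⟩
    have h2 : b (s, r) = x := h.emb.injective (by rw [hb _ h1, hx])
    rw [← h2]
    exact hk _ h1
  have hr1 : (1 / 2 : ℝ) ∈ Icc (1 / 2 : ℝ) (3 / 4) := by norm_num
  have hr2 : (3 / 4 : ℝ) ∈ Icc (1 / 2 : ℝ) (3 / 4) := by norm_num
  have hc1 : ∀ x ∈ i ⁻¹' (m '' strip (1 / 2)) \ i ⁻¹' (m '' ostrip (1 / 2)),
      Λ x = n * d + k * (2 * Real.pi) := fun x hx => by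
    obtain ⟨s, hs⟩ := hcirc _ (by norm_num) x hx
    rw [hval _ hr1 x s hs, twistAngle_of_le (by norm_num), hud]
    ring
  have hc2 : ∀ x ∈ i ⁻¹' (m '' strip (3 / 4)) \ i ⁻¹' (m '' ostrip (3 / 4)),
      Λ x = k * (2 * Real.pi) := fun x hx => by
    obtain ⟨s, hs⟩ := hcirc _ (by norm_num) x hx
    rw [hval _ hr2 x s hs, twistAngle_of_ge (by norm_num)]
    simp
  have hz1 : n * d + k * (2 * Real.pi) = 0 := by
    have h1 := eq_const_of_discrete ((hm.isCompact_strip _).isClosed.preimage h.emb.continuous)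
      (hO _ (by norm_num)) (hOA _) ⟨_, hbA _ hr1⟩ hΛ hc1 (fun x hx => by
        refine eq_or_one_le_of_exp_eq ?_
        rw [hin x hx, ← hin _ (hbA _ hr1).1, hc1 _ (hbA _ hr1)])
    obtain ⟨x, hx⟩ := hC
    obtain ⟨v, hv, hvx⟩ := h.exists_of_mem hγ hx
    rw [← h1 x (hOA _ (by rw [mem_preimage, ← hvx]; exact hj v hv)), hΛC x hx]
  have hz2 : k * (2 * Real.pi) = 0 := by
    have hd : ((i ⁻¹' (m '' ostrip (3 / 4)))ᶜ \ (i ⁻¹' (m '' strip (3 / 4)))ᶜ) =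
        i ⁻¹' (m '' strip (3 / 4)) \ i ⁻¹' (m '' ostrip (3 / 4)) := by
      rw [compl_sdiff_compl]
    have h1 := eq_const_of_discrete (A := (i ⁻¹' (m '' ostrip (3 / 4)))ᶜ)
      (O := (i ⁻¹' (m '' strip (3 / 4)))ᶜ) (hO _ (by norm_num)).isClosed_compl
      ((hm.isCompact_strip _).isClosed.isOpen_compl.preimage h.emb.continuous)
      (compl_subset_compl.2 (hOA _)) (hd ▸ ⟨_, hbA _ hr2⟩) hΛ (by rwa [hd]) (fun x hx => by
        refine eq_or_one_le_of_exp_eq ?_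
        rw [hout x hx, ← hout _ (hbA _ hr2).2, hc2 _ (hbA _ hr2)])
    refine tendsto_nhds_unique (tendsto_const_nhds.congr' ?_) hΛ0
    filter_upwards [(hA (3 / 4)).compl_mem_cocompact] with x hx
    exact (h1 x fun hx' => hx (hOA _ hx')).symm
  have : (n : ℝ) * d = 0 := by linarith
  rcases mul_eq_zero.1 this with h1 | h1
  · exact hn.ne' (by exact_mod_cast h1)
  · exact hd h1

end

lemma exists_mem_Hc_forall_hpow_notMem {M : Type*} [TopologicalSpace M] [T2Space M]
    [SigmaCompactSpace M] [ChartedSpace (EuclideanHalfSpace 2) M] [ConnectedSpace M]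
    (hnc : ¬ CompactSpace M) {A : Set M} (e : A ≃ₜ MobiusBand) {C : Set M}
    (hC : ∃ x ∈ surfaceBoundary M, C = connectedComponentIn (surfaceBoundary M) x)
    (φ : C ≃ₜ Circle2) : ∃ h ∈ Hc M, ∀ n : ℕ, 0 < n → hpow h n ∉ H0 M := by
  have := (modelWithCornersEuclideanHalfSpace 2).locallyCompactSpace
  have := ChartedSpace.locallyCompactSpace (EuclideanHalfSpace 2) M
  have : NoncompactSpace M := not_compactSpace_iff.1 hnc
  obtain ⟨S, _, _, γ, i, j, m, θ, hγ, hi, hS, hm, hj, hθ, hw, hθj⟩ := exists_capped hnc e hC φ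
  obtain ⟨H, hH, hH'⟩ := hm.exists_shift hS continuous_twistAngle
    (fun t => by rw [twistAngle, twistAngle, abs_neg]) (fun t => twistAngle_of_ge)
  have hfix : ∀ v ∈ closedBall (0 : ℝ × ℝ) 1, H (j v) = j v := fun v hv => by
    obtain ⟨⟨s, t⟩, ht, hp⟩ := hj v hv
    have ht' : |t| < 1 / 2 := ht
    rw [← hp, hH s t (by linarith), twistAngle_of_le ht'.le]
    simpa using hm.add_two_mul s t 1
  obtain ⟨h, hh⟩ := exists_homeo_pullback hi.emb.isEmbedding H (hi.range_iff_of_fixed hfix)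
  have hK : IsCompact (i ⁻¹' (m '' strip (3 / 4))) :=
    hi.emb.isCompact_preimage (hm.isCompact_strip _)
  refine ⟨h, ?_, fun n hn hn0 => ?_⟩
  · refine hK.of_isClosed_subset isClosed_closure (closure_minimal (fun x hx => ?_) hK.isClosed)
    by_contra hx'
    exact hx (hi.emb.injective (by rw [hh, hH' _ hx']))
  · have hCn : C.Nonempty := by
      obtain ⟨x, hx, rfl⟩ := hC
      exact ⟨x, mem_connectedComponentIn hx⟩
    refine hi.notMem_phaseSet hγ hS hm hj hθ hw hCn hH hH' (iterate_hpow hh n) hn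
      (H0_subset_phaseSet hC hγ.isCompact (hθ.comp hi.emb.continuous) (fun x hx => ?_) hn0)
    obtain ⟨v, hv, hvx⟩ := hi.exists_of_mem hγ hx
    rw [Function.comp_apply, ← hvx, hθj v hv]

end SurfaceMCG

variable (M : Type*) [TopologicalSpace M] [T2Space M] [SigmaCompactSpace M]
  [ChartedSpace (EuclideanHalfSpace 2) M] [ConnectedSpace M]

/-- If a σ-compact non-compact connected 2-manifold `M` contains an embedded Möbius band
and its boundary has a connected component homeomorphic to the circle, then the mapping
class group `𝓜_c(M) = 𝓗_c(M)/𝓗₀(M)` contains an element of infinite order. -/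
theorem mcg_infinite_order_of_mobius_and_boundary_circle (hnc : ¬ CompactSpace M)
    (A : Set M) (hA : Nonempty (↥A ≃ₜ MobiusBand))
    (C : Set M)
    (hC : ∃ x ∈ surfaceBoundary M, C = connectedComponentIn (surfaceBoundary M) x)
    (hcirc : Nonempty (↥C ≃ₜ Circle2)) :
    ∃ h ∈ Hc M, ∀ n : ℕ, 0 < n → hpow h n ∉ H0 M := by
  obtain ⟨e⟩ := hA
  obtain ⟨φ⟩ := hcirc
  exact SurfaceMCG.exists_mem_Hc_forall_hpow_notMem hnc e hC φ

end
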